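/- For every natural number n ≥ 1, every k ≥ 1, and every continuous map f ∈ C(S^{2n+1}, Γ_{n+1}⁺), there is a group isomorphism π_k(C(S^{2n+1}, Γ_{n+1}⁺), f) ≅ π_k(Γ_{n+1}⁺, J₀) × π_{2n+k+1}(Γ_{n+1}⁺, J₀). -/

import Mathlib

open Topology

/-- The unit sphere `S^m ⊆ ℝ^{m+1}` centered at the origin. -/
noncomputable def Sph (m : ℕ) : Set (EuclideanSpace ℝ (Fin (m + 1))) :=
  Metric.sphere (0 : EuclideanSpace ℝ (Fin (m + 1))) 1

/-- The north pole `N = (0, …, 0, 1) ∈ S^m`. -/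
noncomputable def northPole (m : ℕ) : Sph m :=
  ⟨EuclideanSpace.single (Fin.last m) (1 : ℝ), by
    simp [Sph, EuclideanSpace.norm_single]⟩

/-- The space `Γ_n` of orthogonal complex structures on `ℝ^{2n}`: real `(2n) × (2n)` matrices
`J` (with `Fin (2n)` identified with `Fin n ⊕ Fin n`) such that `Jᵀ * J = 1` and `J * J = -1`,
with the subspace topology. -/
def Gamma (n : ℕ) : Set (Matrix (Fin n ⊕ Fin n) (Fin n ⊕ Fin n) ℝ) :=
  {J | J.transpose * J = 1 ∧ J * J = -1}

/-- The standard complex structure `J₀` on `ℝ^{2n}`, given by the block matrix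
`[[0, -1], [1, 0]]`. -/
def J0 (n : ℕ) : Matrix (Fin n ⊕ Fin n) (Fin n ⊕ Fin n) ℝ :=
  Matrix.fromBlocks 0 (-1) 1 0

theorem J0_mem (n : ℕ) : J0 n ∈ Gamma n := by
  constructor
  · simp [J0, Matrix.fromBlocks_transpose, Matrix.fromBlocks_multiply, ← Matrix.fromBlocks_one]
  · have h : (-1 : Matrix (Fin n ⊕ Fin n) (Fin n ⊕ Fin n) ℝ)
        = Matrix.fromBlocks (-1) (-0) (-0) (-1) := by
      rw [← Matrix.fromBlocks_neg, Matrix.fromBlocks_one]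
    simp [J0, Matrix.fromBlocks_multiply, h]

/-- `Γ_n⁺`: the path component of the standard complex structure `J₀` in `Γ_n`
(the homogeneous space `SO(2n)/U(n)`). -/
noncomputable def GammaPlus (n : ℕ) : Set (Gamma n) :=
  pathComponent (⟨J0 n, J0_mem n⟩ : Gamma n)

/-- `Γ_n⁺` pointed at `J₀`. -/
noncomputable def J0plus (n : ℕ) : GammaPlus n :=
  ⟨⟨J0 n, J0_mem n⟩, mem_pathComponent_self _⟩

/-! ### Homotopies of families of invertible matrices -/

theorem continuous_matrix_inv {Y ι : Type*} [TopologicalSpace Y] [Fintype ι] [DecidableEq ι]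
    {g : Y → Matrix ι ι ℂ} (hg : Continuous g) (h : ∀ y, (g y).det ≠ 0) :
    Continuous fun y => (g y)⁻¹ := by
  simp only [Matrix.inv_def, Ring.inverse_eq_inv']
  exact ((hg.matrix_det).inv₀ h).smul hg.matrix_adjugate

theorem det_diag_ne_zero {ι κ : Type*} [Fintype ι] [DecidableEq ι] [Fintype κ] [DecidableEq κ]
    {M : Matrix ι ι ℂ} {N : Matrix κ κ ℂ} (hM : M.det ≠ 0) (hN : N.det ≠ 0) :
    (Matrix.fromBlocks M 0 0 N).det ≠ 0 := by
  rw [Matrix.det_fromBlocks_zero₂₁]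
  exact mul_ne_zero hM hN

theorem det_inv_ne_zero {ι : Type*} [Fintype ι] [DecidableEq ι]
    {M : Matrix ι ι ℂ} (hM : M.det ≠ 0) : (M⁻¹).det ≠ 0 :=
  (Matrix.isUnit_nonsing_inv_det M hM.isUnit).ne_zero

/-- Two families `g`, `h` of invertible matrices over `Y` are homotopic through families of
invertible matrices which identify points related by `R`. -/
def InvHomotopic {Y ι : Type*} [TopologicalSpace Y] [Fintype ι] [DecidableEq ι]
    (R : Y → Y → Prop) (g h : Y → Matrix ι ι ℂ) : Prop :=
  ∃ H : ℝ × Y → Matrix ι ι ℂ, Continuous H ∧ (∀ p, (H p).det ≠ 0) ∧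
    (∀ s y y', R y y' → H (s, y) = H (s, y')) ∧ (∀ y, H (0, y) = g y) ∧ ∀ y, H (1, y) = h y

namespace InvHomotopic

variable {Y ι κ : Type*} [TopologicalSpace Y] [Fintype ι] [DecidableEq ι] [Fintype κ]
  [DecidableEq κ] {R : Y → Y → Prop} {g h k : Y → Matrix ι ι ℂ}

theorem of_Icc (H : ℝ × Y → Matrix ι ι ℂ) (hc : Continuous H)
    (hd : ∀ s ∈ Set.Icc (0 : ℝ) 1, ∀ y, (H (s, y)).det ≠ 0)
    (hR : ∀ s ∈ Set.Icc (0 : ℝ) 1, ∀ y y', R y y' → H (s, y) = H (s, y'))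
    (h0 : ∀ y, H (0, y) = g y) (h1 : ∀ y, H (1, y) = h y) : InvHomotopic R g h := by
  have hm : ∀ s : ℝ, max 0 (min s 1) ∈ Set.Icc (0 : ℝ) 1 := fun s =>
    ⟨le_max_left _ _, max_le zero_le_one (min_le_right _ _)⟩
  refine ⟨fun p => H (max 0 (min p.1 1), p.2), by fun_prop, fun p => hd _ (hm _) _,
    fun s y y' hy => hR _ (hm _) _ _ hy, fun y => ?_, fun y => ?_⟩
  · simp [h0]
  · simp [h1]

theorem left (H : InvHomotopic R g h) :
    Continuous g ∧ (∀ y, (g y).det ≠ 0) ∧ ∀ y y', R y y' → g y = g y' := by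
  obtain ⟨H, hc, hd, hR, h0, h1⟩ := H
  simp only [← h0]
  exact ⟨by rw [← funext h0]; fun_prop, fun y => hd _, fun y y' hy => hR _ _ _ hy⟩

theorem refl (hc : Continuous g) (hd : ∀ y, (g y).det ≠ 0) (hR : ∀ y y', R y y' → g y = g y') :
    InvHomotopic R g g :=
  ⟨fun p => g p.2, by fun_prop, fun p => hd _, fun _ => hR, fun _ => rfl, fun _ => rfl⟩

theorem symm (H : InvHomotopic R g h) : InvHomotopic R h g := by
  obtain ⟨H, hc, hd, hR, h0, h1⟩ := H
  exact ⟨fun p => H (1 - p.1, p.2), by fun_prop, fun p => hd _,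
    fun s y y' hy => hR _ _ _ hy, fun y => by simpa using h1 y, fun y => by simpa using h0 y⟩

theorem right (H : InvHomotopic R g h) :
    Continuous h ∧ (∀ y, (h y).det ≠ 0) ∧ ∀ y y', R y y' → h y = h y' :=
  H.symm.left

theorem trans (H : InvHomotopic R g h) (K : InvHomotopic R h k) : InvHomotopic R g k := by
  obtain ⟨H, hc, hd, hR, h0, h1⟩ := H
  obtain ⟨K, kc, kd, kR, k0, k1⟩ := K
  refine ⟨fun p => if p.1 ≤ 1 / 2 then H (2 * p.1, p.2) else K (2 * p.1 - 1, p.2), ?_, fun p => ?_,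
    fun s y y' hy => ?_, fun y => ?_, fun y => ?_⟩
  · refine Continuous.if_le (by fun_prop) (by fun_prop) (by fun_prop) (by fun_prop) ?_
    rintro ⟨s, y⟩ hs
    simp only at hs
    simp [hs, h1, k0]
  · simp only
    split_ifs
    exacts [hd _, kd _]
  · simp only
    split_ifs
    exacts [hR _ _ _ hy, kR _ _ _ hy]
  · simp [h0]
  · norm_num [k1]

theorem mul {g' h' : Y → Matrix ι ι ℂ} (H : InvHomotopic R g h) (K : InvHomotopic R g' h') :
    InvHomotopic R (fun y => g y * g' y) (fun y => h y * h' y) := by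
  obtain ⟨H, hc, hd, hR, h0, h1⟩ := H
  obtain ⟨K, kc, kd, kR, k0, k1⟩ := K
  refine ⟨fun p => H p * K p, hc.matrix_mul kc, fun p => ?_, fun s y y' hy => ?_, fun y => ?_,
    fun y => ?_⟩
  · rw [Matrix.det_mul]
    exact mul_ne_zero (hd _) (kd _)
  · simp only [hR _ _ _ hy, kR _ _ _ hy]
  · simp [h0, k0]
  · simp [h1, k1]

theorem diag {g' h' : Y → Matrix κ κ ℂ} (H : InvHomotopic R g h) (K : InvHomotopic R g' h') :
    InvHomotopic R (fun y => Matrix.fromBlocks (g y) 0 0 (g' y))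
      (fun y => Matrix.fromBlocks (h y) 0 0 (h' y)) := by
  obtain ⟨H, hc, hd, hR, h0, h1⟩ := H
  obtain ⟨K, kc, kd, kR, k0, k1⟩ := K
  refine ⟨fun p => Matrix.fromBlocks (H p) 0 0 (K p),
    hc.matrix_fromBlocks continuous_const continuous_const kc, fun p => ?_,
    fun s y y' hy => ?_, fun y => ?_, fun y => ?_⟩
  · exact det_diag_ne_zero (hd _) (kd _)
  · simp only [hR _ _ _ hy, kR _ _ _ hy]
  · simp [h0, k0]
  · simp [h1, k1]

theorem reindex (e : ι ≃ κ) (H : InvHomotopic R g h) :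
    InvHomotopic R (fun y => Matrix.reindex e e (g y)) (fun y => Matrix.reindex e e (h y)) := by
  obtain ⟨H, hc, hd, hR, h0, h1⟩ := H
  refine ⟨fun p => Matrix.reindex e e (H p), hc.matrix_reindex e e, fun p => ?_,
    fun s y y' hy => ?_, fun y => ?_, fun y => ?_⟩
  · simpa using hd p
  · simp only [hR _ _ _ hy]
  · simp [h0]
  · simp [h1]

/-- The rotation homotopy from `diag (a, b)` to `1`, for `a * b = 1`. -/
theorem whitehead {a b : Y → Matrix ι ι ℂ} (ha : Continuous a) (hb : Continuous b)
    (hab : ∀ y, a y * b y = 1) (haR : ∀ y y', R y y' → a y = a y')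
    (hbR : ∀ y y', R y y' → b y = b y') :
    InvHomotopic R (fun y => Matrix.fromBlocks (a y) 0 0 (b y)) (fun _ => 1) := by
  have had : ∀ y, (a y).det ≠ 0 := fun y h0 => by
    have := congrArg Matrix.det (hab y)
    simp [h0] at this
  have hbd : ∀ y, (b y).det ≠ 0 := fun y h0 => by
    have := congrArg Matrix.det (hab y)
    simp [h0] at this
  have hba : ∀ y, b y * a y = 1 := fun y => mul_eq_one_comm.1 (hab y)
  let U : ℝ × Y → Matrix (ι ⊕ ι) (ι ⊕ ι) ℂ := fun p => Matrix.fromBlocks 1 ((p.1 : ℂ) • a p.2) 0 1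
  let V : ℝ × Y → Matrix (ι ⊕ ι) (ι ⊕ ι) ℂ := fun p =>
    Matrix.fromBlocks 1 0 ((-p.1 : ℂ) • b p.2) 1
  let W : ℝ × Y → Matrix (ι ⊕ ι) (ι ⊕ ι) ℂ := fun p => Matrix.fromBlocks 1 ((-p.1 : ℂ) • 1) 0 1
  let W' : ℝ × Y → Matrix (ι ⊕ ι) (ι ⊕ ι) ℂ := fun p => Matrix.fromBlocks 1 0 ((p.1 : ℂ) • 1) 1
  have cU : Continuous U := Continuous.matrix_fromBlocks (by fun_prop) (by fun_prop) (by fun_prop)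
    (by fun_prop)
  have cV : Continuous V := Continuous.matrix_fromBlocks (by fun_prop) (by fun_prop) (by fun_prop)
    (by fun_prop)
  have cW : Continuous W := Continuous.matrix_fromBlocks (by fun_prop) (by fun_prop) (by fun_prop)
    (by fun_prop)
  have cW' : Continuous W' := Continuous.matrix_fromBlocks (by fun_prop) (by fun_prop)
    (by fun_prop) (by fun_prop)
  refine symm ⟨fun p => U p * V p * U p * (W p * W' p * W p), by fun_prop, fun p => ?_,
    fun s y y' hy => ?_, fun y => ?_, fun y => ?_⟩
  · simp [U, V, W, W', Matrix.det_mul]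
  · simp [U, V, W, W', haR _ _ hy, hbR _ _ hy]
  · simp [U, V, W, W']
  · simp [U, V, W, W', Matrix.fromBlocks_multiply, hab, hba]

end InvHomotopic

/-! ### Families of loops that become constant after stabilization -/

/-- Two points of `X × S¹` are identified when they lie over `A` at the same angle. -/
def LoopRel {X : Type*} (A : Set X) (p q : X × Circle) : Prop :=
  p.1 ∈ A ∧ q.1 ∈ A ∧ p.2 = q.2

/-- A family `g` of invertible matrices over `X × S¹` splits stably if, after adding a family which
depends only on the angle, it becomes homotopic to a family independent of the angle. -/
def SplitsStably {X ι : Type*} [TopologicalSpace X] [Fintype ι] [DecidableEq ι] (A : Set X)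
    (g : X × Circle → Matrix ι ι ℂ) : Prop :=
  ∃ (κ : Type) (_ : Fintype κ) (_ : DecidableEq κ) (μ : Circle → Matrix κ κ ℂ)
    (v : X → Matrix (ι ⊕ κ) (ι ⊕ κ) ℂ),
    InvHomotopic (LoopRel A) (fun p => Matrix.fromBlocks (g p) 0 0 (μ p.2)) (fun p => v p.1)

namespace SplitsStably

variable {X ι κ : Type} [TopologicalSpace X] [Fintype ι] [DecidableEq ι] [Fintype κ]
  [DecidableEq κ] {A : Set X} {g h : X × Circle → Matrix ι ι ℂ}

theorem snd_facts {μ : Circle → Matrix κ κ ℂ} {f : X × Circle → Matrix (ι ⊕ κ) (ι ⊕ κ) ℂ}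
    (H : InvHomotopic (LoopRel A) (fun p => Matrix.fromBlocks (g p) 0 0 (μ p.2)) f) :
    InvHomotopic (LoopRel A) (fun p => μ p.2) (fun p => μ p.2) := by
  obtain ⟨hc, hd, -⟩ := H.left
  refine InvHomotopic.refl ?_ (fun p h0 => hd p ?_) ?_
  · exact hc.matrix_submatrix (Sum.inr : κ → ι ⊕ κ) (Sum.inr : κ → ι ⊕ κ)
  · rw [Matrix.det_fromBlocks_zero₂₁, h0, mul_zero]
  · rintro ⟨x, z⟩ ⟨x', z'⟩ ⟨-, -, h⟩
    simp only at h
    rw [h]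

theorem refl_fst {v : X → Matrix ι ι ℂ} (hc : Continuous v) (hd : ∀ x, (v x).det ≠ 0)
    (hA : ∀ x ∈ A, ∀ y ∈ A, v x = v y) :
    InvHomotopic (LoopRel A) (fun p => v p.1) (fun p => v p.1) :=
  InvHomotopic.refl (by fun_prop) (fun p => hd _) fun p q h => hA _ h.1 _ h.2.1

theorem refl_one : InvHomotopic (LoopRel A) (fun _ => (1 : Matrix κ κ ℂ)) (fun _ => 1) :=
  InvHomotopic.refl (by fun_prop) (fun p => by simp) fun p q _ => rfl

theorem congr (H : InvHomotopic (LoopRel A) g h) (hh : SplitsStably A h) : SplitsStably A g := by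
  obtain ⟨κ, _, _, μ, v, K⟩ := hh
  exact ⟨κ, _, _, μ, v, (H.diag (snd_facts K)).trans K⟩

theorem of_stab
    (H : SplitsStably A fun p => Matrix.fromBlocks (g p) 0 0 (1 : Matrix κ κ ℂ)) :
    SplitsStably A g := by
  obtain ⟨κ', _, _, μ, v, K⟩ := H
  refine ⟨κ ⊕ κ', inferInstance, inferInstance, fun z => Matrix.fromBlocks 1 0 0 (μ z),
    fun x => Matrix.reindex (Equiv.sumAssoc ι κ κ') (Equiv.sumAssoc ι κ κ') (v x), ?_⟩
  convert K.reindex (Equiv.sumAssoc ι κ κ') using 2 with p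
  ext (i | i | i) (j | j | j) <;> rfl

theorem mul_fst (H : SplitsStably A g) {w : X → Matrix ι ι ℂ} (hc : Continuous w)
    (hd : ∀ x, (w x).det ≠ 0) (hA : ∀ x ∈ A, ∀ y ∈ A, w x = w y) :
    SplitsStably A fun p => g p * w p.1 := by
  obtain ⟨κ, _, _, μ, v, K⟩ := H
  refine ⟨κ, inferInstance, inferInstance, μ, fun x => v x * Matrix.fromBlocks (w x) 0 0 1, ?_⟩
  convert K.mul ((refl_fst hc hd hA).diag refl_one) using 2 with p
  simp [Matrix.fromBlocks_multiply]

theorem smul (H : SplitsStably A g) {c : Circle → ℂ} (hc : Continuous c) (hc0 : ∀ z, c z ≠ 0) :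
    SplitsStably A fun p => c p.2 • g p := by
  obtain ⟨κ, _, _, μ, v, K⟩ := H
  let c' : Circle → ℂ := fun z => (c z)⁻¹
  have hc' : Continuous c' := hc.inv₀ hc0
  have W : InvHomotopic (LoopRel A)
      (fun p => Matrix.fromBlocks (c p.2 • (1 : Matrix ι ι ℂ)) 0 0 (c' p.2 • (1 : Matrix ι ι ℂ)))
      (fun _ => 1) := by
    refine InvHomotopic.whitehead (by fun_prop) (by fun_prop) (fun y => ?_) (fun y y' h => ?_)
      (fun y y' h => ?_)
    · simp [c', smul_smul, hc0]
    · rw [h.2.2]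
    · rw [h.2.2]
  let e : (ι ⊕ κ) ⊕ ι ≃ ι ⊕ (ι ⊕ κ) := (Equiv.sumAssoc _ _ _).trans
    ((Equiv.refl ι).sumCongr (Equiv.sumComm _ _))
  have K1 := (K.diag (refl_one (A := A) (κ := ι))).reindex e
  have K2 := ((W.diag (refl_one (A := A) (κ := κ))).reindex (Equiv.sumAssoc ι ι κ)).mul K1
  refine ⟨ι ⊕ κ, inferInstance, inferInstance, fun z => Matrix.fromBlocks (c' z • 1) 0 0 (μ z),
    fun x => Matrix.reindex e e (Matrix.fromBlocks (v x) 0 0 1), ?_⟩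
  convert K2 using 2 with p p
  · have h1 : Matrix.reindex (Equiv.sumAssoc ι ι κ) (Equiv.sumAssoc ι ι κ) (Matrix.fromBlocks
        (Matrix.fromBlocks (c p.2 • (1 : Matrix ι ι ℂ)) 0 0 (c' p.2 • (1 : Matrix ι ι ℂ))) 0 0
          (1 : Matrix κ κ ℂ)) = Matrix.fromBlocks (c p.2 • 1) 0 0
          (Matrix.fromBlocks (c' p.2 • 1) 0 0 1) := by
      ext (i | i | i) (j | j | j) <;> rfl
    have h2 : Matrix.reindex e e (Matrix.fromBlocks (Matrix.fromBlocks (g p) 0 0 (μ p.2)) 0 0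
        (1 : Matrix ι ι ℂ)) = Matrix.fromBlocks (g p) 0 0 (Matrix.fromBlocks 1 0 0 (μ p.2)) := by
      ext (i | i | i) (j | j | j) <;> rfl
    rw [h1, h2]
    simp [Matrix.fromBlocks_multiply]
  · simp

end SplitsStably

/-- Over `X`, every family of idempotent matrices which is constant on `A` becomes, after adding
an identity block, the family of images of frames which are constant on `A`. -/
def FramesStably (X : Type) [TopologicalSpace X] (A : Set X) : Prop :=
  ∀ (ι : Type) [Fintype ι] [DecidableEq ι] (P : X → Matrix ι ι ℂ), Continuous P →
    (∀ x, P x * P x = P x) → (∀ x ∈ A, ∀ y ∈ A, P x = P y) →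
    ∃ (κ ρ : Type) (_ : Fintype κ) (_ : DecidableEq κ) (_ : Fintype ρ) (_ : DecidableEq ρ)
      (C : X → Matrix (ι ⊕ κ) ρ ℂ) (R : X → Matrix ρ (ι ⊕ κ) ℂ), Continuous C ∧ Continuous R ∧
      (∀ x ∈ A, ∀ y ∈ A, C x = C y ∧ R x = R y) ∧
      ∀ x, R x * C x = 1 ∧ C x * R x = Matrix.fromBlocks (P x) 0 0 1

namespace SplitsStably

variable {X ι : Type} [TopologicalSpace X] [Fintype ι] [DecidableEq ι] {A : Set X}

theorem of_idempotent (hV : FramesStably X A) {P : X → Matrix ι ι ℂ} (hP : Continuous P)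
    (hPP : ∀ x, P x * P x = P x) (hA : ∀ x ∈ A, ∀ y ∈ A, P x = P y) :
    SplitsStably A fun p => 1 + ((p.2 : ℂ) - 1) • P p.1 := by
  obtain ⟨κ, ρ, _, _, _, _, C, R, hC, hR, hCR, h⟩ := hV ι P hP hPP hA
  let W : X → Matrix ((ι ⊕ κ) ⊕ ρ) ((ι ⊕ κ) ⊕ ρ) ℂ := fun x =>
    Matrix.fromBlocks (1 - C x * R x) (C x) (R x) 0
  let Z : ℂ → Matrix ((ι ⊕ κ) ⊕ ρ) ((ι ⊕ κ) ⊕ ρ) ℂ := fun z =>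
    Matrix.fromBlocks 1 0 0 (z • 1)
  have hW : Continuous W := Continuous.matrix_fromBlocks
    (continuous_const.sub (hC.matrix_mul hR)) hC hR continuous_const
  have hWW : ∀ x, W x * W x = 1 := fun x => by
    have e1 : C x * R x * C x = C x := by rw [Matrix.mul_assoc, (h x).1, Matrix.mul_one]
    have e2 : R x * (C x * R x) = R x := by rw [← Matrix.mul_assoc, (h x).1, Matrix.one_mul]
    have e3 : C x * R x * (C x * R x) = C x * R x := by rw [Matrix.mul_assoc, e2]
    simp [W, Matrix.fromBlocks_multiply, Matrix.sub_mul, Matrix.mul_sub, e1, e2, e3, (h x).1]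
  have hZ : Continuous Z := Continuous.matrix_fromBlocks (by fun_prop) (by fun_prop) (by fun_prop)
    (by fun_prop)
  have hWd : ∀ x, (W x).det ≠ 0 := fun x h0 => by
    have := congrArg Matrix.det (hWW x)
    simp [h0] at this
  have hWA : ∀ x ∈ A, ∀ y ∈ A, W x = W y := fun x hx y hy => by
    simp only [W, (hCR x hx y hy).1, (hCR x hx y hy).2]
  have K1 : InvHomotopic (LoopRel A) (fun p => Matrix.fromBlocks (Z p.2) 0 0 (Z (p.2⁻¹ : Circle)))
      (fun _ => 1) := by
    refine InvHomotopic.whitehead (hZ.comp (by fun_prop)) (hZ.comp (by fun_prop))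
      (fun p => ?_) (fun p q h => by rw [h.2.2]) (fun p q h => by rw [h.2.2])
    simp [Z, Matrix.fromBlocks_multiply, smul_smul]
  have KW := (refl_fst hW hWd hWA).diag (refl_one (A := A) (κ := (ι ⊕ κ) ⊕ ρ))
  have K2 := (KW.mul K1).mul KW
  let e : ((ι ⊕ κ) ⊕ ρ) ⊕ ((ι ⊕ κ) ⊕ ρ) ≃ ι ⊕ (κ ⊕ (ρ ⊕ ((ι ⊕ κ) ⊕ ρ))) :=
    (Equiv.sumAssoc _ _ _).trans (Equiv.sumAssoc _ _ _)
  refine ⟨κ ⊕ (ρ ⊕ ((ι ⊕ κ) ⊕ ρ)), inferInstance, inferInstance,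
    fun z => Matrix.fromBlocks ((z : ℂ) • 1) 0 0 (Matrix.fromBlocks 1 0 0 (Z (z⁻¹ : Circle))),
    fun x => 1, ?_⟩
  convert K2.reindex e using 2 with p p
  · have h1 : W p.1 * Z p.2 * W p.1 = Matrix.fromBlocks
        (Matrix.fromBlocks (1 + ((p.2 : ℂ) - 1) • P p.1) 0 0 ((p.2 : ℂ) • 1)) 0 0 1 := by
      have e1 : C p.1 * R p.1 * C p.1 = C p.1 := by
        rw [Matrix.mul_assoc, (h p.1).1, Matrix.mul_one]
      have e2 : R p.1 * (C p.1 * R p.1) = R p.1 := by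
        rw [← Matrix.mul_assoc, (h p.1).1, Matrix.one_mul]
      have e3 : C p.1 * R p.1 * (C p.1 * R p.1) = C p.1 * R p.1 := by rw [Matrix.mul_assoc, e2]
      have e4 : Matrix.fromBlocks (1 + ((p.2 : ℂ) - 1) • P p.1) 0 0 ((p.2 : ℂ) • (1 : Matrix κ κ ℂ))
          = 1 - C p.1 * R p.1 + (p.2 : ℂ) • (C p.1 * R p.1) := by
        rw [(h p.1).2]
        ext (i | i) (j | j)
        · simp only [Matrix.fromBlocks_apply₁₁, Matrix.add_apply, Matrix.sub_apply,
            Matrix.smul_apply, smul_eq_mul, Matrix.one_apply, Sum.inl.injEq]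
          ring
        · simp
        · simp
        · simp [Matrix.one_apply]
      rw [e4]
      simp [W, Z, Matrix.fromBlocks_multiply, Matrix.sub_mul, Matrix.mul_sub, e1, e2, e3, (h p.1).1]
    simp only [Matrix.fromBlocks_multiply, Matrix.mul_zero, Matrix.zero_mul, add_zero, zero_add,
      Matrix.one_mul, Matrix.mul_one, h1]
    ext (i | i | i | i) (j | j | j | j) <;> rfl
  · simp [Matrix.fromBlocks_multiply, hWW]

end SplitsStably

/-! ### The spectral projection of a linear loop -/

section LinearLoop

attribute [local instance] Matrix.linftyOpNormedRing Matrix.linftyOpNormedAlgebra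

variable {ι : Type} [Fintype ι] [DecidableEq ι]

/-- The `k`-th Fourier coefficient of the inverse of the loop `z ↦ 1 + (z - 1) B`. -/
noncomputable def loopCoeff (B : Matrix ι ι ℂ) (k : ℤ) : Matrix ι ι ℂ :=
  ∫ v in (0 : ℝ)..1, ((Real.fourierChar (-(v * k)) : Circle) : ℂ) •
    (1 + (((Real.fourierChar v : Circle) : ℂ) - 1) • B)⁻¹

/-- The loop `z ↦ 1 + (z - 1) B` consists of invertible matrices. -/
def InvLoop (B : Matrix ι ι ℂ) : Prop :=
  ∀ z : Circle, (1 + ((z : ℂ) - 1) • B).det ≠ 0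

variable {B : Matrix ι ι ℂ}

theorem InvLoop.continuous_inv {Y : Type*} [TopologicalSpace Y] {B : Y → Matrix ι ι ℂ}
    (hB : Continuous B) (h : ∀ y, InvLoop (B y)) {a : Y → ℝ} (ha : Continuous a) :
    Continuous fun y => (1 + (((Real.fourierChar (a y) : Circle) : ℂ) - 1) • B y)⁻¹ := by
  have hc : Continuous fun y => Real.fourierChar (a y) := Real.continuous_fourierChar.comp ha
  exact continuous_matrix_inv
    (g := fun y => 1 + (((Real.fourierChar (a y) : Circle) : ℂ) - 1) • B y)
    (by fun_prop) fun p => h _ _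

theorem continuous_fourierChar_neg_mul (k : ℤ) :
    Continuous fun v : ℝ => ((Real.fourierChar (-(v * k)) : Circle) : ℂ) := by
  have hc : Continuous fun v : ℝ => Real.fourierChar (-(v * k)) :=
    Real.continuous_fourierChar.comp (by fun_prop)
  fun_prop

theorem continuous_loopCoeff {X : Type*} [TopologicalSpace X] {B : X → Matrix ι ι ℂ}
    (hB : Continuous B) (h : ∀ x, InvLoop (B x)) (k : ℤ) :
    Continuous fun x => loopCoeff (B x) k := by
  refine intervalIntegral.continuous_parametric_intervalIntegral_of_continuous
    (s := fun _ => (1 : ℝ)) ?_ continuous_const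
  exact ((continuous_fourierChar_neg_mul k).comp continuous_snd).smul
    (InvLoop.continuous_inv (hB.comp continuous_fst) (fun p => h p.1) continuous_snd)

theorem loopCoeff_continuous_integrand (h : InvLoop B) (k : ℤ) :
    Continuous fun v : ℝ => ((Real.fourierChar (-(v * k)) : Circle) : ℂ) •
      (1 + (((Real.fourierChar v : Circle) : ℂ) - 1) • B)⁻¹ :=
  (continuous_fourierChar_neg_mul k).smul
    (InvLoop.continuous_inv continuous_const (fun _ => h) continuous_id)

theorem mul_loopCoeff (h : InvLoop B) (k : ℤ) (D : Matrix ι ι ℂ) :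
    D * loopCoeff B k = ∫ v in (0 : ℝ)..1, ((Real.fourierChar (-(v * k)) : Circle) : ℂ) •
      (D * (1 + (((Real.fourierChar v : Circle) : ℂ) - 1) • B)⁻¹) := by
  have := (ContinuousLinearMap.mul ℂ (Matrix ι ι ℂ) D).intervalIntegral_comp_comm
    ((loopCoeff_continuous_integrand h k).intervalIntegrable (μ := MeasureTheory.volume) 0 1)
  simpa [loopCoeff] using this.symm

theorem loopCoeff_mul (h : InvLoop B) (k : ℤ) (D : Matrix ι ι ℂ) :
    loopCoeff B k * D = ∫ v in (0 : ℝ)..1, ((Real.fourierChar (-(v * k)) : Circle) : ℂ) •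
      ((1 + (((Real.fourierChar v : Circle) : ℂ) - 1) • B)⁻¹ * D) := by
  have := ((ContinuousLinearMap.mul ℂ (Matrix ι ι ℂ)).flip D).intervalIntegral_comp_comm
    ((loopCoeff_continuous_integrand h k).intervalIntegrable (μ := MeasureTheory.volume) 0 1)
  simpa [loopCoeff] using this.symm

theorem loopCoeff_commute (h : InvLoop B) (k : ℤ) : B * loopCoeff B k = loopCoeff B k * B := by
  rw [mul_loopCoeff h, loopCoeff_mul h]
  congr 1
  ext1 v
  congr 1
  have hu := (h (Real.fourierChar v)).isUnit
  set N := 1 + (((Real.fourierChar v : Circle) : ℂ) - 1) • B with hN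
  have hNB : N * B = B * N := by
    rw [hN]
    simp [Matrix.add_mul, Matrix.mul_add]
  calc B * N⁻¹ = N⁻¹ * (N * B) * N⁻¹ := by rw [Matrix.nonsing_inv_mul_cancel_left _ _ hu]
    _ = N⁻¹ * B := by rw [hNB, ← Matrix.mul_assoc, Matrix.mul_nonsing_inv_cancel_right _ _ hu]

theorem integral_fourierChar (k : ℤ) :
    ∫ v in (0 : ℝ)..1, ((Real.fourierChar (-(v * k)) : Circle) : ℂ) = if k = 0 then 1 else 0 := by
  split_ifs with hk
  · simp [hk]
  · have hk' : (-(2 * Real.pi * k * Complex.I) : ℂ) ≠ 0 := by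
      simp [hk, Real.pi_ne_zero]
    have : ∀ v : ℝ, ((Real.fourierChar (-(v * k)) : Circle) : ℂ)
        = Complex.exp (-(2 * Real.pi * k * Complex.I) * v) := fun v => by
      rw [Real.fourierChar_apply]
      congr 1
      push_cast
      ring
    simp only [this]
    rw [integral_exp_mul_complex hk', div_eq_zero_iff]
    left
    have := Complex.exp_int_mul_two_pi_mul_I (-k)
    simp only [Complex.ofReal_one, mul_one, Complex.ofReal_zero, mul_zero, Complex.exp_zero]
    rw [← this, sub_eq_zero]
    congr 1
    push_cast
    ring

theorem loopCoeff_recursion (h : InvLoop B) (k : ℤ) :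
    (1 - B) * loopCoeff B k + B * loopCoeff B (k - 1) = if k = 0 then 1 else 0 := by
  rw [mul_loopCoeff h, mul_loopCoeff h, ← intervalIntegral.integral_add]
  · have : ∀ v : ℝ, ((Real.fourierChar (-(v * k)) : Circle) : ℂ) •
        ((1 - B) * (1 + (((Real.fourierChar v : Circle) : ℂ) - 1) • B)⁻¹) +
        ((Real.fourierChar (-(v * (k - 1 : ℤ))) : Circle) : ℂ) •
        (B * (1 + (((Real.fourierChar v : Circle) : ℂ) - 1) • B)⁻¹) =
        ((Real.fourierChar (-(v * k)) : Circle) : ℂ) • (1 : Matrix ι ι ℂ) := fun v => by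
      have e : (-(v * (k - 1 : ℤ)) : ℝ) = -(v * k) + v := by push_cast; ring
      have hu := (h (Real.fourierChar v)).isUnit
      rw [e, AddChar.map_add_eq_mul, Circle.coe_mul, mul_smul, ← smul_add, ← Matrix.smul_mul,
        ← Matrix.add_mul]
      rw [show 1 - B + ((Real.fourierChar v : Circle) : ℂ) • B
        = 1 + (((Real.fourierChar v : Circle) : ℂ) - 1) • B by module, Matrix.mul_nonsing_inv _ hu]
    simp only [this]
    rw [intervalIntegral.integral_smul_const, integral_fourierChar]
    split_ifs <;> simp
  · exact Continuous.intervalIntegrable ((continuous_fourierChar_neg_mul _).smul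
      (continuous_const.matrix_mul
        (InvLoop.continuous_inv continuous_const (fun _ => h) continuous_id))) _ _
  · exact Continuous.intervalIntegrable ((continuous_fourierChar_neg_mul _).smul
      (continuous_const.matrix_mul
        (InvLoop.continuous_inv continuous_const (fun _ => h) continuous_id))) _ _

theorem tendsto_loopCoeff (B : Matrix ι ι ℂ) :
    Filter.Tendsto (loopCoeff B) Filter.cofinite (𝓝 0) := by
  have := Real.tendsto_integral_exp_smul_cocompact (Set.indicator (Set.Ioc (0 : ℝ) 1)
    fun v => (1 + (((Real.fourierChar v : Circle) : ℂ) - 1) • B)⁻¹)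
  have := this.comp Int.tendsto_coe_cofinite
  refine this.congr fun k => ?_
  rw [loopCoeff, intervalIntegral.integral_of_le zero_le_one,
    ← MeasureTheory.integral_indicator measurableSet_Ioc]
  simp only [Function.comp_apply]
  congr 1
  ext1 v
  by_cases hv : v ∈ Set.Ioc (0 : ℝ) 1 <;> simp [hv, Circle.smul_def]

/-- The spectral projection of `B` onto the part of the spectrum in `{Re > 1 / 2}`. -/
noncomputable def loopProj (B : Matrix ι ι ℂ) : Matrix ι ι ℂ := B * loopCoeff B (-1)

theorem one_sub_loopProj (h : InvLoop B) : 1 - loopProj B = (1 - B) * loopCoeff B 0 := by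
  have := loopCoeff_recursion h 0
  rw [if_pos rfl, zero_sub] at this
  exact sub_eq_of_eq_add this.symm

theorem loopProj_idempotent (h : InvLoop B) : loopProj B * loopProj B = loopProj B := by
  have key : ∀ k : ℕ, (1 - loopProj B) * loopProj B
      = (1 - B) * loopCoeff B k * (B * loopCoeff B (-k - 1)) := fun k => by
    induction k with
    | zero =>
      rw [one_sub_loopProj h]
      simp [loopProj]
    | succ k ih =>
      have h1 := loopCoeff_recursion h (k + 1)
      have h2 := loopCoeff_recursion h (-k - 1)
      rw [if_neg (by lia)] at h1 h2
      rw [add_sub_cancel_right] at h1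
      have h1' : (1 - B) * loopCoeff B (k + 1) = - (B * loopCoeff B k) := by
        rw [← add_eq_zero_iff_eq_neg.1 h1]
      have h2' : B * loopCoeff B (-(k + 1 : ℕ) - 1) = - ((1 - B) * loopCoeff B (-k - 1)) := by
        rw [← add_eq_zero_iff_eq_neg'.1 h2]
        congr 2
        push_cast
        ring
      rw [ih, h2']
      push_cast
      rw [h1', neg_mul_neg]
      have hk := loopCoeff_commute h k
      calc (1 - B) * loopCoeff B k * (B * loopCoeff B (-k - 1))
          = (1 - B) * (loopCoeff B k * B) * loopCoeff B (-k - 1) := by simp only [mul_assoc]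
        _ = (B * ((1 - B) * loopCoeff B k)) * loopCoeff B (-k - 1) := by
          rw [← hk]; noncomm_ring
        _ = (B * (loopCoeff B k * (1 - B))) * loopCoeff B (-k - 1) := by
          rw [sub_mul, mul_sub, hk]; noncomm_ring
        _ = _ := by simp only [mul_assoc]
  have hl : Filter.Tendsto (fun k : ℕ => (1 - B) * loopCoeff B k *
      (B * loopCoeff B (-k - 1))) Filter.atTop (𝓝 0) := by
    have hc : Filter.Tendsto (fun k : ℕ => loopCoeff B k) Filter.atTop (𝓝 0) := by
      refine (tendsto_loopCoeff B).comp ?_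
      rw [← Nat.cofinite_eq_atTop]
      exact (Nat.cast_injective (R := ℤ)).tendsto_cofinite
    have hc' : Filter.Tendsto (fun k : ℕ => loopCoeff B (-k - 1)) Filter.atTop (𝓝 0) := by
      refine (tendsto_loopCoeff B).comp ?_
      rw [← Nat.cofinite_eq_atTop]
      exact Function.Injective.tendsto_cofinite fun a b hab => by
        lia
    simpa using (hc.const_mul (1 - B)).mul (hc'.const_mul B)
  have h0 : (1 - loopProj B) * loopProj B = 0 :=
    tendsto_nhds_unique (tendsto_const_nhds.congr key) hl
  rw [sub_mul, one_mul, sub_eq_zero] at h0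
  exact h0.symm

theorem loopProj_commute (h : InvLoop B) : B * loopProj B = loopProj B * B := by
  rw [loopProj, mul_assoc, loopCoeff_commute h]

end LinearLoop

section LinearLoop

variable {ι : Type} [Fintype ι] [DecidableEq ι] {B : Matrix ι ι ℂ}

theorem tendsto_loopCoeff_mulVec (B : Matrix ι ι ℂ) (w : ι → ℂ) (i : ι) :
    Filter.Tendsto (fun k => ‖(loopCoeff B k).mulVec w i‖) Filter.cofinite (𝓝 0) := by
  have hc : Continuous fun M : Matrix ι ι ℂ => ‖M.mulVec w i‖ := by
    have : Continuous fun M : Matrix ι ι ℂ => M.mulVec w := by fun_prop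
    exact ((continuous_apply i).comp this).norm
  simpa [Function.comp_def] using (hc.tendsto 0).comp (tendsto_loopCoeff B)

theorem loopCoeff_recursion_mulVec (h : InvLoop B) {w : ι → ℂ} {c : ℂ}
    (hw : B.mulVec w = c • w) {k : ℤ} (hk : k ≠ 0) :
    (1 - c) • (loopCoeff B k).mulVec w = -(c • (loopCoeff B (k - 1)).mulVec w) := by
  have := loopCoeff_recursion h k
  rw [if_neg hk, Matrix.sub_mul, Matrix.one_mul, loopCoeff_commute h, loopCoeff_commute h] at this
  have := congrArg (fun M => Matrix.mulVec M w) this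
  simp only [Matrix.add_mulVec, Matrix.sub_mulVec, ← Matrix.mulVec_mulVec, hw, Matrix.mulVec_smul,
    Matrix.zero_mulVec] at this
  rw [sub_smul, one_smul]
  exact add_eq_zero_iff_eq_neg.1 this

theorem eq_zero_of_le_of_tendsto {u : ℕ → ℝ} (h0 : 0 ≤ u 0) (h : ∀ k, u k ≤ u (k + 1))
    (hu : Filter.Tendsto u Filter.atTop (𝓝 0)) : u 0 = 0 :=
  le_antisymm ((monotone_nat_of_le_succ h).ge_of_tendsto hu 0) h0

theorem loopProj_mulVec_of_le (h : InvLoop B) {w : ι → ℂ} {c : ℂ}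
    (hw : B.mulVec w = c • w) (hc : ‖c‖ ≤ ‖1 - c‖) : (loopProj B).mulVec w = 0 := by
  have hP : (loopProj B).mulVec w = c • (loopCoeff B (-1)).mulVec w := by
    rw [loopProj, loopCoeff_commute h, ← Matrix.mulVec_mulVec, hw, Matrix.mulVec_smul]
  rw [hP]
  by_cases hc0 : c = 0
  · simp [hc0]
  suffices (loopCoeff B (-1)).mulVec w = 0 by simp [this]
  ext i
  have ht : Filter.Tendsto (fun k : ℕ => ‖(loopCoeff B (-1 - k)).mulVec w i‖) Filter.atTop
      (𝓝 0) := by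
    refine (tendsto_loopCoeff_mulVec B w i).comp ?_
    rw [← Nat.cofinite_eq_atTop]
    exact Function.Injective.tendsto_cofinite fun a b hab => by
      lia
  have := eq_zero_of_le_of_tendsto (u := fun k : ℕ => ‖(loopCoeff B (-1 - k)).mulVec w i‖)
    (norm_nonneg _) (fun k => ?_) ht
  · simpa using this
  · have hr := congrFun (loopCoeff_recursion_mulVec h hw (k := -1 - k) (by lia)) i
    simp only [Pi.smul_apply, Pi.neg_apply, smul_eq_mul] at hr
    have hr' := congrArg norm hr
    rw [norm_mul, norm_neg, norm_mul] at hr'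
    push_cast
    rw [show (-1 - ((k : ℤ) + 1)) = -1 - k - 1 by ring]
    have hcp : 0 < ‖c‖ := norm_pos_iff.2 hc0
    have h1 := mul_le_mul_of_nonneg_right hc (norm_nonneg ((loopCoeff B (-1 - k)).mulVec w i))
    rw [hr'] at h1
    exact le_of_mul_le_mul_left h1 hcp

theorem loopProj_mulVec_of_ge (h : InvLoop B) {w : ι → ℂ} {c : ℂ}
    (hw : B.mulVec w = c • w) (hc : ‖1 - c‖ ≤ ‖c‖) : (loopProj B).mulVec w = w := by
  have hP : (1 - loopProj B).mulVec w = (1 - c) • (loopCoeff B 0).mulVec w := by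
    rw [one_sub_loopProj h, Matrix.sub_mul, Matrix.one_mul, loopCoeff_commute h,
      Matrix.sub_mulVec, ← Matrix.mulVec_mulVec, hw, Matrix.mulVec_smul, sub_smul, one_smul]
  suffices (1 - c) • (loopCoeff B 0).mulVec w = 0 by
    rw [this, Matrix.sub_mulVec, Matrix.one_mulVec, sub_eq_zero] at hP
    exact hP.symm
  by_cases hc0 : 1 - c = 0
  · simp [hc0]
  suffices (loopCoeff B 0).mulVec w = 0 by simp [this]
  ext i
  have ht : Filter.Tendsto (fun k : ℕ => ‖(loopCoeff B k).mulVec w i‖) Filter.atTop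
      (𝓝 0) := by
    refine (tendsto_loopCoeff_mulVec B w i).comp ?_
    rw [← Nat.cofinite_eq_atTop]
    exact Function.Injective.tendsto_cofinite fun a b hab => by simpa using hab
  have := eq_zero_of_le_of_tendsto (u := fun k : ℕ => ‖(loopCoeff B k).mulVec w i‖)
    (norm_nonneg _) (fun k => ?_) ht
  · simpa using this
  · have hr := congrFun (loopCoeff_recursion_mulVec h hw (k := k + 1) (by lia)) i
    rw [add_sub_cancel_right] at hr
    simp only [Pi.smul_apply, Pi.neg_apply, smul_eq_mul] at hr
    have hr' := congrArg norm hr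
    rw [norm_mul, norm_neg, norm_mul] at hr'
    push_cast
    have hcp : 0 < ‖1 - c‖ := norm_pos_iff.2 hc0
    have h1 := mul_le_mul_of_nonneg_right hc (norm_nonneg ((loopCoeff B k).mulVec w i))
    rw [← hr'] at h1
    exact le_of_mul_le_mul_left h1 hcp

theorem norm_le_norm_one_sub_iff (c : ℂ) : ‖c‖ ≤ ‖1 - c‖ ↔ c.re ≤ 1 / 2 := by
  rw [← sq_le_sq₀ (norm_nonneg _) (norm_nonneg _), ← Complex.normSq_eq_norm_sq,
    ← Complex.normSq_eq_norm_sq, Complex.normSq_apply, Complex.normSq_apply]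
  simp only [Complex.sub_re, Complex.one_re, Complex.sub_im, Complex.one_im]
  constructor <;> intro h <;> nlinarith

theorem norm_one_sub_le_norm_iff (c : ℂ) : ‖1 - c‖ ≤ ‖c‖ ↔ 1 / 2 ≤ c.re := by
  rw [← sq_le_sq₀ (norm_nonneg _) (norm_nonneg _), ← Complex.normSq_eq_norm_sq,
    ← Complex.normSq_eq_norm_sq, Complex.normSq_apply, Complex.normSq_apply]
  simp only [Complex.sub_re, Complex.one_re, Complex.sub_im, Complex.one_im]
  constructor <;> intro h <;> nlinarith

theorem re_inv_one_sub {z : Circle} (hz : (z : ℂ) ≠ 1) : ((1 - (z : ℂ))⁻¹).re = 1 / 2 := by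
  have h1 : Complex.normSq (z : ℂ) = 1 := by simp
  have h2 : Complex.normSq (1 - (z : ℂ)) ≠ 0 := by
    rw [Ne, Complex.normSq_eq_zero, sub_eq_zero]
    exact hz.symm
  rw [Complex.inv_re, div_eq_iff h2]
  rw [Complex.normSq_apply] at h1 ⊢
  simp only [Complex.sub_re, Complex.one_re, Complex.sub_im, Complex.one_im]
  nlinarith

theorem det_loop_homotopy_ne_zero (h : InvLoop B) {s : ℝ} (hs : s ∈ Set.Icc (0 : ℝ) 1)
    (z : Circle) :
    (1 + ((z : ℂ) - 1) • ((1 - s : ℂ) • B + (s : ℂ) • loopProj B)).det ≠ 0 := by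
  intro h0
  set P := loopProj B with hP
  have hPP : P * P = P := loopProj_idempotent h
  have hPB : B * P = P * B := loopProj_commute h
  obtain ⟨v, hv0, hv⟩ := Matrix.exists_mulVec_eq_zero_iff.2 h0
  have hz : (z : ℂ) ≠ 1 := by
    rintro hz
    simp [hz] at hv
    exact hv0 hv
  have hz' : 1 - (z : ℂ) ≠ 0 := sub_ne_zero.2 hz.symm
  set a := (1 - (z : ℂ))⁻¹ with ha
  have hare : a.re = 1 / 2 := re_inv_one_sub hz
  have hv' : (1 - s : ℂ) • B.mulVec v + (s : ℂ) • P.mulVec v = a • v := by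
    simp only [Matrix.add_mulVec, Matrix.smul_mulVec, Matrix.one_mulVec] at hv
    have e : v = (1 - (z : ℂ)) • ((1 - s : ℂ) • B.mulVec v + (s : ℂ) • P.mulVec v) := by
      rw [← sub_eq_zero, ← hv]
      module
    conv_rhs => rw [e]
    rw [ha, inv_smul_smul₀ hz']
  have ha0 : a ≠ 0 := inv_ne_zero hz'
  have e1 : (1 - s : ℂ) • B.mulVec (P.mulVec v) = (a - s) • P.mulVec v := by
    have := congrArg P.mulVec hv'
    simp only [Matrix.mulVec_add, Matrix.mulVec_smul, Matrix.mulVec_mulVec, hPP, ← hPB] at this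
    rw [sub_smul a, ← this, Matrix.mulVec_mulVec]
    module
  have e2 : (1 - s : ℂ) • B.mulVec (v - P.mulVec v) = a • (v - P.mulVec v) := by
    rw [Matrix.mulVec_sub, smul_sub, e1, smul_sub, ← hv']
    module
  have hre : ∀ (b : ℂ) (s : ℝ), ((1 - (s : ℂ))⁻¹ * b).re = (1 - s)⁻¹ * b.re := fun b s => by
    have : (1 - (s : ℂ))⁻¹ = ((1 - s)⁻¹ : ℝ) := by push_cast; rfl
    rw [this, Complex.re_ofReal_mul]
  rcases eq_or_ne s 1 with rfl | hs1
  · have f1 : P.mulVec v = 0 := by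
      have : (a - 1) • P.mulVec v = 0 := by simpa using e1.symm
      refine (smul_eq_zero.1 this).resolve_left fun h1 => ?_
      rw [sub_eq_zero.1 h1] at hare
      norm_num at hare
    have f2 : a • v = 0 := by simpa [f1] using e2.symm
    exact hv0 ((smul_eq_zero.1 f2).resolve_left ha0)
  · have hs1' : 0 < 1 - s := sub_pos.2 (lt_of_le_of_ne hs.2 hs1)
    have hs1c : (1 - s : ℂ) ≠ 0 := by exact_mod_cast hs1'.ne'
    have f1 : P.mulVec v = 0 := by
      have g1 : B.mulVec (P.mulVec v) = ((1 - s : ℂ)⁻¹ * (a - s)) • P.mulVec v := by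
        rw [mul_smul, ← e1, inv_smul_smul₀ hs1c]
      have g2 := loopProj_mulVec_of_le h g1 ((norm_le_norm_one_sub_iff _).2 ?_)
      · rwa [← hP, Matrix.mulVec_mulVec, hPP] at g2
      · rw [hre, inv_mul_le_iff₀ hs1', Complex.sub_re, hare, Complex.ofReal_re]
        linarith [hs.1]
    have g1 : B.mulVec v = ((1 - s : ℂ)⁻¹ * a) • v := by
      rw [f1, sub_zero] at e2
      rw [mul_smul, ← e2, inv_smul_smul₀ hs1c]
    have g2 := loopProj_mulVec_of_ge h g1 ((norm_one_sub_le_norm_iff _).2 ?_)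
    · exact hv0 (g2.symm.trans f1)
    · rw [hre, le_inv_mul_iff₀ hs1', hare]
      linarith [hs.1]

end LinearLoop

namespace SplitsStably

variable {X ι : Type} [TopologicalSpace X] [Fintype ι] [DecidableEq ι] {A : Set X}

theorem of_linear_one (hV : FramesStably X A) {B : X → Matrix ι ι ℂ} (hB : Continuous B)
    (h : ∀ x, InvLoop (B x)) (hA : ∀ x ∈ A, ∀ y ∈ A, B x = B y) :
    SplitsStably A fun p => 1 + ((p.2 : ℂ) - 1) • B p.1 := by
  have hP : Continuous fun x => loopProj (B x) := hB.matrix_mul (continuous_loopCoeff hB h _)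
  have hPA : ∀ x ∈ A, ∀ y ∈ A, loopProj (B x) = loopProj (B y) := fun x hx y hy => by
    rw [hA x hx y hy]
  have hP' : Continuous fun p : ℝ × (X × Circle) => loopProj (B p.2.1) := hP.comp (by fun_prop)
  refine congr (InvHomotopic.of_Icc (fun p : ℝ × (X × Circle) => 1 + ((p.2.2 : ℂ) - 1) •
    ((1 - p.1 : ℂ) • B p.2.1 + (p.1 : ℂ) • loopProj (B p.2.1))) (by fun_prop)
    (fun s hs y => det_loop_homotopy_ne_zero (h _) hs _) (fun s hs y y' hy => ?_) (fun y => ?_)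
    fun y => ?_) (of_idempotent hV hP (fun x => loopProj_idempotent (h x)) hPA)
  · rw [hA _ hy.1 _ hy.2.1, hy.2.2]
  · simp
  · simp

theorem of_linear (hV : FramesStably X A) {a b : X → Matrix ι ι ℂ} (ha : Continuous a)
    (hb : Continuous b) (h : ∀ (x : X) (z : Circle), (a x + (z : ℂ) • b x).det ≠ 0)
    (hA : ∀ x ∈ A, ∀ y ∈ A, a x = a y ∧ b x = b y) :
    SplitsStably A fun p => a p.1 + (p.2 : ℂ) • b p.1 := by
  have h1 : ∀ x, (a x + b x).det ≠ 0 := fun x => by simpa using h x 1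
  have hi : Continuous fun x => (a x + b x)⁻¹ := continuous_matrix_inv (by fun_prop) h1
  have key : ∀ x (z : ℂ), (1 + (z - 1) • (b x * (a x + b x)⁻¹)) * (a x + b x)
      = a x + z • b x := fun x z => by
    rw [Matrix.add_mul, Matrix.smul_mul, Matrix.one_mul,
      Matrix.nonsing_inv_mul_cancel_right _ _ (h1 x).isUnit]
    module
  have := (of_linear_one hV (B := fun x => b x * (a x + b x)⁻¹) (hb.matrix_mul hi)
    (fun x z h0 => h x z (by rw [← key, Matrix.det_mul, h0, zero_mul]))
    (fun x hx y hy => by rw [(hA x hx y hy).1, (hA x hx y hy).2])).mul_fst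
    (w := fun x => a x + b x) (by fun_prop) h1
    (fun x hx y hy => by rw [(hA x hx y hy).1, (hA x hx y hy).2])
  simpa only [key] using this

end SplitsStably

namespace SplitsStably

theorem of_polynomial {X : Type} [TopologicalSpace X] {A : Set X} (hV : FramesStably X A) (d : ℕ) :
    ∀ {ι : Type} [Fintype ι] [DecidableEq ι] (a : ℕ → X → Matrix ι ι ℂ),
      (∀ k, Continuous (a k)) →
      (∀ (x : X) (z : Circle), (∑ k ∈ Finset.range (d + 2), (z : ℂ) ^ k • a k x).det ≠ 0) →
      (∀ k, ∀ x ∈ A, ∀ y ∈ A, a k x = a k y) →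
      SplitsStably A fun p => ∑ k ∈ Finset.range (d + 2), (p.2 : ℂ) ^ k • a k p.1 := by
  induction d with
  | zero =>
    intro ι _ _ a ha h hA
    simpa [Finset.sum_range_succ] using of_linear hV (ha 0) (ha 1)
      (fun x z => by simpa [Finset.sum_range_succ] using h x z)
      fun x hx y hy => ⟨hA 0 x hx y hy, hA 1 x hx y hy⟩
  | succ d ih =>
    intro ι _ _ a ha h hA
    let q : X × Circle → Matrix ι ι ℂ := fun p =>
      ∑ k ∈ Finset.range (d + 2), (p.2 : ℂ) ^ k • a (k + 1) p.1
    have hq : Continuous q := by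
      refine continuous_finsetSum _ fun k _ => ?_
      have := ha (k + 1)
      fun_prop
    have hqA : ∀ p p', LoopRel A p p' → q p = q p' := fun p p' hp => by
      simp only [q, hp.2.2]
      exact Finset.sum_congr rfl fun k _ => by rw [hA (k + 1) _ hp.1 _ hp.2.1]
    have hpq : ∀ p : X × Circle, ∑ k ∈ Finset.range (d + 1 + 2), (p.2 : ℂ) ^ k • a k p.1
        = a 0 p.1 + (p.2 : ℂ) • q p := fun p => by
      rw [Finset.sum_range_succ', add_comm, Finset.smul_sum]
      simp [pow_succ', mul_smul]
    let b : ℕ → X → Matrix (ι ⊕ ι) (ι ⊕ ι) ℂ := fun k x =>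
      Matrix.fromBlocks (if k = 0 then a 0 x else 0) (if k = 1 then -1 else 0) (a (k + 1) x)
        (if k = 0 then 1 else 0)
    have hb : ∀ p : X × Circle, ∑ k ∈ Finset.range (d + 2), (p.2 : ℂ) ^ k • b k p.1
        = Matrix.fromBlocks (a 0 p.1) (-(p.2 : ℂ) • 1) (q p) 1 := fun p => by
      have : ∀ k, (p.2 : ℂ) ^ k • b k p.1 = Matrix.fromBlocks (if k = 0 then a 0 p.1 else 0)
          (if k = 1 then -(p.2 : ℂ) • 1 else 0) ((p.2 : ℂ) ^ k • a (k + 1) p.1)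
          (if k = 0 then 1 else 0) := fun k => by
        simp only [b, Matrix.fromBlocks_smul]
        congr 1
        · split_ifs with hk <;> simp [hk]
        · split_ifs with hk <;> simp [hk]
        · split_ifs with hk <;> simp [hk]
      simp only [this]
      ext (i | i) (j | j)
      · simp [Matrix.sum_apply]
        simp [apply_ite (fun M : Matrix ι ι ℂ => M i j)]
      · simp only [Matrix.sum_apply, Matrix.fromBlocks_apply₁₂]
        simp [apply_ite (fun M : Matrix ι ι ℂ => M i j)]
      · simp [Matrix.sum_apply, q]
      · simp only [Matrix.sum_apply, Matrix.fromBlocks_apply₂₂]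
        simp [apply_ite (fun M : Matrix ι ι ℂ => M i j)]
    let U : ℝ × (X × Circle) → Matrix (ι ⊕ ι) (ι ⊕ ι) ℂ := fun p =>
      Matrix.fromBlocks 1 (((p.1 : ℂ) * p.2.2) • 1) 0 1
    let L : ℝ × (X × Circle) → Matrix (ι ⊕ ι) (ι ⊕ ι) ℂ := fun p =>
      Matrix.fromBlocks 1 0 ((-p.1 : ℂ) • q p.2) 1
    let N : X × Circle → Matrix (ι ⊕ ι) (ι ⊕ ι) ℂ := fun p =>
      Matrix.fromBlocks (a 0 p.1) (-(p.2 : ℂ) • 1) (q p) 1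
    have hU : Continuous U := Continuous.matrix_fromBlocks (by fun_prop) (by fun_prop) (by fun_prop)
      (by fun_prop)
    have hL : Continuous L := Continuous.matrix_fromBlocks (by fun_prop) (by fun_prop) (by fun_prop)
      (by fun_prop)
    have ha0 := ha 0
    have hN : Continuous N := Continuous.matrix_fromBlocks (by fun_prop) (by fun_prop) (by fun_prop)
      (by fun_prop)
    have hUNL : ∀ p, U (1, p) * N p * L (1, p)
        = Matrix.fromBlocks (a 0 p.1 + (p.2 : ℂ) • q p) 0 0 1 := fun p => by
      simp [U, N, L, Matrix.fromBlocks_multiply]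
    have hUd : ∀ p, (U p).det = 1 := fun p => by simp [U]
    have hLd : ∀ p, (L p).det = 1 := fun p => by simp [L]
    have hNd : ∀ p, (N p).det ≠ 0 := fun p => by
      have := congrArg Matrix.det (hUNL p)
      rw [Matrix.det_mul, Matrix.det_mul, hUd, hLd, ← hpq, Matrix.det_fromBlocks_zero₂₁] at this
      rw [one_mul, mul_one, Matrix.det_one, mul_one] at this
      rw [this]
      exact h p.1 p.2
    have hNA : ∀ p p', LoopRel A p p' → N p = N p' := fun p p' hp => by
      simp only [N, hqA _ _ hp, hp.2.2, hA 0 _ hp.1 _ hp.2.1]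
    have key : InvHomotopic (LoopRel A)
        (fun p => Matrix.fromBlocks (∑ k ∈ Finset.range (d + 1 + 2), (p.2 : ℂ) ^ k • a k p.1) 0 0 1)
        N := by
      refine InvHomotopic.symm ⟨fun p => U p * N p.2 * L p, by fun_prop, fun p => ?_,
        fun s p p' hp => ?_, fun p => ?_, fun p => ?_⟩
      · simp [Matrix.det_mul, hUd, hLd, hNd]
      · simp only [hNA _ _ hp, U, L, hqA _ _ hp, hp.2.2]
      · simp [U, L]
      · simp only [hUNL, hpq]
    refine of_stab (κ := ι) (congr key ?_)
    have := ih b (fun k => ?_) (fun x z => ?_) (fun k x hx y hy => ?_)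
    · simpa only [hb] using this
    · have := ha (k + 1)
      refine Continuous.matrix_fromBlocks ?_ continuous_const this continuous_const
      split_ifs
      exacts [ha0, continuous_const]
    · rw [hb (x, z)]
      exact hNd (x, z)
    · simp only [b, hA 0 x hx y hy, hA (k + 1) x hx y hy]

end SplitsStably

/-! ### Approximation of loops by Laurent polynomials -/

section Laurent

variable {X : Type} [TopologicalSpace X]

/-- The continuous functions on `X × S¹` which are Laurent polynomials in the angle. -/
noncomputable def laurentSubalgebra (X : Type) [TopologicalSpace X] :
    StarSubalgebra ℂ C(X × Circle, ℂ) where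
  carrier := {f | ∃ (m : ℕ) (p : Polynomial C(X, ℂ)), ∀ x (z : Circle),
    (z : ℂ) ^ m * f (x, z) = p.eval₂ (ContinuousMap.evalAlgHom ℂ ℂ x : C(X, ℂ) →+* ℂ) z}
  mul_mem' := by
    rintro f g ⟨m, p, hf⟩ ⟨m', p', hg⟩
    refine ⟨m + m', p * p', fun x z => ?_⟩
    rw [Polynomial.eval₂_mul, ← hf, ← hg, ContinuousMap.mul_apply]
    ring
  add_mem' := by
    rintro f g ⟨m, p, hf⟩ ⟨m', p', hg⟩
    refine ⟨m + m', Polynomial.X ^ m' * p + Polynomial.X ^ m * p', fun x z => ?_⟩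
    rw [Polynomial.eval₂_add, Polynomial.eval₂_mul, Polynomial.eval₂_mul, ← hf, ← hg,
      ContinuousMap.add_apply, Polynomial.eval₂_X_pow, Polynomial.eval₂_X_pow]
    ring
  algebraMap_mem' c := ⟨0, Polynomial.C (ContinuousMap.const X c), fun x z => by
    simp [Polynomial.eval₂_C]⟩
  star_mem' := by
    rintro f ⟨m, p, hf⟩
    set q := p.map (starRingEnd C(X, ℂ)) with hq
    refine ⟨q.natDegree, Polynomial.X ^ m * q.reverse, fun x z => ?_⟩
    set ev := (ContinuousMap.evalAlgHom ℂ ℂ x : C(X, ℂ) →+* ℂ)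
    have hz : starRingEnd ℂ (z : ℂ) * z = 1 := by
      rw [Complex.conj_mul', Circle.norm_coe]
      simp
    have h1 : starRingEnd ℂ (p.eval₂ ev (z : ℂ)) = q.eval₂ ev (starRingEnd ℂ (z : ℂ)) := by
      rw [hq, Polynomial.eval₂_map, Polynomial.hom_eval₂]
      congr 1
    let _ : Invertible (starRingEnd ℂ (z : ℂ)) := ⟨z, by rw [mul_comm, hz], hz⟩
    have h2 : q.reverse.eval₂ ev (z : ℂ) * starRingEnd ℂ (z : ℂ) ^ q.natDegree
        = q.eval₂ ev (starRingEnd ℂ (z : ℂ)) :=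
      Polynomial.eval₂_reverse_mul_pow ev (starRingEnd ℂ (z : ℂ)) q
    rw [← h1, ← hf, map_mul, map_pow] at h2
    rw [Polynomial.eval₂_mul, Polynomial.eval₂_X_pow]
    have h3 : ∀ n, starRingEnd ℂ (z : ℂ) ^ n * (z : ℂ) ^ n = 1 := fun n => by
      rw [← mul_pow, hz, one_pow]
    change _ * starRingEnd ℂ (f (x, z)) = _
    calc (z : ℂ) ^ q.natDegree * starRingEnd ℂ (f (x, z))
        = (z : ℂ) ^ q.natDegree * (z : ℂ) ^ m *
          (starRingEnd ℂ (z : ℂ) ^ m * starRingEnd ℂ (f (x, z))) := by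
          linear_combination (-(z : ℂ) ^ q.natDegree * starRingEnd ℂ (f (x, z))) * h3 m
      _ = _ := by
          rw [← h2]
          linear_combination ((z : ℂ) ^ m * q.reverse.eval₂ ev (z : ℂ)) * h3 q.natDegree

theorem laurentSubalgebra_separatesPoints [CompactSpace X] [T2Space X] :
    (laurentSubalgebra X).SeparatesPoints := by
  rintro ⟨x, z⟩ ⟨y, w⟩ h
  by_cases hxy : x = y
  · refine ⟨fun p => (p.2 : ℂ), ⟨⟨fun p => (p.2 : ℂ), by fun_prop⟩, ⟨0, Polynomial.X, ?_⟩, rfl⟩, ?_⟩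
    · intro x z
      simp
    · intro h'
      exact h (Prod.ext hxy (Circle.ext h'))
  · obtain ⟨φ, h0, h1, -⟩ := exists_continuous_zero_one_of_isClosed (isClosed_singleton (x := x))
      (isClosed_singleton (x := y)) (by simpa using hxy)
    refine ⟨fun p => (φ p.1 : ℂ), ⟨⟨fun p => (φ p.1 : ℂ), by fun_prop⟩,
      ⟨0, Polynomial.C ⟨fun x => (φ x : ℂ), by fun_prop⟩, ?_⟩, rfl⟩, ?_⟩
    · intro x z
      simp
    · simp [h0 rfl, h1 rfl]

open Filter in
theorem exists_laurent_approx [CompactSpace X] [T2Space X] {A : Set X} (hA : IsClosed A)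
    {a₀ : X} (ha₀ : a₀ ∈ A) {f : X × Circle → ℂ} (hf : Continuous f)
    (hfA : ∀ p q, LoopRel A p q → f p = f q) {ε : ℝ} (hε : 0 < ε) :
    ∀ᶠ m in atTop, ∀ᶠ d in atTop, ∃ a : ℕ → X → ℂ, (∀ k, Continuous (a k)) ∧
      (∀ k, ∀ x ∈ A, ∀ y ∈ A, a k x = a k y) ∧ ∀ x (z : Circle),
      ‖(z : ℂ) ^ m * f (x, z) - ∑ k ∈ Finset.range d, (z : ℂ) ^ k * a k x‖ < ε := by
  have hd := ContinuousMap.starSubalgebra_topologicalClosure_eq_top_of_separatesPoints _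
    (laurentSubalgebra_separatesPoints (X := X))
  have hmem : (⟨f, hf⟩ : C(X × Circle, ℂ)) ∈ (laurentSubalgebra X).topologicalClosure := by
    rw [hd]; trivial
  rw [← SetLike.mem_coe, StarSubalgebra.topologicalClosure_coe, Metric.mem_closure_iff] at hmem
  obtain ⟨g, ⟨m₀, p, hp⟩, hg⟩ := hmem (ε / 2) (by positivity)
  rw [ContinuousMap.dist_lt_iff (by positivity)] at hg
  simp only [ContinuousMap.coe_mk] at hg
  let K : Set (X × Circle) := {p | ε / 2 ≤ ‖f p - f (a₀, p.2)‖}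
  have hK : IsClosed K := isClosed_le (by fun_prop) (by fun_prop)
  have hK' : IsClosed (Prod.fst '' K) := isClosedMap_fst_of_compactSpace _ hK
  have hAK : Disjoint A (Prod.fst '' K) := by
    rw [Set.disjoint_left]
    rintro _ hx ⟨⟨x, z⟩, h1, rfl⟩
    simp only [K, Set.mem_ofPred_eq] at h1
    rw [hfA _ (a₀, z) ⟨hx, ha₀, rfl⟩, sub_self, norm_zero] at h1
    linarith
  obtain ⟨φ, hφ0, hφ1, hφ⟩ := exists_continuous_zero_one_of_isClosed hA hK' hAK
  filter_upwards [eventually_ge_atTop m₀] with m hm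
  set q := Polynomial.X ^ (m - m₀) * p with hq
  filter_upwards [eventually_gt_atTop q.natDegree] with d hd
  have hq' : ∀ x (z : Circle), (z : ℂ) ^ m * g (x, z)
      = ∑ k ∈ Finset.range d, (z : ℂ) ^ k * q.coeff k x := fun x z => by
    have := Polynomial.eval₂_eq_sum_range' (ContinuousMap.evalAlgHom ℂ ℂ x : C(X, ℂ) →+* ℂ) hd
      (z : ℂ)
    rw [hq, Polynomial.eval₂_mul, Polynomial.eval₂_X_pow, ← hp, ← mul_assoc, ← pow_add,
      Nat.sub_add_cancel hm] at this
    rw [this]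
    exact Finset.sum_congr rfl fun k _ => mul_comm _ _
  refine ⟨fun k x => φ x * q.coeff k x + (1 - φ x) * q.coeff k a₀, fun k => ?_,
    fun k x hx y hy => ?_, fun x z => ?_⟩
  · have := (q.coeff k).continuous
    fun_prop
  · simp [hφ0 hx, hφ0 hy]
  · have e : (z : ℂ) ^ m * f (x, z) - ∑ k ∈ Finset.range d,
        (z : ℂ) ^ k * (φ x * q.coeff k x + (1 - φ x) * q.coeff k a₀)
        = (z : ℂ) ^ m * (φ x * (f (x, z) - g (x, z)) + (1 - φ x) * (f (a₀, z) - g (a₀, z))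
          + (1 - φ x) * (f (x, z) - f (a₀, z))) := by
      have : ∑ k ∈ Finset.range d, (z : ℂ) ^ k * (φ x * q.coeff k x + (1 - φ x) * q.coeff k a₀)
          = φ x * ((z : ℂ) ^ m * g (x, z)) + (1 - φ x) * ((z : ℂ) ^ m * g (a₀, z)) := by
        rw [hq', hq', Finset.mul_sum, Finset.mul_sum, ← Finset.sum_add_distrib]
        exact Finset.sum_congr rfl fun k _ => by ring
      rw [this]
      ring
    rw [e, norm_mul, norm_pow, Circle.norm_coe, one_pow, one_mul]
    have n1 : ‖(φ x : ℂ)‖ = φ x := by simp [(hφ x).1]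
    have n2 : ‖(1 - φ x : ℂ)‖ = 1 - φ x := by
      rw [← Complex.ofReal_one, ← Complex.ofReal_sub, Complex.norm_real, Real.norm_eq_abs,
        abs_of_nonneg (by linarith [(hφ x).2])]
    have h1 := hg (x, z)
    have h2 := hg (a₀, z)
    rw [dist_eq_norm] at h1 h2
    have h3 : (1 - φ x) * ‖f (x, z) - f (a₀, z)‖ ≤ ε / 2 := by
      by_cases hx : x ∈ Prod.fst '' K
      · rw [hφ1 hx]
        simp
        positivity
      · have : ‖f (x, z) - f (a₀, z)‖ < ε / 2 := by
          by_contra h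
          exact hx ⟨(x, z), not_lt.1 h, rfl⟩
        nlinarith [(hφ x).1, (hφ x).2, norm_nonneg (f (x, z) - f (a₀, z))]
    calc _ ≤ φ x * ‖f (x, z) - g (x, z)‖ + (1 - φ x) * ‖f (a₀, z) - g (a₀, z)‖
          + (1 - φ x) * ‖f (x, z) - f (a₀, z)‖ := by
          refine (norm_add_le _ _).trans (add_le_add ((norm_add_le _ _).trans ?_) ?_)
          · rw [norm_mul, norm_mul, n1, n2]
          · rw [norm_mul, n2]
      _ < ε := by
          have : φ x * ‖f (x, z) - g (x, z)‖ + (1 - φ x) * ‖f (a₀, z) - g (a₀, z)‖ < ε / 2 := by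
            rcases (hφ x).1.eq_or_lt with h0 | h0
            · rw [← h0]
              linarith
            · nlinarith [(hφ x).2]
          linarith

end Laurent

attribute [local instance] Matrix.normedAddCommGroup in
theorem exists_forall_det_add_ne_zero {Y ι : Type} [TopologicalSpace Y] [CompactSpace Y] [Fintype ι]
    [DecidableEq ι] {g : Y → Matrix ι ι ℂ} (hg : Continuous g) (hd : ∀ y, (g y).det ≠ 0) :
    ∃ ε > 0, ∀ N : Matrix ι ι ℂ, (∀ i j, ‖N i j‖ < ε) → ∀ y, (g y + N).det ≠ 0 := by
  let K : Set (Y × Matrix ι ι ℂ) := {p | (g p.1 + p.2).det = 0}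
  have hK : IsClosed K := isClosed_eq (Continuous.matrix_det (by fun_prop)) continuous_const
  have hK' : IsClosed (Prod.snd '' K) := isClosedMap_snd_of_compactSpace _ hK
  have h0 : (0 : Matrix ι ι ℂ) ∈ (Prod.snd '' K)ᶜ := by
    rintro ⟨⟨y, N⟩, h1, h2⟩
    simp only at h2
    simp only [K, h2, Set.mem_ofPred_eq, add_zero] at h1
    exact hd y h1
  obtain ⟨ε, hε, hb⟩ := Metric.isOpen_iff.1 hK'.isOpen_compl 0 h0
  refine ⟨ε, hε, fun N hN y h => hb ?_ ⟨(y, N), h, rfl⟩⟩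
  rw [mem_ball_zero_iff]
  exact (Matrix.norm_lt_iff hε).2 hN

open Filter in
theorem SplitsStably.of_continuous {X ι : Type} [TopologicalSpace X] [Fintype ι] [DecidableEq ι]
    [CompactSpace X] [T2Space X] {A : Set X} (hA : IsClosed A) (hA0 : A.Nonempty)
    (hV : FramesStably X A) {g : X × Circle → Matrix ι ι ℂ} (hg : Continuous g)
    (hd : ∀ p, (g p).det ≠ 0) (hgA : ∀ p q, LoopRel A p q → g p = g q) : SplitsStably A g := by
  obtain ⟨a₀, ha₀⟩ := hA0
  obtain ⟨ε, hε, hN⟩ := exists_forall_det_add_ne_zero hg hd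
  have h1 : ∀ᶠ m in atTop, ∀ i j, ∀ᶠ d in atTop, ∃ a : ℕ → X → ℂ, (∀ k, Continuous (a k)) ∧
      (∀ k, ∀ x ∈ A, ∀ y ∈ A, a k x = a k y) ∧ ∀ x (z : Circle),
      ‖(z : ℂ) ^ m * g (x, z) i j - ∑ k ∈ Finset.range d, (z : ℂ) ^ k * a k x‖ < ε := by
    rw [eventually_all]
    intro i
    rw [eventually_all]
    intro j
    exact exists_laurent_approx hA ha₀ (hg.matrix_elem i j) (fun p q h => by rw [hgA p q h]) hε
  obtain ⟨m, hm⟩ := h1.exists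
  have h2 : ∀ᶠ d in atTop, ∀ i j, ∃ a : ℕ → X → ℂ, (∀ k, Continuous (a k)) ∧
      (∀ k, ∀ x ∈ A, ∀ y ∈ A, a k x = a k y) ∧ ∀ x (z : Circle),
      ‖(z : ℂ) ^ m * g (x, z) i j - ∑ k ∈ Finset.range d, (z : ℂ) ^ k * a k x‖ < ε := by
    rw [eventually_all]
    intro i
    rw [eventually_all]
    exact hm i
  obtain ⟨d, hda⟩ := ((tendsto_add_atTop_nat 2).eventually h2).exists
  choose a ha haA hag using hda
  let b : ℕ → X → Matrix ι ι ℂ := fun k x => Matrix.of fun i j => a i j k x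
  let G : X × Circle → Matrix ι ι ℂ := fun p => ∑ k ∈ Finset.range (d + 2), (p.2 : ℂ) ^ k • b k p.1
  have hb : ∀ k, Continuous (b k) := fun k => continuous_matrix fun i j => ha i j k
  have hbA : ∀ k, ∀ x ∈ A, ∀ y ∈ A, b k x = b k y := fun k x hx y hy => by
    ext i j
    exact haA i j k x hx y hy
  have hG : Continuous G := continuous_finsetSum _ fun k _ => by
    have := hb k
    fun_prop
  have hGA : ∀ p q, LoopRel A p q → G p = G q := fun p q h => by
    simp only [G, h.2.2]
    exact Finset.sum_congr rfl fun k _ => by rw [hbA k _ h.1 _ h.2.1]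
  have hz : ∀ (z : Circle) (n : ℕ), (z : ℂ)⁻¹ ^ n * (z : ℂ) ^ n = 1 := fun z n => by
    rw [← mul_pow, inv_mul_cancel₀ z.coe_ne_zero, one_pow]
  have hclose : ∀ (s : ℝ), s ∈ Set.Icc (0 : ℝ) 1 → ∀ p : X × Circle, ∀ i j,
      ‖((s : ℂ) • ((p.2 : ℂ)⁻¹ ^ m • G p - g p)) i j‖ < ε := fun s hs p i j => by
    have := hag i j p.1 p.2
    have e : ((s : ℂ) • ((p.2 : ℂ)⁻¹ ^ m • G p - g p)) i j = -(s : ℂ) * ((p.2 : ℂ)⁻¹ ^ m *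
        ((p.2 : ℂ) ^ m * g (p.1, p.2) i j -
          ∑ k ∈ Finset.range (d + 2), (p.2 : ℂ) ^ k * a i j k p.1)) := by
      simp only [Matrix.smul_apply, Matrix.sub_apply, smul_eq_mul, G, Matrix.sum_apply, b,
        Matrix.of_apply, Prod.mk.eta]
      linear_combination (s : ℂ) * g p i j * hz p.2 m
    rw [e, norm_mul, norm_mul, norm_pow, norm_inv, Circle.norm_coe, inv_one, one_pow, one_mul,
      norm_neg, Complex.norm_real, Real.norm_eq_abs, abs_of_nonneg hs.1]
    exact (mul_le_of_le_one_left (norm_nonneg _) hs.2).trans_lt this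
  have hzc : Continuous fun z : Circle => (z : ℂ)⁻¹ ^ m :=
    (Continuous.inv₀ (by fun_prop) fun z => z.coe_ne_zero).pow m
  have key : InvHomotopic (LoopRel A) g (fun p => (p.2 : ℂ)⁻¹ ^ m • G p) := by
    refine InvHomotopic.of_Icc (fun p => g p.2 + (p.1 : ℂ) • ((p.2.2 : ℂ)⁻¹ ^ m • G p.2 - g p.2))
      ?_ (fun s hs p => hN _ (hclose s hs p) _) (fun s _ p q h => ?_) (fun p => ?_) fun p => ?_
    · have : Continuous fun p : ℝ × (X × Circle) => (p.2.2 : ℂ)⁻¹ ^ m := hzc.comp (by fun_prop)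
      fun_prop
    · rw [hGA _ _ h, hgA _ _ h, h.2.2]
    · simp
    · simp
  refine congr key (smul (c := fun z : Circle => (z : ℂ)⁻¹ ^ m) ?_ hzc fun z => ?_)
  · refine of_polynomial hV d b hb (fun x z h0 => key.right.2.1 (x, z) ?_) hbA
    simp only [G]
    rw [Matrix.det_smul, h0, mul_zero]
  · exact pow_ne_zero _ (inv_ne_zero z.coe_ne_zero)

/-- Every family over `X` of invertible matrices equal to `1` on `A` becomes, after adding an
identity block, homotopic to the constant family `1` through families constant on `A`. -/
def NullStably (X : Type) [TopologicalSpace X] (A : Set X) : Prop :=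
  ∀ (ι : Type) [Fintype ι] [DecidableEq ι] (g : X → Matrix ι ι ℂ), Continuous g →
    (∀ x, (g x).det ≠ 0) → (∀ x ∈ A, g x = 1) →
    ∃ (κ : Type) (_ : Fintype κ) (_ : DecidableEq κ), InvHomotopic (fun x y => x ∈ A ∧ y ∈ A)
      (fun x => Matrix.fromBlocks (g x) 0 0 (1 : Matrix κ κ ℂ)) (fun _ => 1)

/-- The part of the boundary of `X × I` lying over `A` or at the ends. -/
def cylinderBoundary {X : Type} (A : Set X) : Set (X × unitInterval) :=
  {p | p.1 ∈ A ∨ p.2 = 0 ∨ p.2 = 1}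

theorem fourierChar_eq_iff {s t : unitInterval}
    (h : Real.fourierChar (s : ℝ) = Real.fourierChar (t : ℝ)) :
    s = t ∨ (s = 0 ∨ s = 1) ∧ (t = 0 ∨ t = 1) := by
  rw [Real.fourierChar_apply', Real.fourierChar_apply', Circle.exp_eq_exp] at h
  obtain ⟨m, hm⟩ := h
  have h2 : (2 * Real.pi) ≠ 0 := by positivity
  have hst : (s : ℝ) = t + m := mul_left_cancel₀ h2 (by linarith)
  have hs := s.2
  have ht := t.2
  have h1 : (-1 : ℝ) ≤ m := by linarith [hs.1, ht.2]
  have h3 : (m : ℝ) ≤ 1 := by linarith [hs.2, ht.1]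
  have h1' : -1 ≤ m := by exact_mod_cast h1
  have h3' : m ≤ 1 := by exact_mod_cast h3
  obtain rfl | rfl | rfl : m = -1 ∨ m = 0 ∨ m = 1 := by lia
  · push_cast at hst
    exact Or.inr ⟨Or.inl (Subtype.ext (show (s : ℝ) = 0 by linarith [hs.1, ht.2])),
      Or.inr (Subtype.ext (show (t : ℝ) = 1 by linarith [hs.1, ht.2]))⟩
  · push_cast at hst
    exact Or.inl (Subtype.ext (by linarith))
  · push_cast at hst
    exact Or.inr ⟨Or.inr (Subtype.ext (show (s : ℝ) = 1 by linarith [hs.2, ht.1])),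
      Or.inl (Subtype.ext (show (t : ℝ) = 0 by linarith [hs.2, ht.1]))⟩

/-- The quotient map from the cylinder over `X` to `X × S¹`. -/
noncomputable def cylinderToLoop (X : Type) (p : X × unitInterval) : X × Circle :=
  (p.1, Real.fourierChar (p.2 : ℝ))

theorem continuous_cylinderToLoop (X : Type) [TopologicalSpace X] :
    Continuous (cylinderToLoop X) :=
  continuous_fst.prodMk (Real.continuous_fourierChar.comp (by fun_prop))

theorem isQuotientMap_cylinderToLoop (X : Type) [TopologicalSpace X] [CompactSpace X] [T2Space X] :
    IsQuotientMap (cylinderToLoop X) := by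
  refine (continuous_cylinderToLoop X).isClosedMap.isQuotientMap (continuous_cylinderToLoop X) ?_
  rintro ⟨x, z⟩
  obtain ⟨a, ha⟩ := Circle.exp_surjective z
  refine ⟨(x, ⟨Int.fract (a / (2 * Real.pi)), Int.fract_nonneg _, (Int.fract_lt_one _).le⟩), ?_⟩
  refine Prod.ext rfl ?_
  change Real.fourierChar (Int.fract (a / (2 * Real.pi))) = z
  rw [Real.fourierChar_apply', ← ha, Circle.exp_eq_exp]
  refine ⟨-⌊a / (2 * Real.pi)⌋, ?_⟩
  have h2 : (2 * Real.pi) ≠ 0 := by positivity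
  rw [Int.fract]
  field_simp
  push_cast
  ring

theorem nullStably_cylinder {X : Type} [TopologicalSpace X] [CompactSpace X] [T2Space X]
    {A : Set X} (hA : IsClosed A) (hA0 : A.Nonempty) (hV : FramesStably X A) :
    NullStably (X × unitInterval) (cylinderBoundary A) := by
  intro ι _ _ g hg hd hgA
  obtain ⟨a₀, ha₀⟩ := hA0
  have hq := isQuotientMap_cylinderToLoop X
  let G : X × Circle → Matrix ι ι ℂ := fun p => g (Function.surjInv hq.surjective p)
  have hGg : ∀ p, G (cylinderToLoop X p) = g p := fun p => by
    have h := Function.surjInv_eq hq.surjective (cylinderToLoop X p)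
    set p' := Function.surjInv hq.surjective (cylinderToLoop X p) with hp'
    change g p' = g p
    have h1 : (cylinderToLoop X p').1 = (cylinderToLoop X p).1 := by rw [h]
    have h2 : (cylinderToLoop X p').2 = (cylinderToLoop X p).2 := by rw [h]
    rcases fourierChar_eq_iff h2 with h2 | ⟨h2, h3⟩
    · have e : p' = p := Prod.ext h1 h2
      rw [e]
    · rw [hgA p' (Or.inr h2), hgA p (Or.inr h3)]
  have hG : Continuous G := by
    rw [hq.continuous_iff]
    exact hg.congr fun p => (hGg p).symm
  have hG1 : ∀ x, G (x, 1) = 1 := fun x => by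
    have := hGg (x, 0)
    rw [hgA _ (Or.inr (Or.inl rfl))] at this
    simpa [cylinderToLoop] using this
  have hGA : ∀ x ∈ A, ∀ z, G (x, z) = 1 := fun x hx z => by
    obtain ⟨⟨y, t⟩, hp⟩ := hq.surjective (x, z)
    have hy : y = x := congrArg Prod.fst hp
    rw [← hp, hGg, hgA _ (Or.inl (by rwa [hy]))]
  obtain ⟨κ, _, _, μ, v, H, hc, hHd, hHR, h0, h1⟩ := SplitsStably.of_continuous hA ⟨a₀, ha₀⟩ hV hG
    (fun p => hd _) (fun p q h => by
      rw [← Prod.mk.eta (p := p), ← Prod.mk.eta (p := q), hGA _ h.1, hGA _ h.2.1])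
  simp only at h0 h1
  let H₁ : ℝ × (X × Circle) → Matrix (ι ⊕ κ) (ι ⊕ κ) ℂ := fun p => (H (p.1, p.2.1, 1))⁻¹ * H p
  have hH₁ : Continuous H₁ :=
    (continuous_matrix_inv (g := fun p : ℝ × (X × Circle) => H (p.1, p.2.1, 1))
      (by fun_prop) fun p => hHd _).matrix_mul hc
  have hH₁d : ∀ p, (H₁ p).det ≠ 0 := fun p => by
    rw [Matrix.det_mul]
    exact mul_ne_zero (det_inv_ne_zero (hHd _)) (hHd _)
  have hH₁one : ∀ s x, H₁ (s, x, 1) = 1 := fun s x => Matrix.nonsing_inv_mul _ (hHd _).isUnit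
  have hH₁A : ∀ s, ∀ x ∈ A, ∀ z, H₁ (s, x, z) = H₁ (s, a₀, z) := fun s x hx z => by
    simp only [H₁]
    rw [hHR s (x, z) (a₀, z) ⟨hx, ha₀, rfl⟩, hHR s (x, 1) (a₀, 1) ⟨hx, ha₀, rfl⟩]
  have hH₁1 : ∀ x z, H₁ (1, x, z) = 1 := fun x z => by
    simp only [H₁]
    rw [h1, h1, Matrix.nonsing_inv_mul _ (by rw [← h1 (x, 1)]; exact (hHd _).isUnit)]
  let H₂ : ℝ × (X × Circle) → Matrix (ι ⊕ κ) (ι ⊕ κ) ℂ := fun p =>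
    H₁ p * (H₁ (p.1, a₀, p.2.2))⁻¹
  have hH₂ : Continuous H₂ :=
    hH₁.matrix_mul (continuous_matrix_inv (g := fun p : ℝ × (X × Circle) => H₁ (p.1, a₀, p.2.2))
      (by fun_prop) fun p => hH₁d _)
  have hH₂A : ∀ s p, p ∈ cylinderBoundary A → H₂ (s, cylinderToLoop X p) = 1 := by
    rintro s ⟨x, t⟩ hp
    have hend : Real.fourierChar (t : ℝ) = 1 → H₂ (s, cylinderToLoop X (x, t)) = 1 := fun ht => by
      simp [H₂, cylinderToLoop, ht, hH₁one]
    rcases hp with hp | hp | hp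
    · simp only [H₂, cylinderToLoop]
      rw [hH₁A s x hp]
      exact Matrix.mul_nonsing_inv _ (hH₁d _).isUnit
    · refine hend ?_
      simp only at hp
      simp [hp]
    · refine hend ?_
      simp only at hp
      rw [hp, Real.fourierChar_apply']
      simp
  refine ⟨κ, inferInstance, inferInstance, fun p => H₂ (p.1, cylinderToLoop X p.2),
    hH₂.comp (continuous_fst.prodMk ((continuous_cylinderToLoop X).comp continuous_snd)),
    fun p => ?_, fun s p q hpq => ?_, fun p => ?_, fun p => ?_⟩
  · simp only [H₂, Matrix.det_mul]
    exact mul_ne_zero (hH₁d _) (det_inv_ne_zero (hH₁d _))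
  · simp only [hH₂A s p hpq.1, hH₂A s q hpq.2]
  · have hμ : ∀ z, (μ z).det ≠ 0 := fun z hz => hHd (0, a₀, z) (by
      rw [h0, Matrix.det_fromBlocks_zero₂₁, hz, mul_zero])
    have e : ∀ x z, H₁ (0, x, z) = Matrix.fromBlocks (G (x, z)) 0 0 ((μ 1)⁻¹ * μ z) := fun x z => by
      simp only [H₁]
      have : (Matrix.fromBlocks (1 : Matrix ι ι ℂ) 0 0 (μ 1))⁻¹
          = Matrix.fromBlocks 1 0 0 (μ 1)⁻¹ := by
        refine Matrix.inv_eq_left_inv ?_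
        simp [Matrix.fromBlocks_multiply, Matrix.nonsing_inv_mul _ (hμ 1).isUnit]
      rw [h0, h0, hG1, this]
      simp [Matrix.fromBlocks_multiply]
    have hν : ∀ z, ((μ 1)⁻¹ * μ z).det ≠ 0 := fun z => by
      rw [Matrix.det_mul]
      exact mul_ne_zero (det_inv_ne_zero (hμ 1)) (hμ z)
    simp only [H₂]
    rw [← Prod.mk.eta (p := cylinderToLoop X p), e, e, Prod.mk.eta, hGg, hGA _ ha₀]
    rw [Matrix.inv_eq_left_inv (B := Matrix.fromBlocks 1 0 0
      ((μ 1)⁻¹ * μ (cylinderToLoop X p).2)⁻¹)]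
    · simp [Matrix.fromBlocks_multiply, Matrix.mul_nonsing_inv _ (hν _).isUnit]
    · simp only [Matrix.fromBlocks_multiply, Matrix.nonsing_inv_mul _ (hν _).isUnit]
      simp
  · simp only [H₂]
    rw [← Prod.mk.eta (p := cylinderToLoop X p), hH₁1, hH₁1]
    simp

theorem nullStably_of_subsingleton (X : Type) [TopologicalSpace X] [Subsingleton X] :
    NullStably X ∅ := by
  intro ι _ _ g hg hd _
  rcases isEmpty_or_nonempty X with hX | ⟨⟨x₀⟩⟩
  · exact ⟨Empty, inferInstance, inferInstance, fun _ => 1, by fun_prop, fun p => by simp,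
      fun _ _ _ _ => rfl, fun x => hX.elim x, fun _ => rfl⟩
  suffices h : InvHomotopic (fun x y : X => x ∈ (∅ : Set X) ∧ y ∈ (∅ : Set X)) g (fun _ => 1) by
    refine ⟨Empty, inferInstance, inferInstance, ?_⟩
    simpa using h.diag (InvHomotopic.refl (R := fun x y : X => x ∈ (∅ : Set X) ∧ y ∈ (∅ : Set X))
      (g := fun _ => (1 : Matrix Empty Empty ℂ)) (by fun_prop) (by simp) (by simp))
  refine InvHomotopic.symm ?_
  let M : Matrix ι ι (Polynomial ℂ) := (1 - Polynomial.X : Polynomial ℂ) • 1 +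
    (Polynomial.X : Polynomial ℂ) • (g x₀).map Polynomial.C
  have hM : ∀ z, M.det.eval z = ((1 - z) • 1 + z • g x₀ : Matrix ι ι ℂ).det := fun z => by
    rw [← Polynomial.coe_evalRingHom, RingHom.map_det]
    congr 1
    ext i j
    by_cases hij : i = j <;> simp [M, hij, mul_comm z]
  have h0 : M.det.eval 0 ≠ 0 := by simp [hM]
  have h1 : M.det.eval 1 ≠ 0 := by simpa [hM] using hd x₀
  have hM0 : M.det ≠ 0 := fun h => h0 (by simp [h])
  obtain ⟨c, hc⟩ := (M.det.roots.toFinset.image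
    fun z : ℂ => z.im / (z.re * (1 - z.re))).exists_notMem
  let γ : ℝ → ℂ := fun s => ⟨s, c * (s * (1 - s))⟩
  have hγ : Continuous γ := by
    have : γ = fun s : ℝ => (s : ℂ) + ((c * (s * (1 - s)) : ℝ) : ℂ) * Complex.I := by
      ext s
      simp [γ, Complex.ext_iff]
    rw [this]
    fun_prop
  have hne : ∀ s, M.det.eval (γ s) ≠ 0 := fun s hs => by
    have hs' : s * (1 - s) ≠ 0 := fun h => by
      rcases mul_eq_zero.1 h with h2 | h2
      · subst h2
        refine h0 ?_
        convert hs
        simp [γ, Complex.ext_iff]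
      · obtain rfl : s = 1 := by linarith
        refine h1 ?_
        convert hs
        simp [γ, Complex.ext_iff]
    refine hc (Finset.mem_image.2 ⟨γ s, ?_, ?_⟩)
    · simpa [hM0] using hs
    · simp only [γ]
      exact mul_div_cancel_right₀ _ hs'
  refine ⟨fun p => (1 - γ p.1) • 1 + γ p.1 • g x₀, by fun_prop, fun p => ?_, by simp,
    fun y => ?_, fun y => ?_⟩
  · rw [← hM]
    exact hne _
  · have : γ 0 = 0 := by simp [γ, Complex.ext_iff]
    simp [this]
  · have : γ 1 = 1 := by simp [γ, Complex.ext_iff]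
    simp [this, Subsingleton.elim x₀ y]

theorem Matrix.exists_rank_factorization {ι : Type} [Fintype ι] [DecidableEq ι]
    {P : Matrix ι ι ℂ} (hP : P * P = P) :
    ∃ (r : ℕ) (C : Matrix ι (Fin r) ℂ) (R : Matrix (Fin r) ι ℂ), C * R = P ∧ R * C = 1 := by
  let f : (ι → ℂ) →ₗ[ℂ] (ι → ℂ) := Matrix.toLin' P
  let b := Module.finBasis ℂ (LinearMap.range f)
  let c : (Fin (Module.finrank ℂ (LinearMap.range f)) → ℂ) →ₗ[ℂ] (ι → ℂ) :=
    (LinearMap.range f).subtype ∘ₗ (b.equivFun.symm : _ →ₗ[ℂ] LinearMap.range f)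
  let r : (ι → ℂ) →ₗ[ℂ] (Fin (Module.finrank ℂ (LinearMap.range f)) → ℂ) :=
    (b.equivFun : LinearMap.range f →ₗ[ℂ] _) ∘ₗ f.rangeRestrict
  refine ⟨_, LinearMap.toMatrix' c, LinearMap.toMatrix' r, ?_, ?_⟩
  · rw [← LinearMap.toMatrix'_comp]
    have : c ∘ₗ r = f := by
      refine LinearMap.ext fun i => ?_
      simp [c, r]
    rw [this]
    simp [f]
  · rw [← LinearMap.toMatrix'_comp]
    have hf : ∀ y : LinearMap.range f, f.rangeRestrict y = y := by
      rintro ⟨_, x, rfl⟩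
      refine Subtype.ext ?_
      simp [f, hP]
    have : r ∘ₗ c = LinearMap.id := by
      refine LinearMap.ext fun i => ?_
      simp only [r, c, LinearMap.comp_apply, LinearEquiv.coe_coe, Submodule.subtype_apply, hf,
        LinearMap.id_apply, LinearEquiv.apply_symm_apply]
    rw [this]
    simp

/-- A matrix carrying the image of `Q` to the image of `P` for nearby idempotents. -/
def idemTransport {ι : Type} [Fintype ι] [DecidableEq ι] (P Q : Matrix ι ι ℂ) : Matrix ι ι ℂ :=
  P * Q + (1 - P) * (1 - Q)

theorem mul_idemTransport {ι : Type} [Fintype ι] [DecidableEq ι] {P Q : Matrix ι ι ℂ}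
    (hP : P * P = P) (hQ : Q * Q = Q) : P * idemTransport P Q = idemTransport P Q * Q := by
  have e1 : P * (P * Q) = P * Q := by rw [← Matrix.mul_assoc, hP]
  simp only [idemTransport, Matrix.mul_add, Matrix.add_mul, Matrix.mul_sub, Matrix.sub_mul,
    Matrix.mul_one, Matrix.one_mul, hP, hQ, Matrix.mul_assoc, e1]
  simp

theorem idemTransport_self {ι : Type} [Fintype ι] [DecidableEq ι] {P : Matrix ι ι ℂ}
    (hP : P * P = P) : idemTransport P P = 1 := by
  simp only [idemTransport, Matrix.mul_sub, Matrix.sub_mul, Matrix.mul_one, Matrix.one_mul, hP]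
  simp

theorem exists_parallel_transport {X ι : Type} [TopologicalSpace X] [CompactSpace X] [Fintype ι]
    [DecidableEq ι] {P : X × ℝ → Matrix ι ι ℂ} (hP : Continuous P) (hPP : ∀ x, P x * P x = P x) :
    ∃ u : X × ℝ → Matrix ι ι ℂ, Continuous u ∧ (∀ p, (u p).det ≠ 0) ∧ (∀ x, u (x, 0) = 1) ∧
      (∀ x, (∀ t ∈ Set.Icc (0 : ℝ) 1, P (x, t) = P (x, 0)) → ∀ t ∈ Set.Icc (0 : ℝ) 1,
        u (x, t) = 1) ∧
      ∀ x, ∀ t ∈ Set.Icc (0 : ℝ) 1, P (x, t) * u (x, t) = u (x, t) * P (x, 0) := by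
  let d : X × ℝ × ℝ → ℂ := fun q => (idemTransport (P (q.1, q.2.1)) (P (q.1, q.2.2))).det
  have hd : Continuous d := by
    simp only [d, idemTransport]
    fun_prop
  let K : Set (X × ℝ × ℝ) :=
    (Set.univ ×ˢ (Set.Icc (0 : ℝ) 1 ×ˢ Set.Icc (0 : ℝ) 1)) ∩ {q | d q = 0}
  have hK : IsCompact K := (isCompact_univ.prod (isCompact_Icc.prod isCompact_Icc)).inter_right
    (isClosed_eq hd continuous_const)
  obtain ⟨δ, hδ, hKδ⟩ := hK.exists_forall_le' (f := fun q => |q.2.1 - q.2.2|) (a := 0)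
    (by fun_prop) (fun q hq => by
      refine abs_pos.2 fun h => ?_
      have h2 : d q = 0 := hq.2
      simp only [d] at h2
      rw [sub_eq_zero.1 h, idemTransport_self (hPP _)] at h2
      simp at h2)
  obtain ⟨N, hN⟩ := exists_nat_one_div_lt hδ
  let θ : ℕ → ℝ → ℝ := fun i t => max 0 (min t (i / (N + 1)))
  have hN0 : (0 : ℝ) < N + 1 := by positivity
  have hθ : ∀ i, i ≤ N + 1 → ∀ t, θ i t ∈ Set.Icc (0 : ℝ) 1 := fun i hi t => by
    refine ⟨le_max_left _ _, max_le zero_le_one ((min_le_right _ _).trans ?_)⟩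
    rw [div_le_one hN0]
    exact_mod_cast hi
  have hθc : ∀ i, Continuous (θ i) := fun i => by fun_prop
  have hθd : ∀ i t, |θ (i + 1) t - θ i t| < δ := fun i t => by
    refine lt_of_le_of_lt ?_ hN
    refine (abs_max_sub_max_le_max _ _ _ _).trans ?_
    rw [sub_self, abs_zero, max_eq_right (abs_nonneg _)]
    refine (abs_min_sub_min_le_max _ _ _ _).trans ?_
    rw [sub_self, abs_zero, max_eq_right (abs_nonneg _)]
    rw [← sub_div]
    push_cast
    rw [add_sub_cancel_left, abs_of_nonneg (by positivity)]
  have hTd : ∀ i, i ≤ N → ∀ x t,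
      (idemTransport (P (x, θ (i + 1) t)) (P (x, θ i t))).det ≠ 0 := fun i hi x t h => by
    have := hKδ (x, θ (i + 1) t, θ i t)
      ⟨⟨trivial, hθ (i + 1) (by lia) t, hθ i (by lia) t⟩, h⟩
    exact absurd (hθd i t) (not_lt.2 this)
  suffices h : ∀ i, i ≤ N + 1 → ∃ u : X × ℝ → Matrix ι ι ℂ, Continuous u ∧ (∀ p, (u p).det ≠ 0) ∧
      (∀ x, u (x, 0) = 1) ∧
      (∀ x, (∀ t ∈ Set.Icc (0 : ℝ) 1, P (x, t) = P (x, 0)) → ∀ t, u (x, t) = 1) ∧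
      ∀ x t, P (x, θ i t) * u (x, t) = u (x, t) * P (x, 0) by
    obtain ⟨u, hu, hud, hu0, huA, huP⟩ := h (N + 1) le_rfl
    refine ⟨u, hu, hud, hu0, fun x hx t _ => huA x hx t, fun x t ht => ?_⟩
    have := huP x t
    have e : θ (N + 1) t = t := by
      simp only [θ]
      push_cast
      rw [div_self hN0.ne', min_eq_left ht.2, max_eq_right ht.1]
    rwa [e] at this
  intro i
  induction i with
  | zero =>
    intro _
    refine ⟨fun _ => 1, by fun_prop, by simp, by simp, by simp, fun x t => ?_⟩
    have : θ 0 t = 0 := by simp [θ]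
    simp [this]
  | succ i ih =>
    intro hi
    obtain ⟨u, hu, hud, hu0, huA, huP⟩ := ih (by lia)
    refine ⟨fun p => idemTransport (P (p.1, θ (i + 1) p.2)) (P (p.1, θ i p.2)) * u p, ?_,
      fun p => ?_, fun x => ?_, fun x hx t => ?_, fun x t => ?_⟩
    · have h1 := hθc (i + 1)
      have h2 := hθc i
      simp only [idemTransport]
      fun_prop
    · rw [Matrix.det_mul]
      exact mul_ne_zero (hTd i (by lia) _ _) (hud _)
    · have h0 : ∀ i, θ i 0 = 0 := fun i => by
        simp only [θ]
        rw [min_eq_left (by positivity), max_self]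
      simp [h0, hu0, idemTransport_self (hPP _)]
    · simp only [huA x hx, hx _ (hθ (i + 1) hi t), hx _ (hθ i (by lia) t),
        idemTransport_self (hPP _), Matrix.mul_one]
    · simp only
      rw [← Matrix.mul_assoc, mul_idemTransport (hPP _) (hPP _), Matrix.mul_assoc, huP,
        Matrix.mul_assoc]

theorem framesStably_cylinder {X : Type} [TopologicalSpace X] [CompactSpace X] [Nonempty X]
    {A : Set X} (hT : NullStably X A) : FramesStably (X × unitInterval) (cylinderBoundary A) := by
  intro ι _ _ P hP hPP hPA
  obtain ⟨x₀⟩ := ‹Nonempty X›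
  let P' : X × ℝ → Matrix ι ι ℂ := fun p => P (p.1, Set.projIcc 0 1 zero_le_one p.2)
  have hP' : Continuous P' :=
    hP.comp (continuous_fst.prodMk (continuous_projIcc.comp continuous_snd))
  obtain ⟨u, hu, hud, hu0, huA, huP⟩ := exists_parallel_transport hP' fun p => hPP _
  set P₀ := P (x₀, 0) with hP₀
  have hPb : ∀ p ∈ cylinderBoundary A, P p = P₀ := fun p hp => hPA _ hp _ (Or.inr (Or.inl rfl))
  have hP'0 : ∀ x, P' (x, 0) = P₀ := fun x => hPb _ (Or.inr (Or.inl (by simp)))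
  have hPI : ∀ x (t : unitInterval), P' (x, t) = P (x, t) := fun x t => by simp [P']
  have huA' : ∀ x ∈ A, ∀ t : unitInterval, u (x, t) = 1 := fun x hx t =>
    huA x (fun s _ => hPA _ (Or.inl hx) _ (Or.inl hx)) t t.2
  have huP' : ∀ x (t : unitInterval), P (x, t) * u (x, t) = u (x, t) * P₀ := fun x t => by
    rw [← hPI, huP x t t.2, hP'0]
  obtain ⟨r, C₀, R₀, hCR, hRC⟩ := Matrix.exists_rank_factorization (hPP (x₀, 0))
  rw [← hP₀] at hCR
  have hvP : ∀ x, P₀ * u (x, 1) = u (x, 1) * P₀ := fun x => by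
    have h1 := huP' x 1
    rwa [hPb _ (Or.inr (Or.inr rfl))] at h1
  have huu : ∀ p, u p * (u p)⁻¹ = 1 := fun p => Matrix.mul_nonsing_inv _ (hud p).isUnit
  have hvC : ∀ x, C₀ * (R₀ * u (x, 1) * C₀) = u (x, 1) * C₀ := fun x => by
    rw [← Matrix.mul_assoc, ← Matrix.mul_assoc, hCR, hvP, ← hCR, Matrix.mul_assoc,
      Matrix.mul_assoc, hRC, Matrix.mul_one]
  have hvR : ∀ x, R₀ * u (x, 1) * C₀ * (R₀ * (u (x, 1))⁻¹) = R₀ := fun x => by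
    have : R₀ * u (x, 1) * C₀ * (R₀ * (u (x, 1))⁻¹) = R₀ * (u (x, 1) * (C₀ * R₀)) * (u (x, 1))⁻¹ := by
      simp only [Matrix.mul_assoc]
    rw [this, hCR, ← hvP, ← hCR]
    calc _ = (R₀ * C₀) * R₀ * (u (x, 1) * (u (x, 1))⁻¹) := by simp only [Matrix.mul_assoc]
      _ = R₀ := by rw [hRC, huu, Matrix.one_mul, Matrix.mul_one]
  have hv1 : ∀ x, R₀ * u (x, 1) * C₀ * (R₀ * (u (x, 1))⁻¹ * C₀) = 1 := fun x => by
    rw [← Matrix.mul_assoc, hvR, hRC]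
  obtain ⟨κ, _, _, w, hw, hwd, hwA, hw0, hw1⟩ : ∃ (κ : Type) (_ : Fintype κ) (_ : DecidableEq κ)
      (w : ℝ × X → Matrix (Fin r ⊕ κ) (Fin r ⊕ κ) ℂ), Continuous w ∧ (∀ p, (w p).det ≠ 0) ∧
        (∀ s, ∀ x ∈ A, w (s, x) = 1) ∧ (∀ x, w (0, x) = 1) ∧
        ∀ x, w (1, x) = Matrix.fromBlocks (R₀ * u (x, 1) * C₀) 0 0 1 := by
    have hv1A : ∀ x ∈ A, R₀ * u (x, 1) * C₀ = 1 := fun x hx => by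
      have := huA' x hx 1
      rw [Set.Icc.coe_one] at this
      rw [this, Matrix.mul_one, hRC]
    obtain ⟨κ, _, _, H, hH, hHd, hHA, h0, h1⟩ := hT (Fin r) (fun x => R₀ * u (x, 1) * C₀)
      (by fun_prop) (fun x h => by
        have := congrArg Matrix.det (hv1 x)
        simp [h] at this) hv1A
    simp only at h0 h1
    rcases A.eq_empty_or_nonempty with rfl | ⟨a, ha⟩
    · exact ⟨κ, inferInstance, inferInstance, fun p => H (1 - p.1, p.2), by fun_prop,
        fun p => hHd _, by simp, by simp [h1], by simp [h0]⟩
    · refine ⟨κ, inferInstance, inferInstance, fun p => (H (1 - p.1, a))⁻¹ * H (1 - p.1, p.2), ?_,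
        fun p => ?_, fun s x hx => ?_, by simp [h1], by simp [h0, hv1A a ha]⟩
      · exact (continuous_matrix_inv (g := fun p : ℝ × X => H (1 - p.1, a)) (by fun_prop)
          fun p => hHd _).matrix_mul (by fun_prop)
      · rw [Matrix.det_mul]
        exact mul_ne_zero (det_inv_ne_zero (hHd _)) (hHd _)
      · simp only
        rw [hHA _ x a ⟨hx, ha⟩]
        exact Matrix.nonsing_inv_mul _ (hHd _).isUnit
  have hww : ∀ p, (w p)⁻¹ * w p = 1 := fun p => Matrix.nonsing_inv_mul _ (hwd p).isUnit
  have hww' : ∀ p, w p * (w p)⁻¹ = 1 := fun p => Matrix.mul_nonsing_inv _ (hwd p).isUnit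
  have huu' : ∀ p, (u p)⁻¹ * u p = 1 := fun p => Matrix.nonsing_inv_mul _ (hud p).isUnit
  let C : X × unitInterval → Matrix (ι ⊕ κ) (Fin r ⊕ κ) ℂ := fun p =>
    (Matrix.fromBlocks (u (p.1, p.2) * C₀) 0 0 1 : Matrix (ι ⊕ κ) (Fin r ⊕ κ) ℂ) *
      (w (p.2, p.1))⁻¹
  let R : X × unitInterval → Matrix (Fin r ⊕ κ) (ι ⊕ κ) ℂ := fun p =>
    w (p.2, p.1) *
      (Matrix.fromBlocks (R₀ * (u (p.1, p.2))⁻¹) 0 0 1 : Matrix (Fin r ⊕ κ) (ι ⊕ κ) ℂ)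
  have hone : (1 : Matrix (Fin r ⊕ κ) (Fin r ⊕ κ) ℂ)⁻¹ = 1 := inv_one
  have hone' : (1 : Matrix ι ι ℂ)⁻¹ = 1 := inv_one
  have hb : ∀ p ∈ cylinderBoundary A, C p = Matrix.fromBlocks C₀ 0 0 1 ∧
      R p = Matrix.fromBlocks R₀ 0 0 1 := by
    rintro ⟨x, t⟩ (hx | hx | hx)
    · simp only at hx
      simp only [C, R, huA' x hx, hwA _ x hx, hone, hone', Matrix.mul_one, Matrix.one_mul, and_self]
    · simp only at hx
      simp only [C, R, hx, Set.Icc.coe_zero, hu0, hw0, hone, hone', Matrix.mul_one, Matrix.one_mul,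
        and_self]
    · simp only at hx
      simp only [C, R, hx, Set.Icc.coe_one]
      constructor
      · have : Matrix.fromBlocks (u (x, 1) * C₀) 0 0 (1 : Matrix κ κ ℂ)
            = (Matrix.fromBlocks C₀ 0 0 1 : Matrix (ι ⊕ κ) (Fin r ⊕ κ) ℂ) * w (1, x) := by
          rw [hw1, Matrix.fromBlocks_multiply, hvC]
          simp
        rw [this, Matrix.mul_assoc, hww', Matrix.mul_one]
      · rw [hw1, Matrix.fromBlocks_multiply, hvR]
        simp
  refine ⟨κ, Fin r ⊕ κ, inferInstance, inferInstance, inferInstance, inferInstance, C, R, ?_, ?_,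
    fun p hp q hq => ?_, fun p => ⟨?_, ?_⟩⟩
  · exact (Continuous.matrix_fromBlocks (by fun_prop) (by fun_prop) (by fun_prop)
      (by fun_prop)).matrix_mul (continuous_matrix_inv
        (g := fun p : X × unitInterval => w (p.2, p.1)) (by fun_prop) fun p => hwd _)
  · have h1 := continuous_matrix_inv (g := fun p : X × unitInterval => u (p.1, p.2)) (by fun_prop)
      fun p => hud _
    have h2 : Continuous fun p : X × unitInterval => w (p.2, p.1) := by fun_prop
    exact h2.matrix_mul (Continuous.matrix_fromBlocks (by fun_prop) (by fun_prop) (by fun_prop)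
      (by fun_prop))
  · rw [(hb p hp).1, (hb p hp).2, (hb q hq).1, (hb q hq).2]
    exact ⟨rfl, rfl⟩
  · simp only [C, R]
    have e : R₀ * (u (p.1, p.2))⁻¹ * (u (p.1, p.2) * C₀) = 1 := by
      calc _ = R₀ * ((u (p.1, p.2))⁻¹ * u (p.1, p.2)) * C₀ := by simp only [Matrix.mul_assoc]
        _ = 1 := by rw [huu', Matrix.mul_one, hRC]
    calc _ = w (p.2, p.1) * ((Matrix.fromBlocks (R₀ * (u (p.1, p.2))⁻¹) 0 0 1 : Matrix (Fin r ⊕ κ) (ι ⊕ κ) ℂ) *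
          (Matrix.fromBlocks (u (p.1, p.2) * C₀) 0 0 1 : Matrix (ι ⊕ κ) (Fin r ⊕ κ) ℂ)) * (w (p.2, p.1))⁻¹ := by
          simp only [Matrix.mul_assoc]
      _ = 1 := by
          rw [Matrix.fromBlocks_multiply, e]
          simp [hww']
  · simp only [C, R]
    have e : u (p.1, p.2) * C₀ * (R₀ * (u (p.1, p.2))⁻¹) = P p := by
      calc _ = u (p.1, p.2) * (C₀ * R₀) * (u (p.1, p.2))⁻¹ := by simp only [Matrix.mul_assoc]
        _ = P p := by rw [hCR, ← huP', Matrix.mul_assoc, huu, Matrix.mul_one]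
    calc _ = (Matrix.fromBlocks (u (p.1, p.2) * C₀) 0 0 1 : Matrix (ι ⊕ κ) (Fin r ⊕ κ) ℂ) * ((w (p.2, p.1))⁻¹ * w (p.2, p.1)) *
          (Matrix.fromBlocks (R₀ * (u (p.1, p.2))⁻¹) 0 0 1 : Matrix (Fin r ⊕ κ) (ι ⊕ κ) ℂ) := by simp only [Matrix.mul_assoc]
      _ = _ := by
          rw [hww, Matrix.mul_one, Matrix.fromBlocks_multiply, e]
          simp

theorem FramesStably.of_homeomorph {X Y : Type} [TopologicalSpace X] [TopologicalSpace Y]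
    {B : Set Y} (h : FramesStably Y B) (e : X ≃ₜ Y) {A : Set X} (hA : ∀ x, e x ∈ B ↔ x ∈ A) :
    FramesStably X A := by
  intro ι _ _ P hP hPP hPA
  have hB : ∀ y, e.symm y ∈ A ↔ y ∈ B := fun y => by rw [← hA, e.apply_symm_apply]
  obtain ⟨κ, ρ, _, _, _, _, C, R, hC, hR, hCR, hh⟩ := h ι (fun y => P (e.symm y))
    (hP.comp e.symm.continuous) (fun y => hPP _)
    fun x hx y hy => hPA _ ((hB x).2 hx) _ ((hB y).2 hy)
  refine ⟨κ, ρ, inferInstance, inferInstance, inferInstance, inferInstance, fun x => C (e x),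
    fun x => R (e x), hC.comp e.continuous, hR.comp e.continuous,
    fun x hx y hy => hCR _ ((hA x).2 hx) _ ((hA y).2 hy), fun x => ?_⟩
  simpa using hh (e x)

theorem NullStably.of_homeomorph {X Y : Type} [TopologicalSpace X] [TopologicalSpace Y]
    {B : Set Y} (h : NullStably Y B) (e : X ≃ₜ Y) {A : Set X} (hA : ∀ x, e x ∈ B ↔ x ∈ A) :
    NullStably X A := by
  intro ι _ _ g hg hd hgA
  have hB : ∀ y, e.symm y ∈ A ↔ y ∈ B := fun y => by rw [← hA, e.apply_symm_apply]
  obtain ⟨κ, _, _, H, hH, hHd, hHA, h0, h1⟩ := h ι (fun y => g (e.symm y))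
    (hg.comp e.symm.continuous) (fun y => hd _) fun x hx => hgA _ ((hB x).2 hx)
  refine ⟨κ, inferInstance, inferInstance, fun p => H (p.1, e p.2),
    hH.comp (continuous_fst.prodMk (e.continuous.comp continuous_snd)), fun p => hHd _,
    fun s x y hxy => hHA s _ _ ⟨(hA x).2 hxy.1, (hA y).2 hxy.2⟩, fun x => ?_, fun x => ?_⟩
  · simpa using h0 (e x)
  · simpa using h1 (e x)

theorem mem_boundary_iff_splitAt {N : Type} [DecidableEq N] (i : N) (y : N → unitInterval) :
    ((Cube.splitAt i).trans (Homeomorph.prodComm _ _)) y ∈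
      cylinderBoundary (Cube.boundary {j // j ≠ i}) ↔ y ∈ Cube.boundary N := by
  simp only [cylinderBoundary, Cube.boundary]
  constructor
  · rintro (⟨j, hj⟩ | h | h)
    · exact ⟨j, hj⟩
    · exact ⟨i, Or.inl h⟩
    · exact ⟨i, Or.inr h⟩
  · rintro ⟨j, hj⟩
    by_cases hji : j = i
    · subst hji
      exact Or.inr hj
    · exact Or.inl ⟨⟨j, hji⟩, hj⟩

theorem isClosed_cubeBoundary (N : Type) [Finite N] : IsClosed (Cube.boundary N) := by
  have : Cube.boundary N = ⋃ i, {y | y i = 0} ∪ {y | y i = 1} := by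
    ext y
    simp [Cube.boundary]
  rw [this]
  exact isClosed_iUnion_of_finite fun i =>
    (isClosed_eq (continuous_apply i) continuous_const).union
      (isClosed_eq (continuous_apply i) continuous_const)

theorem cubeBoundary_nonempty (N : Type) [Nonempty N] : (Cube.boundary N).Nonempty :=
  ⟨fun _ => 0, Classical.arbitrary N, Or.inl rfl⟩

/-- Bott periodicity for the cube relative to its boundary. -/
theorem nullStably_framesStably_cube (c : ℕ) : ∀ (N : Type) [Fintype N], Fintype.card N = c →
    (Even c → NullStably (N → unitInterval) (Cube.boundary N)) ∧
      (Odd c → FramesStably (N → unitInterval) (Cube.boundary N)) := by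
  induction c with
  | zero =>
    intro N _ hN
    have : IsEmpty N := Fintype.card_eq_zero_iff.1 hN
    refine ⟨fun _ => ?_, fun h => by simp at h⟩
    have hb : Cube.boundary N = ∅ := Set.eq_empty_of_forall_notMem fun y ⟨i, _⟩ => isEmptyElim i
    rw [hb]
    exact nullStably_of_subsingleton _
  | succ c ih =>
    intro N _ hN
    classical
    have : Nonempty N := Fintype.card_pos_iff.1 (by lia)
    obtain ⟨i⟩ := this
    have hc : Fintype.card {j // j ≠ i} = c := by
      rw [Fintype.card_subtype_compl, Fintype.card_subtype_eq, hN, Nat.add_sub_cancel]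
    obtain ⟨h1, h2⟩ := ih {j // j ≠ i} hc
    refine ⟨fun h => ?_, fun h => ?_⟩
    · have hodd : Odd c := by grind
      have : Nonempty {j // j ≠ i} := Fintype.card_pos_iff.1 (by rw [hc]; exact hodd.pos)
      exact (nullStably_cylinder (isClosed_cubeBoundary _) (cubeBoundary_nonempty _)
        (h2 hodd)).of_homeomorph _ (mem_boundary_iff_splitAt i)
    · have hev : Even c := by grind
      exact (framesStably_cylinder (h1 hev)).of_homeomorph _ (mem_boundary_iff_splitAt i)

theorem exists_descend {X Y Z : Type*} [TopologicalSpace X] [TopologicalSpace Y]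
    [TopologicalSpace Z] {q : X → Y} (hq : IsQuotientMap q) {A : Set X}
    (hqA : ∀ x y, q x = q y → x = y ∨ x ∈ A ∧ y ∈ A) {f : X → Z} (hf : Continuous f)
    (hfA : ∀ x ∈ A, ∀ y ∈ A, f x = f y) : ∃ g : Y → Z, Continuous g ∧ ∀ x, g (q x) = f x := by
  have h : ∀ x, f (Function.surjInv hq.surjective (q x)) = f x := fun x => by
    rcases hqA _ _ (Function.surjInv_eq hq.surjective (q x)) with h | h
    · rw [h]
    · exact hfA _ h.1 _ h.2
  refine ⟨fun y => f (Function.surjInv hq.surjective y), ?_, h⟩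
  rw [hq.continuous_iff]
  exact hf.congr fun x => (h x).symm

/-! ### The sphere as the quotient of a cube by its boundary -/

section CubeToSphere

variable {m : ℕ}

/-- The centred coordinates on the cube. -/
noncomputable def cubeCoord (t : Fin m → unitInterval) (i : Fin m) : ℝ := 2 * (t i : ℝ) - 1

/-- A function on the cube vanishing exactly on the boundary. -/
noncomputable def cubeWeight (t : Fin m → unitInterval) : ℝ := ∏ i, (1 - cubeCoord t i ^ 2)

/-- The norm squared of the centred coordinates. -/
noncomputable def cubeNormSq (t : Fin m → unitInterval) : ℝ := ∑ i, cubeCoord t i ^ 2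

theorem continuous_cubeCoord (i : Fin m) : Continuous fun t => cubeCoord t i := by
  simp only [cubeCoord]
  fun_prop

theorem continuous_cubeWeight : Continuous (cubeWeight (m := m)) :=
  continuous_finsetProd _ fun i _ => continuous_const.sub ((continuous_cubeCoord i).pow 2)

theorem continuous_cubeNormSq : Continuous (cubeNormSq (m := m)) :=
  continuous_finsetSum _ fun i _ => (continuous_cubeCoord i).pow 2

theorem cubeCoord_sq_le (t : Fin m → unitInterval) (i : Fin m) : cubeCoord t i ^ 2 ≤ 1 := by
  have := (t i).2
  rw [sq_le_one_iff_abs_le_one, abs_le, cubeCoord]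
  constructor <;> linarith [this.1, this.2]

theorem cubeWeight_nonneg (t : Fin m → unitInterval) : 0 ≤ cubeWeight t :=
  Finset.prod_nonneg fun i _ => sub_nonneg.2 (cubeCoord_sq_le t i)

theorem cubeWeight_eq_zero {t : Fin m → unitInterval} :
    cubeWeight t = 0 ↔ t ∈ Cube.boundary (Fin m) := by
  rw [cubeWeight, Finset.prod_eq_zero_iff]
  simp only [Finset.mem_univ, true_and, Cube.boundary]
  refine exists_congr fun i => ?_
  have : 1 - cubeCoord t i ^ 2 = 4 * ((t i : ℝ) * (1 - t i)) := by
    rw [cubeCoord]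
    ring
  rw [this, mul_eq_zero_iff_left (by norm_num), mul_eq_zero, sub_eq_zero]
  refine or_congr ?_ ?_
  · exact Set.Icc.coe_eq_zero
  · rw [eq_comm]
    exact Set.Icc.coe_eq_one

theorem cubeNormSq_add_pos (t : Fin m → unitInterval) : 0 < cubeNormSq t + cubeWeight t ^ 2 := by
  have h0 : 0 ≤ cubeNormSq t := Finset.sum_nonneg fun i _ => sq_nonneg _
  rcases h0.lt_or_eq with h | h
  · positivity
  · have : ∀ i, cubeCoord t i ^ 2 = 0 := fun i =>
      (Finset.sum_eq_zero_iff_of_nonneg fun i _ => sq_nonneg _).1 h.symm i (Finset.mem_univ i)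
    simp [← h, cubeWeight, this]

/-- The map from the cube to the sphere collapsing the boundary to the north pole. -/
noncomputable def cubeToSphere (m : ℕ) (t : Fin m → unitInterval) : Sph m :=
  ⟨WithLp.toLp 2 (Fin.snoc (α := fun _ => ℝ)
    (fun i => 2 * cubeCoord t i * cubeWeight t / (cubeNormSq t + cubeWeight t ^ 2))
    ((cubeNormSq t - cubeWeight t ^ 2) / (cubeNormSq t + cubeWeight t ^ 2))), by
    have h := cubeNormSq_add_pos t
    have e : ∑ i, (2 * cubeCoord t i * cubeWeight t) ^ 2
        = 4 * cubeNormSq t * cubeWeight t ^ 2 := by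
      rw [cubeNormSq, Finset.mul_sum, Finset.sum_mul]
      exact Finset.sum_congr rfl fun i _ => by ring
    rw [Sph, mem_sphere_zero_iff_norm, ← sq_eq_sq₀ (norm_nonneg _) zero_le_one,
      EuclideanSpace.norm_sq_eq, Fin.sum_univ_castSucc]
    simp only [Fin.snoc_castSucc, Fin.snoc_last, Real.norm_eq_abs, sq_abs, div_pow]
    rw [← Finset.sum_div, e]
    field_simp
    ring⟩

theorem cubeToSphere_castSucc (t : Fin m → unitInterval) (i : Fin m) :
    (cubeToSphere m t).1 i.castSucc =
      2 * cubeCoord t i * cubeWeight t / (cubeNormSq t + cubeWeight t ^ 2) := by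
  simp [cubeToSphere]

theorem cubeToSphere_last (t : Fin m → unitInterval) :
    (cubeToSphere m t).1 (Fin.last m) =
      (cubeNormSq t - cubeWeight t ^ 2) / (cubeNormSq t + cubeWeight t ^ 2) := by
  simp [cubeToSphere]

theorem continuous_cubeToSphere : Continuous (cubeToSphere m) := by
  refine Continuous.subtype_mk ((PiLp.continuous_toLp 2 _).comp (continuous_pi fun j => ?_)) _
  have hw := continuous_cubeWeight (m := m)
  have hn := continuous_cubeNormSq (m := m)
  induction j using Fin.lastCases with
  | last =>
    simp only [Fin.snoc_last]
    exact (hn.sub (hw.pow 2)).div (hn.add (hw.pow 2)) fun t => (cubeNormSq_add_pos t).ne'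
  | cast i =>
    simp only [Fin.snoc_castSucc]
    exact (((continuous_cubeCoord i).const_mul 2).mul hw).div (hn.add (hw.pow 2))
      fun t => (cubeNormSq_add_pos t).ne'

theorem sphere_ext {x y : Sph m} (h : ∀ i : Fin m, x.1 i.castSucc = y.1 i.castSucc)
    (hl : x.1 (Fin.last m) = y.1 (Fin.last m)) : x = y := by
  refine Subtype.ext (PiLp.ext fun j => ?_)
  induction j using Fin.lastCases with
  | last => exact hl
  | cast i => exact h i

theorem northPole_castSucc (i : Fin m) : (northPole m).1 i.castSucc = 0 := by
  simp [northPole, (Fin.castSucc_lt_last i).ne]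

theorem northPole_last : (northPole m).1 (Fin.last m) = 1 := by
  simp [northPole]

theorem cubeToSphere_boundary {t : Fin m → unitInterval} (ht : t ∈ Cube.boundary (Fin m)) :
    cubeToSphere m t = northPole m := by
  have hw := cubeWeight_eq_zero.2 ht
  have h := cubeNormSq_add_pos t
  rw [hw, zero_pow two_ne_zero, add_zero] at h
  refine sphere_ext (fun i => ?_) ?_
  · rw [cubeToSphere_castSucc, hw, northPole_castSucc]
    simp
  · rw [cubeToSphere_last, hw, northPole_last]
    simp [h.ne']

theorem cubeWeight_pos {t : Fin m → unitInterval} (ht : t ∉ Cube.boundary (Fin m)) :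
    0 < cubeWeight t :=
  (cubeWeight_nonneg t).lt_of_ne fun h => ht (cubeWeight_eq_zero.1 h.symm)

theorem one_sub_cubeToSphere_last (t : Fin m → unitInterval) :
    1 - (cubeToSphere m t).1 (Fin.last m) =
      2 * cubeWeight t ^ 2 / (cubeNormSq t + cubeWeight t ^ 2) := by
  have h := (cubeNormSq_add_pos t).ne'
  rw [cubeToSphere_last]
  field_simp
  ring

theorem cubeCoord_div_cubeWeight {t : Fin m → unitInterval} (ht : t ∉ Cube.boundary (Fin m))
    (i : Fin m) : cubeCoord t i = cubeWeight t *
      ((cubeToSphere m t).1 i.castSucc / (1 - (cubeToSphere m t).1 (Fin.last m))) := by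
  have h := (cubeNormSq_add_pos t).ne'
  have hw := (cubeWeight_pos ht).ne'
  rw [one_sub_cubeToSphere_last, cubeToSphere_castSucc]
  field_simp

theorem cubeToSphere_eq {s t : Fin m → unitInterval} (h : cubeToSphere m s = cubeToSphere m t) :
    s = t ∨ s ∈ Cube.boundary (Fin m) ∧ t ∈ Cube.boundary (Fin m) := by
  have hb : s ∈ Cube.boundary (Fin m) ↔ t ∈ Cube.boundary (Fin m) := by
    have key : ∀ r : Fin m → unitInterval, r ∈ Cube.boundary (Fin m) ↔
        1 - (cubeToSphere m r).1 (Fin.last m) = 0 := fun r => by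
      rw [one_sub_cubeToSphere_last, div_eq_zero_iff, ← cubeWeight_eq_zero]
      simp [(cubeNormSq_add_pos r).ne']
    rw [key, key, h]
  by_cases ht : t ∈ Cube.boundary (Fin m)
  · exact Or.inr ⟨hb.2 ht, ht⟩
  have hs : s ∉ Cube.boundary (Fin m) := fun h => ht (hb.1 h)
  have key : ∀ s t : Fin m → unitInterval, s ∉ Cube.boundary (Fin m) →
      t ∉ Cube.boundary (Fin m) → cubeToSphere m s = cubeToSphere m t →
      cubeWeight s ≤ cubeWeight t → cubeWeight t ≤ cubeWeight s := fun s t hs ht h hle => by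
    refine Finset.prod_le_prod (fun i _ => sub_nonneg.2 (cubeCoord_sq_le t i)) fun i _ => ?_
    rw [cubeCoord_div_cubeWeight hs, cubeCoord_div_cubeWeight ht, h, mul_pow, mul_pow]
    have := pow_le_pow_left₀ (cubeWeight_nonneg s) hle 2
    have h2 := sq_nonneg ((cubeToSphere m t).1 i.castSucc /
      (1 - (cubeToSphere m t).1 (Fin.last m)))
    nlinarith
  have hw : cubeWeight s = cubeWeight t := by
    rcases le_total (cubeWeight s) (cubeWeight t) with h1 | h1
    · exact le_antisymm h1 (key s t hs ht h h1)
    · exact le_antisymm (key t s ht hs h.symm h1) h1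
  refine Or.inl (funext fun i => Subtype.ext ?_)
  have : cubeCoord s i = cubeCoord t i := by
    rw [cubeCoord_div_cubeWeight hs, cubeCoord_div_cubeWeight ht, h, hw]
  simp only [cubeCoord] at this
  linarith

theorem surjective_cubeToSphere (hm : 1 ≤ m) : Function.Surjective (cubeToSphere m) := by
  intro y
  have hy : ∑ i, y.1 (Fin.castSucc i) ^ 2 + y.1 (Fin.last m) ^ 2 = 1 := by
    have h : ‖y.1‖ = 1 := mem_sphere_zero_iff_norm.1 y.2
    have h2 := EuclideanSpace.norm_sq_eq y.1
    rw [h, Fin.sum_univ_castSucc] at h2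
    simpa using h2.symm
  have hsum : 0 ≤ ∑ i, y.1 (Fin.castSucc i) ^ 2 := Finset.sum_nonneg fun i _ => sq_nonneg _
  by_cases hl : y.1 (Fin.last m) = 1
  · refine ⟨fun _ => 0, ?_⟩
    rw [cubeToSphere_boundary ⟨⟨0, hm⟩, Or.inl rfl⟩]
    refine sphere_ext (fun i => ?_) (by rw [northPole_last, hl])
    rw [northPole_castSucc]
    rw [hl] at hy
    have h0 : ∑ i, y.1 (Fin.castSucc i) ^ 2 = 0 := by linarith
    have := (Finset.sum_eq_zero_iff_of_nonneg fun i _ => sq_nonneg _).1 h0 i (Finset.mem_univ i)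
    exact (pow_eq_zero_iff two_ne_zero).1 this |>.symm
  have hl1 : y.1 (Fin.last m) < 1 := by
    refine lt_of_le_of_ne ?_ hl
    nlinarith
  let a : Fin m → ℝ := fun i => y.1 i.castSucc / (1 - y.1 (Fin.last m))
  let φ : ℝ → ℝ := fun r => ∏ i, max 0 (1 - (r * a i) ^ 2) - r
  have hφ : Continuous φ := by
    refine (continuous_finsetProd _ fun i _ => ?_).sub continuous_id
    fun_prop
  have hφ0 : φ 0 = 1 := by simp [φ]
  have hφ1 : φ 1 ≤ 0 := by
    refine sub_nonpos.2 (Finset.prod_le_one (fun i _ => le_max_left _ _) fun i _ => ?_)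
    exact max_le zero_le_one (by nlinarith [sq_nonneg (1 * a i)])
  obtain ⟨r, hr, hr0⟩ := intermediate_value_Icc' zero_le_one hφ.continuousOn
    (show (0 : ℝ) ∈ Set.Icc (φ 1) (φ 0) from ⟨hφ1, by rw [hφ0]; exact zero_le_one⟩)
  have hr1 : 0 < r := hr.1.lt_of_ne fun h => by
    rw [← h, hφ0] at hr0
    exact one_ne_zero hr0
  have hpr : ∏ i, max 0 (1 - (r * a i) ^ 2) = r := by simpa [φ, sub_eq_zero] using hr0
  have hpos : ∀ i, 0 < 1 - (r * a i) ^ 2 := fun i => by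
    by_contra! h
    have : ∏ i, max 0 (1 - (r * a i) ^ 2) = 0 :=
      Finset.prod_eq_zero (Finset.mem_univ i) (max_eq_left h)
    exact hr1.ne' (hpr.symm.trans this)
  have habs : ∀ i, |r * a i| ≤ 1 := fun i =>
    sq_le_one_iff_abs_le_one _ |>.1 (sub_nonneg.1 (hpos i).le)
  let t : Fin m → unitInterval := fun i => ⟨(r * a i + 1) / 2,
    by linarith [neg_le_of_abs_le (habs i)], by linarith [le_of_abs_le (habs i)]⟩
  have hc : ∀ i, cubeCoord t i = r * a i := fun i => by
    simp only [cubeCoord, t]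
    ring
  have hw : cubeWeight t = r := by
    rw [cubeWeight, ← hpr]
    refine Finset.prod_congr rfl fun i _ => ?_
    rw [hc, max_eq_right (hpos i).le]
  have hl1' : 1 - y.1 (Fin.last m) ≠ 0 := by linarith
  have hn : cubeNormSq t = r ^ 2 * ((1 + y.1 (Fin.last m)) / (1 - y.1 (Fin.last m))) := by
    have : ∑ i, y.1 (Fin.castSucc i) ^ 2
      = (1 - y.1 (Fin.last m)) * (1 + y.1 (Fin.last m)) := by linarith
    simp only [cubeNormSq, hc, mul_pow, ← Finset.mul_sum, a, div_pow, ← Finset.sum_div, this]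
    field_simp
  have hD : cubeNormSq t + cubeWeight t ^ 2 = 2 * r ^ 2 / (1 - y.1 (Fin.last m)) := by
    rw [hn, hw]
    field_simp
    ring
  refine ⟨t, sphere_ext (fun i => ?_) ?_⟩
  · rw [cubeToSphere_castSucc, hD, hc, hw]
    simp only [a]
    field_simp
  · rw [cubeToSphere_last, hD, hn, hw]
    field_simp
    ring

theorem isQuotientMap_cubeToSphere (hm : 1 ≤ m) : IsQuotientMap (cubeToSphere m) :=
  continuous_cubeToSphere.isClosedMap.isQuotientMap continuous_cubeToSphere
    (surjective_cubeToSphere hm)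

end CubeToSphere

/-- Stable triviality of complex vector bundles over odd-dimensional spheres. -/
theorem framesStably_sphere {m : ℕ} (hm : Odd m) : FramesStably (Sph m) ∅ := by
  intro ι _ _ P hP hPP _
  have hq := isQuotientMap_cubeToSphere hm.pos
  obtain ⟨κ, ρ, _, _, _, _, C, R, hC, hR, hCR, h⟩ :=
    (nullStably_framesStably_cube m (Fin m) (Fintype.card_fin m)).2 hm ι
      (fun t => P (cubeToSphere m t)) (hP.comp continuous_cubeToSphere) (fun t => hPP _)
      fun s hs t ht => by rw [cubeToSphere_boundary hs, cubeToSphere_boundary ht]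
  obtain ⟨C', hC', hCC⟩ := exists_descend hq (fun s t => cubeToSphere_eq) hC
    fun s hs t ht => (hCR s hs t ht).1
  obtain ⟨R', hR', hRR⟩ := exists_descend hq (fun s t => cubeToSphere_eq) hR
    fun s hs t ht => (hCR s hs t ht).2
  refine ⟨κ, ρ, inferInstance, inferInstance, inferInstance, inferInstance, C', R', hC', hR',
    by simp, fun x => ?_⟩
  obtain ⟨t, rfl⟩ := hq.surjective x
  rw [hCC, hRR]
  exact h t

/-- A family of row vectors `u` can be moved to the family `v` by a continuous family of
invertible matrices acting on the right. -/
def Movable {X ι : Type*} [TopologicalSpace X] [Fintype ι] [DecidableEq ι]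
    (u v : X → EuclideanSpace ℂ ι) : Prop :=
  ∃ g : X → Matrix ι ι ℂ, Continuous g ∧ (∀ x, (g x).det ≠ 0) ∧
    ∀ x, Matrix.vecMul (u x).ofLp (g x) = (v x).ofLp

theorem Movable.trans {X ι : Type*} [TopologicalSpace X] [Fintype ι] [DecidableEq ι]
    {u v w : X → EuclideanSpace ℂ ι} (h : Movable u v) (h' : Movable v w) : Movable u w := by
  obtain ⟨g, hg, hd, hm⟩ := h
  obtain ⟨g', hg', hd', hm'⟩ := h'
  refine ⟨fun x => g x * g' x, hg.matrix_mul hg', fun x => ?_, fun x => ?_⟩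
  · rw [Matrix.det_mul]
    exact mul_ne_zero (hd x) (hd' x)
  · rw [← Matrix.vecMul_vecMul, hm, hm']

theorem Movable.of_inner_pos {X ι : Type*} [TopologicalSpace X] [Fintype ι] [DecidableEq ι]
    {u v : X → EuclideanSpace ℂ ι} (hu : Continuous u) (hv : Continuous v)
    (h : ∀ x, 0 < inner ℝ (u x) (v x)) : Movable u v := by
  have hu0 : ∀ x, (u x).ofLp ⬝ᵥ star (u x).ofLp ≠ 0 := fun x hx => by
    have h0 : u x = 0 := by
      rw [← inner_self_eq_zero (𝕜 := ℂ), EuclideanSpace.inner_eq_star_dotProduct, hx]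
    have := h x
    rw [h0, inner_zero_left] at this
    exact lt_irrefl _ this
  have huv : ∀ x, (v x).ofLp ⬝ᵥ star (u x).ofLp ≠ 0 := fun x hx => by
    have h1 : inner ℝ (u x) (v x) = ((v x).ofLp ⬝ᵥ star (u x).ofLp).re := by
      rw [PiLp.inner_apply, dotProduct, Complex.re_sum]
      rfl
    have := h x
    rw [h1, hx] at this
    exact lt_irrefl _ this
  have cu : Continuous fun x => (u x).ofLp := (PiLp.continuous_ofLp 2 _).comp hu
  have cv : Continuous fun x => (v x).ofLp := (PiLp.continuous_ofLp 2 _).comp hv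
  have csu : Continuous fun x => star (u x).ofLp := cu.star
  have cd : Continuous fun x => ((u x).ofLp ⬝ᵥ star (u x).ofLp)⁻¹ :=
    (cu.dotProduct csu).inv₀ hu0
  refine ⟨fun x => 1 + Matrix.replicateCol Unit (((u x).ofLp ⬝ᵥ star (u x).ofLp)⁻¹ •
    star (u x).ofLp) * Matrix.replicateRow Unit ((v x).ofLp - (u x).ofLp), ?_, fun x => ?_,
    fun x => ?_⟩
  · refine continuous_const.add (Continuous.matrix_mul ?_ ?_)
    · refine continuous_matrix fun i j => ?_
      exact (continuous_apply i).comp (cd.smul csu)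
    · refine continuous_matrix fun i j => ?_
      exact (continuous_apply j).comp (cv.sub cu)
  · rw [Matrix.det_one_add_replicateCol_mul_replicateRow, dotProduct_smul, sub_dotProduct,
      smul_eq_mul, mul_sub, inv_mul_cancel₀ (hu0 x), add_sub_cancel]
    exact mul_ne_zero (inv_ne_zero (hu0 x)) (huv x)
  · simp only []
    rw [← Matrix.vecMulVec_eq, Matrix.vecMul_add, Matrix.vecMul_one, Matrix.vecMul_vecMulVec,
      dotProduct_smul, smul_eq_mul, inv_mul_cancel₀ (hu0 x), one_smul, add_sub_cancel]

theorem Movable.of_not_mem_line {X ι : Type*} [TopologicalSpace X] [Fintype ι] [DecidableEq ι]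
    {u : X → EuclideanSpace ℂ ι} {c : EuclideanSpace ℂ ι} (hu : Continuous u)
    (hu0 : ∀ x, u x ≠ 0) (hc : ∀ x (t : ℝ), t • u x ≠ c) (hc0 : c ≠ 0) :
    Movable u fun _ => c := by
  have key : ∀ x, 0 < ‖u x‖ * ‖c‖ + inner ℝ (u x) c := fun x => by
    have h : inner ℝ (-u x) c < ‖-u x‖ * ‖c‖ := by
      rw [inner_lt_norm_mul_iff_real]
      intro h
      apply hc x (-(‖u x‖⁻¹ * ‖c‖))
      rw [norm_neg] at h
      have h0 := norm_ne_zero_iff.2 (hu0 x)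
      rw [neg_smul, mul_smul, ← smul_neg, ← smul_neg, h, inv_smul_smul₀ h0]
    rw [inner_neg_left, norm_neg] at h
    linarith
  have hm : Continuous fun x => ‖c‖ • u x + ‖u x‖ • c := by fun_prop
  refine (Movable.of_inner_pos hu hm fun x => ?_).trans
    (Movable.of_inner_pos hm continuous_const fun x => ?_)
  · rw [inner_add_right, inner_smul_right, inner_smul_right, real_inner_self_eq_norm_sq]
    have := mul_pos (norm_pos_iff.2 (hu0 x)) (key x)
    nlinarith
  · rw [inner_add_left, real_inner_smul_left, real_inner_smul_left, real_inner_self_eq_norm_sq]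
    have := mul_pos (norm_pos_iff.2 hc0) (key x)
    nlinarith

theorem movable_sphere {m M : ℕ} (hmM : m + 2 < 2 * M) {ψ : Sph m → EuclideanSpace ℂ (Fin M)}
    (hψ : Continuous ψ) (hψ0 : ∀ x, ψ x ≠ 0) {w : EuclideanSpace ℂ (Fin M)} (hw : w ≠ 0) :
    Movable ψ fun _ => w := by
  have hcompact : CompactSpace (Sph m) := isCompact_iff_compactSpace.1 (isCompact_sphere _ _)
  obtain ⟨Ψ₀, hΨ₀⟩ := ContinuousMap.exists_restrict_eq (s := Sph m) Metric.isClosed_sphere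
    (⟨ψ, hψ⟩ : C(Sph m, EuclideanSpace ℂ (Fin M)))
  have hΨ₀' : ∀ x : Sph m, Ψ₀ x = ψ x := fun x => congrArg (fun f => f x) hΨ₀
  have hne : Nonempty (Sph m) := ⟨northPole m⟩
  obtain ⟨x₀, -, hx₀⟩ := isCompact_univ.exists_isMinOn (Set.univ_nonempty (α := Sph m))
    hψ.norm.continuousOn
  set δ := ‖ψ x₀‖
  have hδ : 0 < δ := norm_pos_iff.2 (hψ0 x₀)
  have hδ' : ∀ x, δ ≤ ‖ψ x‖ := fun x => hx₀ (Set.mem_univ x)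
  obtain ⟨Ψ, hΨ, hΨd, -⟩ := Ψ₀.continuous.exists_contDiff_approx (ε := fun _ => δ) 1
    continuous_const (fun _ => hδ)
  have hpos : ∀ x : Sph m, 0 < inner ℝ (ψ x) (Ψ x) := fun x => by
    have h1 : ‖Ψ x - ψ x‖ < δ := by
      rw [← dist_eq_norm, ← hΨ₀']
      exact hΨd x
    have h2 : inner ℝ (ψ x) (Ψ x) = ‖ψ x‖ ^ 2 + inner ℝ (ψ x) (Ψ x - ψ x) := by
      rw [inner_sub_right, real_inner_self_eq_norm_sq]
      ring
    have h3 := neg_le_of_abs_le (abs_real_inner_le_norm (ψ x) (Ψ x - ψ x))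
    have h4 := hδ' x
    have h5 : 0 < ‖ψ x‖ := hδ.trans_le h4
    have h6 := mul_lt_mul_of_pos_left (h1.trans_le h4) h5
    rw [h2]
    nlinarith
  have hΨ0 : ∀ x : Sph m, Ψ x ≠ 0 := fun x hx => by
    have := hpos x
    rw [hx, inner_zero_right] at this
    exact lt_irrefl _ this
  have hΨc : Continuous fun x : Sph m => Ψ x := hΨ.continuous.comp continuous_subtype_val
  have hdense : Dense (Set.range fun p : ℝ × EuclideanSpace ℝ (Fin (m + 1)) => p.1 • Ψ p.2)ᶜ := by
    refine ContDiff.dense_compl_range_of_finrank_lt_finrank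
      (contDiff_fst.smul (hΨ.comp contDiff_snd)) ?_
    rw [finrank_real_of_complex, Module.finrank_prod]
    simp
    omega
  obtain ⟨c, hcw, hc⟩ := hdense.exists_mem_open Metric.isOpen_ball
    ⟨w, Metric.mem_ball_self (norm_pos_iff.2 hw)⟩
  have hc' : ∀ (x : Sph m) (t : ℝ), t • Ψ x ≠ c := fun x t h => hcw ⟨(t, x), h⟩
  have hc0 : c ≠ 0 := fun h => hc' x₀ 0 (by rw [zero_smul, h])
  refine ((Movable.of_inner_pos hψ hΨc hpos).trans (Movable.of_not_mem_line hΨc hΨ0 hc' hc0)).trans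
    (Movable.of_inner_pos continuous_const continuous_const fun x => ?_)
  rw [Metric.mem_ball, dist_eq_norm] at hc
  have h2 : inner ℝ c w = ‖w‖ ^ 2 + inner ℝ (c - w) w := by
    rw [inner_sub_left, real_inner_self_eq_norm_sq]
    ring
  have h3 := neg_le_of_abs_le (abs_real_inner_le_norm (c - w) w)
  have h6 := mul_lt_mul_of_pos_right hc (norm_pos_iff.2 hw)
  rw [h2]
  nlinarith

/-- The idempotent family `Q` has an image that is a trivial bundle of rank `d`. -/
def HasFrame {Y ι : Type} [TopologicalSpace Y] [Fintype ι] (Q : Y → Matrix ι ι ℂ) (d : ℕ) : Prop :=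
  ∃ (C : Y → Matrix ι (Fin d) ℂ) (R : Y → Matrix (Fin d) ι ℂ), Continuous C ∧ Continuous R ∧
    (∀ y, R y * C y = 1) ∧ ∀ y, C y * R y = Q y

theorem HasFrame.reindex {Y ι κ : Type} [TopologicalSpace Y] [Fintype ι] [Fintype κ]
    {Q : Y → Matrix ι ι ℂ} {d : ℕ} (h : HasFrame Q d) (e : κ ≃ ι) :
    HasFrame (fun y => (Q y).submatrix e e) d := by
  obtain ⟨C, R, hC, hR, h1, h2⟩ := h
  refine ⟨fun y => (C y).submatrix e id, fun y => (R y).submatrix id e, by fun_prop, by fun_prop,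
    fun y => ?_, fun y => ?_⟩
  · rw [Matrix.submatrix_mul_equiv, h1, Matrix.submatrix_id_id]
  · ext i j
    simp [← h2, Matrix.mul_apply]

theorem HasFrame.of_add_one {m d : ℕ} (hmd : m + 2 < 2 * (d + 1)) {ι : Type} [Fintype ι]
    {Q : Sph m → Matrix ι ι ℂ}
    (h : HasFrame (fun y => (Matrix.fromBlocks (Q y) 0 0 1 : Matrix (ι ⊕ Unit) (ι ⊕ Unit) ℂ))
      (d + 1)) : HasFrame Q d := by
  obtain ⟨C, R, hC, hR, h1, h2⟩ := h
  have hψ : Continuous fun y => (WithLp.toLp 2 (C y (Sum.inr ())) : EuclideanSpace ℂ (Fin (d + 1))) :=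
    (PiLp.continuous_toLp 2 _).comp ((continuous_apply _).comp hC)
  obtain ⟨g, hg, hgd, hm⟩ := movable_sphere hmd hψ (fun y hy => by
    have h3 := congrFun (congrFun (h2 y) (Sum.inr ())) (Sum.inr ())
    have h4 : C y (Sum.inr ()) = 0 := congrArg WithLp.ofLp hy
    rw [Matrix.mul_apply_eq_vecMul, h4, Matrix.zero_vecMul] at h3
    simp at h3) (w := EuclideanSpace.single (Fin.last d) 1)
    (by
      intro h
      have := congrArg norm h
      simp at this)
  have hgu : ∀ y, IsUnit (g y).det := fun y => isUnit_iff_ne_zero.2 (hgd y)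
  have hC' : Continuous fun y => C y * g y := hC.matrix_mul hg
  have hR' : Continuous fun y => (g y)⁻¹ * R y :=
    (continuous_matrix_inv (g := g) hg hgd).matrix_mul hR
  have hRC : ∀ y, ((g y)⁻¹ * R y) * (C y * g y) = 1 := fun y => by
    rw [Matrix.mul_assoc, ← Matrix.mul_assoc (R y), h1, Matrix.one_mul,
      Matrix.nonsing_inv_mul _ (hgu y)]
  have hCR : ∀ y, (C y * g y) * ((g y)⁻¹ * R y) = Matrix.fromBlocks (Q y) 0 0 1 := fun y => by
    rw [Matrix.mul_assoc, ← Matrix.mul_assoc (g y), Matrix.mul_nonsing_inv _ (hgu y),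
      Matrix.one_mul, h2]
  have hlast : ∀ y j, (C y * g y) (Sum.inr ()) j = (Pi.single (Fin.last d) 1 : Fin (d + 1) → ℂ) j :=
    fun y j => by
      rw [Matrix.mul_apply_eq_vecMul]
      exact congrFun (hm y) j
  generalize hC'' : (fun y => C y * g y) = C' at hC'
  generalize hR'' : (fun y => (g y)⁻¹ * R y) = R' at hR'
  replace hRC : ∀ y, R' y * C' y = 1 := by rw [← hC'', ← hR'']; exact hRC
  replace hCR : ∀ y, C' y * R' y = Matrix.fromBlocks (Q y) 0 0 1 := by
    rw [← hC'', ← hR'']; exact hCR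
  replace hlast : ∀ y j, C' y (Sum.inr ()) j = (Pi.single (Fin.last d) 1 : Fin (d + 1) → ℂ) j := by
    rw [← hC'']; exact hlast
  have hRlast : ∀ y (i : ι), R' y (Fin.last d) (Sum.inl i) = 0 := fun y i => by
    have h3 := congrFun (congrFun (hCR y) (Sum.inr ())) (Sum.inl i)
    rw [Matrix.mul_apply] at h3
    simpa [hlast, Pi.single_apply] using h3
  refine ⟨fun y => (C' y).submatrix Sum.inl Fin.castSucc, fun y => (R' y).submatrix Fin.castSucc
    Sum.inl, by fun_prop, by fun_prop, fun y => ?_, fun y => ?_⟩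
  · ext i j
    have h3 := congrFun (congrFun (hRC y) i.castSucc) j.castSucc
    rw [Matrix.mul_apply, Fintype.sum_sum_type] at h3
    simpa [hlast, Matrix.mul_apply, Matrix.one_apply, Pi.single_apply] using h3
  · ext i j
    have h3 := congrFun (congrFun (hCR y) (Sum.inl i)) (Sum.inl j)
    rw [Matrix.mul_apply, Fin.sum_univ_castSucc, hRlast, mul_zero, add_zero] at h3
    exact h3

theorem HasFrame.of_add {m d : ℕ} (hmd : m + 2 < 2 * (d + 1)) {ι : Type} [Fintype ι]
    {Q : Sph m → Matrix ι ι ℂ} : ∀ c : ℕ,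
    HasFrame (fun y => (Matrix.fromBlocks (Q y) 0 0 1 : Matrix (ι ⊕ Fin c) (ι ⊕ Fin c) ℂ))
      (d + c) → HasFrame Q d
  | 0, h => by
    exact h.reindex (Equiv.sumEmpty ι (Fin 0)).symm
  | c + 1, h => by
    refine HasFrame.of_add hmd c (HasFrame.of_add_one (by omega) ?_)
    let e : (ι ⊕ Fin c) ⊕ Unit ≃ ι ⊕ Fin (c + 1) :=
      (Equiv.sumAssoc ι (Fin c) Unit).trans
        (Equiv.sumCongr (Equiv.refl ι) ((Equiv.sumCongr (Equiv.refl _) finOneEquiv.symm).trans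
          finSumFinEquiv))
    have h3 := h.reindex e
    have hfun : ∀ y, (Matrix.fromBlocks (Matrix.fromBlocks (Q y) 0 0 1) 0 0 1 :
        Matrix ((ι ⊕ Fin c) ⊕ Unit) ((ι ⊕ Fin c) ⊕ Unit) ℂ) =
        (Matrix.fromBlocks (Q y) 0 0 1 :
          Matrix (ι ⊕ Fin (c + 1)) (ι ⊕ Fin (c + 1)) ℂ).submatrix e e := fun y => by
      have hlt : ∀ i : Fin c, (i : ℕ) ≠ c := fun i => i.2.ne
      have hgt : ∀ i : Fin c, c ≠ (i : ℕ) := fun i => i.2.ne'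
      ext i j
      rcases i with (i | i) | i <;> rcases j with (j | j) | j <;>
        simp [e, Matrix.one_apply, Fin.ext_iff, hlt, hgt]
    simp only [hfun]
    exact h3

theorem hasFrame_sphere {m d : ℕ} (hm : Odd m) (hmd : m + 2 < 2 * (d + 1)) {ι : Type} [Fintype ι]
    [DecidableEq ι] {P : Sph m → Matrix ι ι ℂ} (hP : Continuous P) (hPP : ∀ y, P y * P y = P y)
    (htr : ∀ y, (P y).trace = d) : HasFrame P d := by
  obtain ⟨κ, ρ, hκ, _, hρ, hρ', C, R, hC, hR, -, hCR⟩ := framesStably_sphere hm ι P hP hPP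
    (fun x hx => hx.elim)
  have hcard : Fintype.card ρ = d + Fintype.card κ := by
    have h1 := congrArg Matrix.trace (hCR (northPole m)).1
    rw [Matrix.trace_mul_comm, (hCR (northPole m)).2, Matrix.trace_one] at h1
    have h2 := htr (northPole m)
    simp only [Matrix.trace, Fintype.sum_sum_type, Matrix.diag_apply, Matrix.fromBlocks_apply₁₁,
      Matrix.fromBlocks_apply₂₂, Matrix.one_apply_eq, Finset.sum_const, Finset.card_univ,
      nsmul_eq_mul, mul_one] at h1 h2
    rw [h2] at h1
    exact_mod_cast h1.symm
  let a : ρ ≃ Fin (d + Fintype.card κ) := Fintype.equivFinOfCardEq hcard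
  let b : ι ⊕ Fin (Fintype.card κ) ≃ ι ⊕ κ :=
    Equiv.sumCongr (Equiv.refl ι) (Fintype.equivFin κ).symm
  refine HasFrame.of_add hmd (Fintype.card κ) ?_
  have h0 : HasFrame (fun y => (Matrix.fromBlocks (P y) 0 0 1 : Matrix (ι ⊕ κ) (ι ⊕ κ) ℂ))
      (d + Fintype.card κ) := by
    refine ⟨fun y => (C y).submatrix id a.symm, fun y => (R y).submatrix a.symm id, by fun_prop,
      by fun_prop, fun y => ?_, fun y => ?_⟩
    · have := Matrix.submatrix_mul (R y) (C y) a.symm id a.symm Function.bijective_id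
      rw [← this, (hCR y).1, Matrix.submatrix_one_equiv]
    · rw [Matrix.submatrix_mul_equiv, (hCR y).2, Matrix.submatrix_id_id]
  have hfun : ∀ y, (Matrix.fromBlocks (P y) 0 0 1 :
      Matrix (ι ⊕ Fin (Fintype.card κ)) (ι ⊕ Fin (Fintype.card κ)) ℂ) =
      (Matrix.fromBlocks (P y) 0 0 1 : Matrix (ι ⊕ κ) (ι ⊕ κ) ℂ).submatrix b b := fun y => by
    ext i j
    rcases i with i | i <;> rcases j with j | j <;> simp [b, Matrix.one_apply]
  simp only [hfun]
  exact h0.reindex b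

theorem continuous_gramSchmidt {Y E : Type*} [TopologicalSpace Y] [NormedAddCommGroup E]
    [InnerProductSpace ℂ E] {d : ℕ} {v : Y → Fin d → E} (hv : ∀ i, Continuous fun y => v y i)
    (hli : ∀ y, LinearIndependent ℂ (v y)) (i : Fin d) :
    Continuous fun y => InnerProductSpace.gramSchmidt ℂ (v y) i := by
  induction i using WellFoundedLT.induction with
  | ind i ih =>
    have h : (fun y => InnerProductSpace.gramSchmidt ℂ (v y) i) = fun y => v y i -
        ∑ j ∈ Finset.Iio i, (inner ℂ (InnerProductSpace.gramSchmidt ℂ (v y) j) (v y i) /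
          ((‖InnerProductSpace.gramSchmidt ℂ (v y) j‖ ^ 2 : ℝ) : ℂ)) •
            InnerProductSpace.gramSchmidt ℂ (v y) j := by
      funext y
      rw [InnerProductSpace.gramSchmidt_def]
      congr 1
      refine Finset.sum_congr rfl fun j _ => ?_
      rw [Submodule.starProjection_singleton]
      rfl
    rw [h]
    refine (hv i).sub (continuous_finsetSum _ fun j hj => ?_)
    have hj := ih j (Finset.mem_Iio.1 hj)
    refine Continuous.smul (Continuous.div (hj.inner (hv i)) ?_ fun y => ?_) hj
    · exact Complex.continuous_ofReal.comp (hj.norm.pow 2)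
    · have := InnerProductSpace.gramSchmidt_ne_zero j (hli y)
      simpa using this

theorem exists_orthonormal_frame {Y ι : Type} [TopologicalSpace Y] [Fintype ι] [DecidableEq ι]
    {P : Y → Matrix ι ι ℂ} {d : ℕ} (h : HasFrame P d) :
    ∃ Φ : Y → Matrix ι (Fin d) ℂ, Continuous Φ ∧ (∀ y, (Φ y).conjTranspose * Φ y = 1) ∧
      ∀ y, P y * Φ y = Φ y := by
  obtain ⟨C, R, hC, hR, h1, h2⟩ := h
  let v : Y → Fin d → EuclideanSpace ℂ ι := fun y j => WithLp.toLp 2 fun i => C y i j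
  have hv : ∀ j, Continuous fun y => v y j := fun j => by
    refine (PiLp.continuous_toLp 2 _).comp (continuous_pi fun i => ?_)
    fun_prop
  have hli : ∀ y, LinearIndependent ℂ (v y) := fun y => by
    rw [Fintype.linearIndependent_iff]
    intro c hc j
    have h3 : Matrix.mulVec (C y) c = 0 := by
      funext i
      have := congrFun (congrArg WithLp.ofLp hc) i
      simpa [v, Matrix.mulVec, dotProduct, mul_comm] using this
    have h4 := congrArg (Matrix.mulVec (R y)) h3
    rw [Matrix.mulVec_mulVec, h1, Matrix.one_mulVec, Matrix.mulVec_zero] at h4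
    exact congrFun h4 j
  have hcont : ∀ j, Continuous fun y => InnerProductSpace.gramSchmidtNormed ℂ (v y) j := fun j => by
    have h5 := continuous_gramSchmidt hv hli j
    refine Continuous.smul (Complex.continuous_ofReal.comp ((h5.norm).inv₀ fun y => ?_)) h5 |>.congr
      fun y => ?_
    · exact norm_ne_zero_iff.2 (InnerProductSpace.gramSchmidt_ne_zero j (hli y))
    · simp [InnerProductSpace.gramSchmidtNormed]
  refine ⟨fun y => Matrix.of fun i j => (InnerProductSpace.gramSchmidtNormed ℂ (v y) j).ofLp i, ?_, fun y => ?_,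
    fun y => ?_⟩
  · exact continuous_matrix fun i j => (continuous_apply i).comp
      ((PiLp.continuous_ofLp 2 _).comp (hcont j))
  · ext j k
    have h6 := (orthonormal_iff_ite.1 (InnerProductSpace.gramSchmidtNormed_orthonormal (hli y))) j k
    rw [PiLp.inner_apply] at h6
    simp only [Matrix.mul_apply, Matrix.conjTranspose_apply, Matrix.one_apply, Matrix.of_apply]
    rw [← h6]
    exact Finset.sum_congr rfl fun i _ => by simp [mul_comm]
  · let W : Submodule ℂ (EuclideanSpace ℂ ι) :=
      { carrier := {w | Matrix.mulVec (P y) w.ofLp = w.ofLp}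
        add_mem' := fun {a b} ha hb => by
          change Matrix.mulVec (P y) (a.ofLp + b.ofLp) = a.ofLp + b.ofLp
          rw [Matrix.mulVec_add, ha, hb]
        zero_mem' := Matrix.mulVec_zero _
        smul_mem' := fun c a ha => by
          change Matrix.mulVec (P y) (c • a.ofLp) = c • a.ofLp
          rw [Matrix.mulVec_smul, ha] }
    have hvW : ∀ j, v y j ∈ W := fun j => by
      change Matrix.mulVec (P y) (fun i => C y i j) = fun i => C y i j
      have h7 : P y * C y = C y := by rw [← h2, Matrix.mul_assoc, h1, Matrix.mul_one]
      funext i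
      exact congrFun (congrFun h7 i) j
    have hW : ∀ j, InnerProductSpace.gramSchmidtNormed ℂ (v y) j ∈ W := fun j => by
      refine W.smul_mem _ ?_
      refine Submodule.span_le.2 ?_ (InnerProductSpace.gramSchmidt_mem_span ℂ (v y) le_rfl)
      rintro _ ⟨k, -, rfl⟩
      exact hvW k
    ext i j
    exact congrFun (hW j) i

theorem exists_orthogonal_lift {m N : ℕ} (hm : Odd m) (hmN : m + 2 < 2 * (N + 1))
    {J : Sph m → Matrix (Fin N ⊕ Fin N) (Fin N ⊕ Fin N) ℝ} (hJ : Continuous J)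
    (hJΓ : ∀ x, J x ∈ Gamma N) :
    ∃ F : Sph m → Matrix (Fin N ⊕ Fin N) (Fin N ⊕ Fin N) ℝ, Continuous F ∧
      (∀ x, (F x).transpose * F x = 1) ∧ ∀ x, J x * F x = F x * J0 N := by
  have hJT : ∀ x, (J x).transpose = -J x := fun x => by
    have h1 : (J x).transpose * (J x * J x) = J x := by
      rw [← Matrix.mul_assoc, (hJΓ x).1, Matrix.one_mul]
    rw [(hJΓ x).2, Matrix.mul_neg, Matrix.mul_one] at h1
    rw [← h1, neg_neg, h1]
  have hJC : Continuous fun x => (J x).map Complex.ofReal := hJ.matrix_map Complex.continuous_ofReal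
  have hJJ : ∀ x, (J x).map Complex.ofReal * (J x).map Complex.ofReal = -1 := fun x => by
    have h := congrArg (fun A : Matrix _ _ ℝ => A.map Complex.ofRealHom) (hJΓ x).2
    simp only [Matrix.map_mul] at h
    refine h.trans ?_
    ext i j
    simp [Matrix.one_apply, apply_ite]
  obtain ⟨Φ, hΦ, hΦΦ, hPΦ⟩ := exists_orthonormal_frame (hasFrame_sphere hm hmN
    (P := fun x => (1 / 2 : ℂ) • (1 - Complex.I • (J x).map Complex.ofReal)) (by fun_prop)
    (fun x => by
      simp only [Matrix.smul_mul, Matrix.mul_smul, sub_mul, mul_sub, one_mul, mul_one, hJJ,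
        smul_smul]
      ext i j
      simp only [Matrix.smul_apply, Matrix.sub_apply, Matrix.neg_apply, smul_eq_mul]
      linear_combination (-(1 / 4) : ℂ) * (1 : Matrix _ _ ℂ) i j * Complex.I_sq)
    (fun x => by
      have htr : (J x).trace = 0 := by
        have := Matrix.trace_transpose (J x)
        rw [hJT, Matrix.trace_neg] at this
        linarith
      have htr' : ((J x).map Complex.ofReal).trace = 0 := by
        have := congrArg Complex.ofReal htr
        simpa [Matrix.trace] using this
      rw [Matrix.trace_smul, Matrix.trace_sub, Matrix.trace_smul, htr', Matrix.trace_one]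
      simp
      ring))
  have hJΦ : ∀ x, (J x).map Complex.ofReal * Φ x = Complex.I • Φ x := fun x => by
    ext i j
    have h := congrFun (congrFun (hPΦ x) i) j
    rw [Matrix.smul_mul, Matrix.sub_mul, Matrix.one_mul, Matrix.smul_mul] at h
    simp only [Matrix.smul_apply, Matrix.sub_apply, smul_eq_mul] at h ⊢
    linear_combination 2 * Complex.I * h +
      ((J x).map Complex.ofReal * Φ x) i j * Complex.I_sq
  have hTΦ : ∀ x, (Φ x).transpose * Φ x = 0 := fun x => by
    have h1 : (Φ x).transpose * ((J x).map Complex.ofReal * Φ x) =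
        Complex.I • ((Φ x).transpose * Φ x) := by rw [hJΦ, Matrix.mul_smul]
    have h2 : (Φ x).transpose * (J x).map Complex.ofReal = -(Complex.I • (Φ x).transpose) := by
      have := congrArg Matrix.transpose (hJΦ x)
      rw [Matrix.transpose_mul, ← Matrix.transpose_map, hJT, Matrix.transpose_smul] at this
      rw [← this]
      ext i j
      simp [Matrix.mul_apply]
    rw [← Matrix.mul_assoc, h2, Matrix.neg_mul, Matrix.smul_mul, neg_eq_iff_add_eq_zero,
      ← two_smul ℂ, smul_smul] at h1
    exact (smul_eq_zero.1 h1).resolve_left (by simp)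
  have e1 : ∀ x k l, (∑ i, (Φ x i k).re * (Φ x i l).re = if k = l then 1 / 2 else 0) ∧
      (∑ i, (Φ x i k).im * (Φ x i l).im = if k = l then 1 / 2 else 0) ∧
      (∑ i, (Φ x i k).re * (Φ x i l).im = 0) ∧ (∑ i, (Φ x i k).im * (Φ x i l).re = 0) :=
    fun x k l => by
      have h1 := congrFun (congrFun (hΦΦ x) k) l
      have h2 := congrFun (congrFun (hTΦ x) k) l
      simp only [Matrix.mul_apply, Matrix.conjTranspose_apply, Matrix.transpose_apply,
        Matrix.one_apply, Complex.ext_iff, Complex.re_sum, Complex.im_sum, Complex.mul_re,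
        Complex.mul_im, Complex.star_def, Complex.conj_re, Complex.conj_im, Matrix.zero_apply,
        Finset.sum_sub_distrib, Finset.sum_add_distrib, neg_mul, sub_neg_eq_add,
        Finset.sum_neg_distrib, Complex.zero_re, Complex.zero_im, apply_ite Complex.re,
        apply_ite Complex.im, Complex.one_re, Complex.one_im, ite_self] at h1 h2
      obtain ⟨h1, h1'⟩ := h1
      obtain ⟨h2, h2'⟩ := h2
      split_ifs at h1 ⊢ <;> refine ⟨?_, ?_, ?_, ?_⟩ <;> linarith
  have e2 : ∀ x i k, (∑ j, J x i j * (Φ x j k).re = -(Φ x i k).im) ∧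
      (∑ j, J x i j * (Φ x j k).im = (Φ x i k).re) := fun x i k => by
    have h1 := congrFun (congrFun (hJΦ x) i) k
    simpa [Matrix.mul_apply, Complex.ext_iff] using h1
  have h2 : Real.sqrt 2 * Real.sqrt 2 = 2 := Real.mul_self_sqrt (by norm_num)
  refine ⟨fun x => Matrix.of fun i => Sum.elim (fun k => Real.sqrt 2 * (Φ x i k).re)
    (fun k => -(Real.sqrt 2 * (Φ x i k).im)), ?_, fun x => ?_, fun x => ?_⟩
  · refine continuous_matrix fun i j => ?_
    have hij : ∀ k, Continuous fun x => Φ x i k := fun k => hΦ.matrix_elem i k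
    rcases j with k | k
    · exact continuous_const.mul (Complex.continuous_re.comp (hij k))
    · exact (continuous_const.mul (Complex.continuous_im.comp (hij k))).neg
  · ext j k
    simp only [Matrix.mul_apply, Matrix.transpose_apply, Matrix.of_apply]
    have hs : ∀ a b : ℝ, Real.sqrt 2 * a * (Real.sqrt 2 * b) = 2 * (a * b) := fun a b => by
      linear_combination a * b * h2
    rcases j with j | j <;> rcases k with k | k <;>
      simp only [Sum.elim_inl, Sum.elim_inr, neg_mul, mul_neg, neg_neg, hs,
        Finset.sum_neg_distrib, ← Finset.mul_sum, (e1 x j k).1, (e1 x j k).2.1, (e1 x j k).2.2.1,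
        (e1 x j k).2.2.2, Matrix.one_apply] <;> simp
  · ext i k
    simp only [Matrix.mul_apply, Matrix.of_apply]
    have hs : ∀ a b : ℝ, b * (Real.sqrt 2 * a) = Real.sqrt 2 * (b * a) := fun a b => by ring
    rcases k with k | k <;>
      simp [J0, hs, ← Finset.mul_sum, (e2 x i k).1, (e2 x i k).2, Fintype.sum_sum_type,
        Matrix.one_apply]

/-! ### Homotopy groups of mapping spaces out of spheres -/

section MappingSpaces

open scoped Topology.Homotopy unitInterval

theorem exists_mulEquiv_prod_of_split {A B G : Type*} [Group A] [Group B] [Group G] (c : A →* G)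
    (i : B →* G) (e : G →* A) (hec : ∀ a, e (c a) = a) (hei : ∀ b, e (i b) = 1)
    (hi : ∀ b, i b = 1 → b = 1) (hk : ∀ g, e g = 1 → ∃ b, i b = g)
    (hcomm : ∀ a b, Commute (c a) (i b)) : Nonempty (G ≃* A × B) := by
  refine ⟨(MulEquiv.ofBijective (MonoidHom.noncommCoprod c i hcomm) ⟨?_, fun g => ?_⟩).symm⟩
  · rw [injective_iff_map_eq_one]
    rintro ⟨a, b⟩ h
    rw [MonoidHom.noncommCoprod_apply] at h
    have ha : a = 1 := by
      have := congrArg e h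
      simpa [hec, hei] using this
    subst ha
    rw [map_one, one_mul] at h
    rw [hi b h]
    rfl
  · obtain ⟨b, hb⟩ := hk ((c (e g))⁻¹ * g) (by rw [map_mul, map_inv, hec, inv_mul_cancel])
    exact ⟨(e g, b), by rw [MonoidHom.noncommCoprod_apply, hb, mul_inv_cancel_left]⟩

/-- A map between spaces of generalized loops that respects homotopies and concatenation induces
a homomorphism of homotopy groups. -/
noncomputable def HomotopyGroup.homOfGenLoop {N N' X X' : Type*} [DecidableEq N] [DecidableEq N']
    [Nonempty N] [Nonempty N'] [TopologicalSpace X] [TopologicalSpace X'] {x : X} {x' : X'}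
    (φ : Ω^ N X x → Ω^ N' X' x')
    (hφ : ∀ p q, GenLoop.Homotopic p q → GenLoop.Homotopic (φ p) (φ q)) (i : N) (i' : N')
    (hi : ∀ p q, φ (GenLoop.transAt i p q) = GenLoop.transAt i' (φ p) (φ q)) :
    HomotopyGroup N X x →* HomotopyGroup N' X' x' :=
  MonoidHom.mk' (Quotient.map φ hφ) (by
    rintro ⟨p⟩ ⟨q⟩
    have h1 := HomotopyGroup.mul_spec (i := i) (p := p) (q := q)
    have h2 := HomotopyGroup.mul_spec (i := i') (p := φ p) (q := φ q)
    refine (congrArg (Quotient.map φ hφ) h1).trans (Eq.trans ?_ h2.symm)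
    exact congrArg (Quotient.mk _) (hi q p))

/-- Post-composition of generalized loops with a continuous map. -/
def GenLoop.postcomp {N X X' : Type*} [TopologicalSpace X] [TopologicalSpace X'] {x : X} {x' : X'}
    (h : C(X, X')) (hx : h x = x') (p : Ω^ N X x) : Ω^ N X' x' :=
  ⟨h.comp p.1, fun y hy => (congrArg h (p.2 y hy)).trans hx⟩

theorem GenLoop.postcomp_homotopic {N X X' : Type*} [TopologicalSpace X] [TopologicalSpace X']
    {x : X} {x' : X'} (h : C(X, X')) (hx : h x = x') (p q : Ω^ N X x)
    (H : GenLoop.Homotopic p q) :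
    GenLoop.Homotopic (GenLoop.postcomp h hx p) (GenLoop.postcomp h hx q) :=
  ContinuousMap.HomotopicRel.comp_continuousMap H h

theorem GenLoop.postcomp_transAt {N X X' : Type*} [DecidableEq N] [TopologicalSpace X]
    [TopologicalSpace X'] {x : X} {x' : X'} (h : C(X, X')) (hx : h x = x') (i : N)
    (p q : Ω^ N X x) : GenLoop.postcomp h hx (GenLoop.transAt i p q) =
      GenLoop.transAt i (GenLoop.postcomp h hx p) (GenLoop.postcomp h hx q) := by
  ext t
  exact apply_ite h _ _ _

/-- The homomorphism of homotopy groups induced by a continuous map. -/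
noncomputable def HomotopyGroup.map {N X X' : Type*} [DecidableEq N] [Nonempty N]
    [TopologicalSpace X] [TopologicalSpace X'] {x : X} {x' : X'} (h : C(X, X')) (hx : h x = x') :
    HomotopyGroup N X x →* HomotopyGroup N X' x' :=
  HomotopyGroup.homOfGenLoop (GenLoop.postcomp h hx) (GenLoop.postcomp_homotopic h hx)
    (Classical.arbitrary N) (Classical.arbitrary N) (GenLoop.postcomp_transAt h hx _)

/-- The isomorphism of homotopy groups induced by a homeomorphism. -/
noncomputable def HomotopyGroup.mulEquivOfHomeomorph {N X X' : Type*} [DecidableEq N] [Nonempty N]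
    [TopologicalSpace X] [TopologicalSpace X'] {x : X} {x' : X'} (h : X ≃ₜ X') (hx : h x = x') :
    HomotopyGroup N X x ≃* HomotopyGroup N X' x' :=
  MonoidHom.toMulEquiv (HomotopyGroup.map (h : C(X, X')) hx)
    (HomotopyGroup.map (h.symm : C(X', X)) (by rw [← hx]; exact h.symm_apply_apply x))
    (by
      ext ⟨p⟩
      refine congrArg (Quotient.mk _) (GenLoop.ext _ _ fun y => h.symm_apply_apply _))
    (by
      ext ⟨p⟩
      refine congrArg (Quotient.mk _) (GenLoop.ext _ _ fun y => h.apply_symm_apply _))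

theorem GenLoop.congr_homotopic {M N X : Type*} [TopologicalSpace X] {x : X} (e : M ≃ N)
    (p q : Ω^ M X x) (H : GenLoop.Homotopic p q) :
    GenLoop.Homotopic (GenLoop.congr x e p) (GenLoop.congr x e q) := by
  obtain ⟨F⟩ := H
  refine ⟨⟨⟨⟨fun z => F (z.1, fun m => z.2 (e m)), ?_⟩, fun t => F.map_zero_left _, fun t =>
    F.map_one_left _⟩, fun s y hy => ?_⟩⟩
  · exact F.continuous.comp (by fun_prop)
  · obtain ⟨n, hn⟩ := hy
    exact F.prop' s (fun m => y (e m)) ⟨e.symm n, by simpa using hn⟩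

/-- Homotopy groups do not depend on the index type of the cube. -/
noncomputable def HomotopyGroup.mulEquivOfEquiv {M N X : Type*} [DecidableEq M] [DecidableEq N]
    [Nonempty M] [Nonempty N] [TopologicalSpace X] {x : X} (e : M ≃ N) :
    HomotopyGroup M X x ≃* HomotopyGroup N X x :=
  MulEquiv.ofBijective (HomotopyGroup.homOfGenLoop (GenLoop.congr x e) (GenLoop.congr_homotopic e)
    (Classical.arbitrary M) (e (Classical.arbitrary M)) fun p q => by
      ext t
      have h : ∀ (r : I) (i : M), (fun m => Function.update t (e i) r (e m)) =
          Function.update (fun m => t (e m)) i r := fun r i => by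
        funext m
        simp [Function.update_apply]
      change ite _ _ _ = ite _ _ _
      change _ = ite _ (p fun m => Function.update t _ _ (e m))
        (q fun m => Function.update t _ _ (e m))
      rw [h, h]
      rfl)
    ⟨by
      rintro ⟨p⟩ ⟨q⟩ h
      have h' := GenLoop.congr_homotopic e.symm _ _ (Quotient.exact h)
      refine Quotient.sound ?_
      have hs : ∀ r : Ω^ M X x, (GenLoop.congr x e.symm) (GenLoop.congr x e r) = r := fun r =>
        (GenLoop.congr x e).symm_apply_apply r
      rwa [hs, hs] at h', by
      rintro ⟨q⟩
      exact ⟨Quotient.mk _ ((GenLoop.congr x e).symm q),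
        congrArg (Quotient.mk _) ((GenLoop.congr x e).apply_symm_apply q)⟩⟩

theorem GenLoop.transAt_homotopic_comm {X : Type*} [TopologicalSpace X] {x : X}
    (Q : C(I × X, X)) (hQ0 : ∀ z, Q (0, z) = z) (hQ1 : ∀ z, Q (1, z) = z)
    (a b : Ω^ (Fin 1) X x) (ha : ∀ t, a t = Q (t 0, x)) :
    GenLoop.Homotopic (GenLoop.transAt 0 a b) (GenLoop.transAt 0 b a) := by
  let p : I → I := fun t => Set.projIcc 0 1 zero_le_one (2 * (t : ℝ))
  let p' : I → I := fun t => Set.projIcc 0 1 zero_le_one (2 * (t : ℝ) - 1)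
  let mix : I → I → I → I := fun s u v =>
    Set.projIcc 0 1 zero_le_one ((1 - (s : ℝ)) * u + s * v)
  have hp : Continuous p := continuous_projIcc.comp (by fun_prop)
  have hp' : Continuous p' := continuous_projIcc.comp (by fun_prop)
  have hmix : Continuous fun z : I × I × I => mix z.1 z.2.1 z.2.2 :=
    continuous_projIcc.comp (by fun_prop)
  have hmix0 : ∀ u v, mix 0 u v = u := fun u v => by simp [mix]
  have hmix1 : ∀ u v, mix 1 u v = v := fun u v => by simp [mix]
  have hmixs : ∀ s u, mix s u u = u := fun s u => by
    have : (1 - (s : ℝ)) * u + s * u = u := by ring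
    simp [mix, this]
  have b0 : b (fun _ => 0) = x := b.2 _ ⟨0, Or.inl rfl⟩
  have b1 : b (fun _ => 1) = x := b.2 _ ⟨0, Or.inr rfl⟩
  have hupd : ∀ (t : Fin 1 → I) r, Function.update t 0 r = fun _ => r := fun t r => by
    funext i
    rw [Subsingleton.elim i 0, Function.update_self]
  have hlow : ∀ t : I, (t : ℝ) ≤ 1 / 2 → p' t = 0 := fun t ht =>
    Set.projIcc_of_le_left _ (by linarith)
  have hhigh : ∀ t : I, ¬ (t : ℝ) ≤ 1 / 2 → p t = 1 := fun t ht =>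
    Set.projIcc_of_right_le _ (by linarith)
  have hab : ∀ t, GenLoop.transAt 0 a b t = Q (p (t 0), b fun _ => p' (t 0)) := fun t => by
    change ite _ _ _ = _
    rw [hupd, hupd]
    split_ifs with h
    · rw [ha, hlow _ h, b0]
    · rw [hhigh _ h, hQ1]
  have hba : ∀ t, GenLoop.transAt 0 b a t = Q (p' (t 0), b fun _ => p (t 0)) := fun t => by
    change ite _ _ _ = _
    rw [hupd, hupd]
    split_ifs with h
    · rw [hlow _ h, hQ0]
    · rw [ha, hhigh _ h, b1]
  refine ⟨⟨⟨⟨fun z => Q (mix z.1 (p (z.2 0)) (p' (z.2 0)),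
    b fun _ => mix z.1 (p' (z.2 0)) (p (z.2 0))), ?_⟩, fun t => ?_, fun t => ?_⟩, fun s y hy => ?_⟩⟩
  · have h1 : ∀ f g : I → I, Continuous f → Continuous g → Continuous fun z : I × (Fin 1 → I) =>
        mix z.1 (f (z.2 0)) (g (z.2 0)) := fun f g hf hg => hmix.comp
      (continuous_fst.prodMk ((hf.comp (by fun_prop)).prodMk (hg.comp (by fun_prop))))
    refine Q.continuous.comp ((h1 p p' hp hp').prodMk (b.1.continuous.comp ?_))
    exact continuous_pi fun _ => h1 p' p hp' hp
  · refine Eq.trans ?_ (hab t).symm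
    simp only [hmix0]
  · refine Eq.trans ?_ (hba t).symm
    simp only [hmix1]
  · have hy' : y 0 = 0 ∨ y 0 = 1 := by
      obtain ⟨i, hi⟩ := hy
      rwa [Subsingleton.elim i 0] at hi
    refine Eq.trans ?_ (hab y).symm
    have : p (y 0) = p' (y 0) := by
      rcases hy' with h | h
      · simp only [p, p', h]
        rw [Set.projIcc_of_le_left _ (by simp), Set.projIcc_of_le_left _ (by simp)]
      · simp only [p, p', h]
        rw [Set.projIcc_of_right_le _ (by simp), Set.projIcc_of_right_le _ (by norm_num)]
    change Q (mix s (p (y 0)) (p' (y 0)), b fun _ => mix s (p' (y 0)) (p (y 0))) = _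
    simp only [this, hmixs]

theorem exists_descend_sphere {m : ℕ} (hm : 1 ≤ m) {T Y : Type*} [TopologicalSpace T]
    [CompactSpace T] [T2Space T] [TopologicalSpace Y] (f : C(T × (Fin m → I), Y))
    (hf : ∀ t, ∀ u ∈ Cube.boundary (Fin m), ∀ u' ∈ Cube.boundary (Fin m), f (t, u) = f (t, u')) :
    ∃ G : C(T, C(Sph m, Y)), ∀ t u, G t (cubeToSphere m u) = f (t, u) := by
  let q : C(T × (Fin m → I), T × Sph m) :=
    ⟨fun z => (z.1, cubeToSphere m z.2),
      continuous_fst.prodMk (continuous_cubeToSphere.comp continuous_snd)⟩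
  have hq : IsQuotientMap q := by
    refine q.continuous.isClosedMap.isQuotientMap q.continuous ?_
    rintro ⟨t, x⟩
    obtain ⟨u, rfl⟩ := surjective_cubeToSphere hm x
    exact ⟨(t, u), rfl⟩
  have hfq : ∀ z z' : T × (Fin m → I), q z = q z' → f z = f z' := by
    rintro ⟨t, u⟩ ⟨t', u'⟩ h
    obtain rfl : t = t' := congrArg Prod.fst h
    rcases cubeToSphere_eq (congrArg Prod.snd h) with h | ⟨h, h'⟩
    · exact congrArg (fun v => f (t, v)) h
    · exact hf t u h u' h'
  refine ⟨(hq.lift f hfq).curry, fun t u => ?_⟩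
  exact DFunLike.congr_fun (hq.lift_comp f hfq) (t, u)

theorem continuous_sumElim_uncurry {A B X : Type*} [TopologicalSpace X] :
    Continuous fun z : (A → X) × (B → X) => Sum.elim z.1 z.2 :=
  continuous_pi fun i => by
    rcases i with a | b
    · exact (continuous_apply a).comp continuous_fst
    · exact (continuous_apply b).comp continuous_snd

theorem Cube.sumElim_left_mem_boundary {A B : Type*} {t : A → I} (ht : t ∈ Cube.boundary A)
    (u : B → I) : Sum.elim t u ∈ Cube.boundary (A ⊕ B) := by
  obtain ⟨i, hi⟩ := ht
  exact ⟨Sum.inl i, hi⟩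

theorem Cube.sumElim_right_mem_boundary {A B : Type*} (t : A → I) {u : B → I}
    (hu : u ∈ Cube.boundary B) : Sum.elim t u ∈ Cube.boundary (A ⊕ B) := by
  obtain ⟨i, hi⟩ := hu
  exact ⟨Sum.inr i, hi⟩

theorem GenLoop.apply_sumElim_left {A B Y : Type*} [TopologicalSpace Y] {y : Y}
    (b : Ω^ (A ⊕ B) Y y) {t : A → I} (ht : t ∈ Cube.boundary A) (u : B → I) :
    b (Sum.elim t u) = y :=
  b.2 _ (Cube.sumElim_left_mem_boundary ht _)

theorem GenLoop.apply_sumElim_right {A B Y : Type*} [TopologicalSpace Y] {y : Y}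
    (b : Ω^ (A ⊕ B) Y y) (t : A → I) {u : B → I} (hu : u ∈ Cube.boundary B) :
    b (Sum.elim t u) = y :=
  b.2 _ (Cube.sumElim_right_mem_boundary _ hu)

theorem exists_sphereLoop {m : ℕ} (hm : 1 ≤ m) {K Y : Type*} [TopologicalSpace Y] {y : Y}
    (b : Ω^ (K ⊕ Fin m) Y y) : ∃ g : Ω^ K C(Sph m, Y) (ContinuousMap.const _ y),
      ∀ t u, g t (cubeToSphere m u) = b (Sum.elim t u) := by
  obtain ⟨G, hG⟩ := exists_descend_sphere hm (T := K → I)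
    ⟨fun z => b (Sum.elim z.1 z.2), b.1.continuous.comp continuous_sumElim_uncurry⟩
    (fun t u hu u' hu' => (GenLoop.apply_sumElim_right b t hu).trans (GenLoop.apply_sumElim_right b t hu').symm)
  refine ⟨⟨G, fun t ht => ?_⟩, hG⟩
  ext x
  obtain ⟨u, rfl⟩ := surjective_cubeToSphere hm x
  exact (hG t u).trans (GenLoop.apply_sumElim_left b ht u)

/-- The loop in a space of maps out of a sphere obtained by collapsing the boundary of a cube. -/
noncomputable def sphereLoop {m : ℕ} (hm : 1 ≤ m) {K Y : Type*} [TopologicalSpace Y] {y : Y}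
    (b : Ω^ (K ⊕ Fin m) Y y) : Ω^ K C(Sph m, Y) (ContinuousMap.const _ y) :=
  (exists_sphereLoop hm b).choose

theorem sphereLoop_apply {m : ℕ} (hm : 1 ≤ m) {K Y : Type*} [TopologicalSpace Y] {y : Y}
    (b : Ω^ (K ⊕ Fin m) Y y) (t : K → I) (u : Fin m → I) :
    sphereLoop hm b t (cubeToSphere m u) = b (Sum.elim t u) :=
  (exists_sphereLoop hm b).choose_spec t u

theorem sphereLoop_northPole {m : ℕ} (hm : 1 ≤ m) {K Y : Type*} [TopologicalSpace Y] {y : Y}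
    (b : Ω^ (K ⊕ Fin m) Y y) (t : K → I) : sphereLoop hm b t (northPole m) = y := by
  have hu : (fun _ => 0 : Fin m → I) ∈ Cube.boundary (Fin m) := ⟨⟨0, hm⟩, Or.inl rfl⟩
  rw [← cubeToSphere_boundary hu, sphereLoop_apply]
  exact GenLoop.apply_sumElim_right b t hu

theorem sphereLoop_homotopic {m : ℕ} (hm : 1 ≤ m) {K Y : Type*} [TopologicalSpace Y] {y : Y}
    (b b' : Ω^ (K ⊕ Fin m) Y y) (h : GenLoop.Homotopic b b') :
    GenLoop.Homotopic (sphereLoop hm b) (sphereLoop hm b') := by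
  obtain ⟨F⟩ := h
  have hF : ∀ s w, w ∈ Cube.boundary (K ⊕ Fin m) → F (s, w) = y := fun s w hw =>
    (F.prop' s w hw).trans (b.2 w hw)
  obtain ⟨G, hG⟩ := exists_descend_sphere hm (T := I × (K → I))
    ⟨fun z => F (z.1.1, Sum.elim z.1.2 z.2), F.continuous.comp
      ((continuous_fst.comp continuous_fst).prodMk
        (continuous_sumElim_uncurry.comp ((continuous_snd.comp continuous_fst).prodMk continuous_snd)))⟩
    (fun t u hu u' hu' => (hF t.1 _ (Cube.sumElim_right_mem_boundary _ hu)).trans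
      (hF t.1 _ (Cube.sumElim_right_mem_boundary _ hu')).symm)
  have hext : ∀ g g' : C(Sph m, Y), (∀ u, g (cubeToSphere m u) = g' (cubeToSphere m u)) →
      g = g' := fun g g' hgg => by
    ext x
    obtain ⟨u, rfl⟩ := surjective_cubeToSphere hm x
    exact hgg u
  refine ⟨⟨⟨G, fun t => hext _ _ fun u => ?_, fun t => hext _ _ fun u => ?_⟩,
    fun s t ht => hext _ _ fun u => ?_⟩⟩
  · exact ((hG (0, t) u).trans (F.map_zero_left _)).trans (sphereLoop_apply hm b t u).symm
  · exact ((hG (1, t) u).trans (F.map_one_left _)).trans (sphereLoop_apply hm b' t u).symm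
  · refine ((hG (s, t) u).trans (hF s _ (Cube.sumElim_left_mem_boundary ht _))).trans ?_
    exact ((sphereLoop_apply hm b t u).trans (GenLoop.apply_sumElim_left b ht u)).symm

theorem sphereLoop_transAt {m : ℕ} (hm : 1 ≤ m) {K Y : Type*} [DecidableEq K]
    [TopologicalSpace Y] {y : Y} (i : K) (b b' : Ω^ (K ⊕ Fin m) Y y) :
    sphereLoop hm (GenLoop.transAt (Sum.inl i) b b') =
      GenLoop.transAt i (sphereLoop hm b) (sphereLoop hm b') := by
  ext t x
  obtain ⟨u, rfl⟩ := surjective_cubeToSphere hm x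
  rw [sphereLoop_apply]
  have h : ∀ r : I, Function.update (Sum.elim t u) (Sum.inl i) r =
      Sum.elim (Function.update t i r) u := fun r => Sum.update_elim_inl
  change ite _ _ _ = (ite _ _ _ : C(Sph m, Y)) _
  rw [h, h, ← sphereLoop_apply hm, ← sphereLoop_apply hm]
  change ite ((t i : ℝ) ≤ 1 / 2) _ _ = _
  split_ifs <;> rfl

instance compactSpace_sph (m : ℕ) : CompactSpace (Sph m) :=
  isCompact_iff_compactSpace.1 (isCompact_sphere _ _)

/-- Projection of the real line onto the unit interval. -/
noncomputable def clampI (a : ℝ) : I := Set.projIcc 0 1 zero_le_one a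

@[fun_prop]
theorem continuous_clampI : Continuous clampI := continuous_projIcc (h := zero_le_one)

theorem clampI_of_nonpos {a : ℝ} (h : a ≤ 0) : clampI a = 0 := Set.projIcc_of_le_left _ h

theorem clampI_of_one_le {a : ℝ} (h : 1 ≤ a) : clampI a = 1 := Set.projIcc_of_right_le _ h

theorem clampI_coe (a : I) : clampI a = a := Set.projIcc_val _ a

/-- A bump function on the cube, vanishing on the boundary and equal to one on a smaller cube. -/
noncomputable def cubeBump {m : ℕ} (u : Fin m → I) : I :=
  ∏ j, clampI (4 * (u j : ℝ)) * clampI (4 - 4 * (u j : ℝ))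

theorem continuous_cubeBump {m : ℕ} : Continuous (cubeBump (m := m)) :=
  continuous_finsetProd _ fun j _ => by fun_prop

theorem cubeBump_boundary {m : ℕ} {u : Fin m → I} (hu : u ∈ Cube.boundary (Fin m)) :
    cubeBump u = 0 := by
  obtain ⟨j, hj⟩ := hu
  refine Finset.prod_eq_zero (Finset.mem_univ j) ?_
  rcases hj with h | h
  · rw [h, clampI_of_nonpos (by simp), zero_mul]
  · rw [h, clampI_of_nonpos (a := 4 - _) (by simp), mul_zero]

/-- The map stretching the middle of the cube over the whole cube. -/
noncomputable def cubeStretch {m : ℕ} (s : ℝ) (u : Fin m → I) : Fin m → I :=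
  fun j => clampI ((1 + s) * (u j : ℝ) - s / 2)

theorem continuous_cubeStretch {m : ℕ} :
    Continuous fun z : ℝ × (Fin m → I) => cubeStretch z.1 z.2 :=
  continuous_pi fun j => by unfold cubeStretch; fun_prop

theorem cubeStretch_zero {m : ℕ} (u : Fin m → I) : cubeStretch 0 u = u := by
  funext j
  simp [cubeStretch, clampI_coe]

theorem cubeStretch_boundary {m : ℕ} {s : ℝ} (hs : 0 ≤ s) {u : Fin m → I}
    (hu : u ∈ Cube.boundary (Fin m)) : cubeStretch s u ∈ Cube.boundary (Fin m) := by
  obtain ⟨j, hj⟩ := hu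
  refine ⟨j, hj.imp (fun h => ?_) fun h => ?_⟩
  · exact clampI_of_nonpos (by rw [h]; simpa using by linarith)
  · exact clampI_of_one_le (by rw [h]; simpa using by linarith)

theorem cubeBump_eq_one_or {m : ℕ} (u : Fin m → I) :
    cubeBump u = 1 ∨ cubeStretch 1 u ∈ Cube.boundary (Fin m) := by
  by_cases h : ∀ j, 1 / 4 < (u j : ℝ) ∧ (u j : ℝ) < 3 / 4
  · left
    refine Finset.prod_eq_one fun j _ => ?_
    obtain ⟨h1, h2⟩ := h j
    rw [clampI_of_one_le (by linarith), clampI_of_one_le (by linarith), one_mul]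
  · right
    push Not at h
    obtain ⟨j, hj⟩ := h
    by_cases h1 : 1 / 4 < (u j : ℝ)
    · exact ⟨j, Or.inr (clampI_of_one_le (by linarith [hj h1]))⟩
    · exact ⟨j, Or.inl (clampI_of_nonpos (by linarith))⟩

/-- Reparametrization of a generalized loop on a cube of the form `I^K × I^m`. -/
theorem GenLoop.homotopic_of_stretch {m : ℕ} {K Y : Type*} [DecidableEq K] [TopologicalSpace Y]
    {y : Y} (i : K) (b b' : Ω^ (K ⊕ Fin m) Y y)
    (h : ∀ t u, b' (Sum.elim t u) =
      b (Sum.elim (Function.update t i (clampI (2 * (t i : ℝ)))) (cubeStretch 1 u))) :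
    GenLoop.Homotopic b b' := by
  have hsplit : ∀ w : K ⊕ Fin m → I, Sum.elim (w ∘ Sum.inl) (w ∘ Sum.inr) = w :=
    fun w => Sum.elim_comp_inl_inr w
  let r : I × (K ⊕ Fin m → I) → (K ⊕ Fin m → I) := fun z =>
    Sum.elim (Function.update (z.2 ∘ Sum.inl) i (clampI ((1 + (z.1 : ℝ)) * z.2 (Sum.inl i))))
      (cubeStretch (z.1 : ℝ) (z.2 ∘ Sum.inr))
  have hr : Continuous r := by
    refine continuous_sumElim_uncurry.comp (Continuous.prodMk ?_ ?_)
    · refine Continuous.update (continuous_pi fun j => ?_) i ?_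
      · exact (continuous_apply _).comp continuous_snd
      · fun_prop
    · have h2 : Continuous fun z : I × (K ⊕ Fin m → I) => z.2 ∘ Sum.inr :=
        continuous_pi fun j => (continuous_apply _).comp continuous_snd
      exact continuous_cubeStretch.comp ((continuous_subtype_val.comp continuous_fst).prodMk h2)
  have hrb : ∀ s w, w ∈ Cube.boundary (K ⊕ Fin m) → r (s, w) ∈ Cube.boundary (K ⊕ Fin m) := by
    rintro s w ⟨j | j, hj⟩
    · refine Cube.sumElim_left_mem_boundary ⟨j, ?_⟩ _
      by_cases hji : j = i
      · subst hji
        rw [Function.update_self]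
        refine hj.imp (fun h => ?_) fun h => ?_
        · exact clampI_of_nonpos (by simp [h])
        · exact clampI_of_one_le (by simpa [h] using s.2.1)
      · rw [Function.update_of_ne hji]
        exact hj
    · exact Cube.sumElim_right_mem_boundary _ (cubeStretch_boundary s.2.1 ⟨j, hj⟩)
  refine ⟨⟨⟨⟨fun z => b (r z), b.1.continuous.comp hr⟩, fun w => ?_, fun w => ?_⟩,
    fun s w hw => ?_⟩⟩
  · refine congrArg b ?_
    simp only [r, Set.Icc.coe_zero, add_zero, one_mul, clampI_coe, cubeStretch_zero]
    conv_rhs => rw [← hsplit w]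
    congr 1
    exact Function.update_eq_self i (w ∘ Sum.inl)
  · conv_rhs => rw [← hsplit w]
    refine Eq.trans ?_ (h _ _).symm
    change b (r (1, w)) = _
    simp only [r, Set.Icc.coe_one, one_add_one_eq_two]
    rfl
  · exact (b.2 _ (hrb s w hw)).trans (b.2 w hw).symm

theorem sphereLoop_injective {m : ℕ} (hm : 1 ≤ m) {K Y : Type*} [DecidableEq K]
    [TopologicalSpace Y] {y : Y} (i : K) (b : Ω^ (K ⊕ Fin m) Y y)
    (h : GenLoop.Homotopic (sphereLoop hm b) GenLoop.const) :
    GenLoop.Homotopic b GenLoop.const := by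
  obtain ⟨H⟩ := h
  have H0 : ∀ t, H (0, t) = sphereLoop hm b t := H.map_zero_left
  have H1 : ∀ t, H (1, t) = ContinuousMap.const _ y := H.map_one_left
  have Hb : ∀ s t, t ∈ Cube.boundary K → H (s, t) = ContinuousMap.const _ y := fun s t ht =>
    (H.prop' s t ht).trans ((sphereLoop hm b).2 t ht)
  let T : (K ⊕ Fin m → I) → I := fun w =>
    (clampI (2 * (w (Sum.inl i) : ℝ)) * clampI (2 - 2 * (w (Sum.inl i) : ℝ))) *
      cubeBump (w ∘ Sum.inr)
  let A : I × (K ⊕ Fin m → I) → C(Sph m, Y) := fun z =>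
    H (z.1, Function.update (z.2 ∘ Sum.inl) i (T z.2))
  have hsnd : ∀ j, Continuous fun z : I × (K ⊕ Fin m → I) => z.2 j := fun j =>
    (continuous_apply j).comp continuous_snd
  have hT : Continuous T := by
    refine Continuous.mul (by fun_prop) (continuous_cubeBump.comp ?_)
    exact continuous_pi fun j => continuous_apply _
  have hA : Continuous A := H.continuous.comp (continuous_fst.prodMk
    (Continuous.update (continuous_pi fun j => hsnd _) i (hT.comp continuous_snd)))
  have hAev : ∀ p : I × (K ⊕ Fin m → I) → Sph m, Continuous p → Continuous fun z => A z (p z) :=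
    fun p hp => hA.eval hp
  have hAb : ∀ s w, w ∈ Cube.boundary (K ⊕ Fin m) → A (s, w) = ContinuousMap.const _ y := by
    rintro s w ⟨j | j, hj⟩
    · refine Hb _ _ ⟨j, ?_⟩
      by_cases hji : j = i
      · subst hji
        rw [Function.update_self]
        left
        change T w = 0
        rcases hj with h | h
        · simp [T, h, clampI_of_nonpos]
        · simp [T, h, clampI_of_nonpos]
      · rw [Function.update_of_ne hji]
        exact hj
    · refine Hb _ _ ⟨i, Or.inl ?_⟩
      rw [Function.update_self]
      change T w = 0
      simp only [T]
      rw [cubeBump_boundary (u := w ∘ Sum.inr) ⟨j, hj⟩, mul_zero]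
  let D : I × (K ⊕ Fin m → I) → Y := fun z => if (z.2 (Sum.inl i) : ℝ) ≤ 1 / 2 then
    A z (cubeToSphere m (cubeStretch 1 (z.2 ∘ Sum.inr))) else A z (northPole m)
  have hD : Continuous D := by
    refine Continuous.if_le (hAev _ ?_) (hAev _ continuous_const)
      (continuous_subtype_val.comp (hsnd _)) continuous_const fun z hz => ?_
    · exact continuous_cubeToSphere.comp (continuous_cubeStretch.comp
        (continuous_const.prodMk (continuous_pi fun j => hsnd _)))
    · rcases cubeBump_eq_one_or (z.2 ∘ Sum.inr) with h | h
      · have : A z = ContinuousMap.const _ y := by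
          refine Hb _ _ ⟨i, Or.inr ?_⟩
          rw [Function.update_self]
          simp only [T]
          rw [h, hz, clampI_of_one_le (by norm_num), clampI_of_one_le (by norm_num), one_mul,
            one_mul]
        rw [this]
        rfl
      · rw [cubeToSphere_boundary h]
  have hDA : ∀ s w, A (s, w) = ContinuousMap.const _ y → D (s, w) = y := fun s w h => by
    simp only [D]
    rw [h]
    split_ifs <;> rfl
  let b' : Ω^ (K ⊕ Fin m) Y y := ⟨⟨fun w => D (0, w), hD.comp (by fun_prop)⟩,
    fun w hw => hDA _ _ (hAb _ _ hw)⟩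
  have h1 : GenLoop.Homotopic b b' := by
    refine GenLoop.homotopic_of_stretch i b b' fun t u => ?_
    change (if (t i : ℝ) ≤ 1 / 2 then
      H (0, Function.update t i (T (Sum.elim t u))) (cubeToSphere m (cubeStretch 1 u)) else
      H (0, Function.update t i (T (Sum.elim t u))) (northPole m)) = _
    rw [H0]
    split_ifs with hti
    · rw [sphereLoop_apply]
      rcases cubeBump_eq_one_or u with h | h
      · have : T (Sum.elim t u) = clampI (2 * (t i : ℝ)) := by
          change clampI (2 * (t i : ℝ)) * clampI (2 - 2 * (t i : ℝ)) * cubeBump u = _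
          rw [h, clampI_of_one_le (a := 2 - _) (by linarith), mul_one, mul_one]
        rw [this]
      · rw [GenLoop.apply_sumElim_right b _ h, GenLoop.apply_sumElim_right b _ h]
    · rw [sphereLoop_northPole, GenLoop.apply_sumElim_left]
      exact ⟨i, Or.inr (by rw [Function.update_self, clampI_of_one_le (by linarith)])⟩
  refine h1.trans ⟨⟨⟨⟨D, hD⟩, fun w => rfl, fun w => hDA _ _ (H1 _)⟩, fun s w hw => ?_⟩⟩
  exact (hDA _ _ (hAb _ _ hw)).trans (b'.2 w hw).symm

theorem exists_sphereLoop_homotopic {m : ℕ} (hm : 1 ≤ m) {K Y : Type*}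
    [TopologicalSpace Y] {y : Y} (g : Ω^ K C(Sph m, Y) (ContinuousMap.const _ y))
    (g' : Ω^ K Y y) (hg' : ∀ t, g' t = g t (northPole m))
    (h : GenLoop.Homotopic g' GenLoop.const) :
    ∃ b : Ω^ (K ⊕ Fin m) Y y, GenLoop.Homotopic g (sphereLoop hm b) := by
  obtain ⟨H⟩ := h
  have H0 : ∀ t, H (0, t) = g t (northPole m) := fun t => (H.map_zero_left t).trans (hg' t)
  have H1 : ∀ t, H (1, t) = y := H.map_one_left
  have Hb : ∀ s t, t ∈ Cube.boundary K → H (s, t) = y := fun s t ht =>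
    (H.prop' s t ht).trans (g'.2 t ht)
  have gb : ∀ t ∈ Cube.boundary K, ∀ x, g t x = y := fun t ht x =>
    DFunLike.congr_fun (g.2 t ht) x
  let ν : (Fin m → I) → ℝ := fun u => ‖fun j => 2 * (u j : ℝ) - 1‖
  have hν : Continuous ν := continuous_norm.comp (by fun_prop)
  have hν1 : ∀ u, ν u ≤ 1 := fun u => by
    refine (pi_norm_le_iff_of_nonneg zero_le_one).2 fun j => ?_
    rw [Real.norm_eq_abs, abs_le]
    constructor <;> linarith [(u j).2.1, (u j).2.2]
  have hνb : ∀ u ∈ Cube.boundary (Fin m), ν u = 1 := by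
    rintro u ⟨j, hj⟩
    refine le_antisymm (hν1 u) (le_trans ?_ (norm_le_pi_norm _ j))
    rcases hj with h | h <;> rw [h] <;> norm_num
  have hνq : ∀ s : ℝ, ∀ u, (1 + s) * ν u = 1 → 0 ≤ s →
      cubeStretch s u ∈ Cube.boundary (Fin m) := by
    intro s u hsu hs
    have : Nonempty (Fin m) := ⟨⟨0, hm⟩⟩
    obtain ⟨j, hj⟩ : ∃ j, ‖2 * (u j : ℝ) - 1‖ = ν u := by
      obtain ⟨j, -, hj⟩ := Finset.exists_mem_eq_sup Finset.univ Finset.univ_nonempty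
        (fun j => ‖2 * (u j : ℝ) - 1‖₊)
      exact ⟨j, (congrArg NNReal.toReal hj).symm⟩
    rw [← hj, Real.norm_eq_abs] at hsu
    rcases abs_cases (2 * (u j : ℝ) - 1) with ⟨h, -⟩ | ⟨h, -⟩
    · rw [h] at hsu
      exact ⟨j, Or.inr (clampI_of_one_le (by linarith))⟩
    · rw [h] at hsu
      exact ⟨j, Or.inl (clampI_of_nonpos (by linarith))⟩
  let E : (I × (K → I)) × (Fin m → I) → Y := fun z =>
    if (1 + (z.1.1 : ℝ)) * ν z.2 ≤ 1 then
      g z.1.2 (cubeToSphere m (cubeStretch (z.1.1 : ℝ) z.2))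
    else H (clampI ((1 + (z.1.1 : ℝ)) * ν z.2 - 1), z.1.2)
  have hE : Continuous E := by
    refine Continuous.if_le ?_ ?_ ?_ continuous_const fun z hz => ?_
    · refine (g.1.continuous.comp (by fun_prop)).eval (continuous_cubeToSphere.comp
        (continuous_cubeStretch.comp (Continuous.prodMk (by fun_prop) continuous_snd)))
    · exact H.continuous.comp (by fun_prop)
    · fun_prop
    · rw [cubeToSphere_boundary (hνq _ _ hz z.1.1.2.1), hz, clampI_of_nonpos (by simp), H0]
  have hE0 : ∀ t u, E ((0, t), u) = g t (cubeToSphere m u) := fun t u => by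
    change ite ((1 + ((0 : I) : ℝ)) * ν u ≤ 1) (g t (cubeToSphere m (cubeStretch ((0 : I) : ℝ) u)))
      _ = _
    rw [if_pos (by simpa using hν1 u), Set.Icc.coe_zero, cubeStretch_zero]
  have hEu : ∀ s t, ∀ u ∈ Cube.boundary (Fin m), E ((s, t), u) = H (s, t) := fun s t u hu => by
    change ite ((1 + (s : ℝ)) * ν u ≤ 1) (g t (cubeToSphere m (cubeStretch (s : ℝ) u)))
      (H (clampI ((1 + (s : ℝ)) * ν u - 1), t)) = _
    rw [hνb u hu, mul_one, add_sub_cancel_left, clampI_coe]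
    split_ifs with hs
    · have : s = 0 := Subtype.ext (le_antisymm (by simpa using hs) s.2.1)
      rw [cubeToSphere_boundary (cubeStretch_boundary s.2.1 hu), this, H0]
    · rfl
  have hEt : ∀ s, ∀ t ∈ Cube.boundary K, ∀ u, E ((s, t), u) = y := fun s t ht u => by
    simp only [E]
    split_ifs
    · exact gb t ht _
    · exact Hb _ t ht
  obtain ⟨G, hG⟩ := exists_descend_sphere hm ⟨E, hE⟩
    (fun t u hu u' hu' => (hEu t.1 t.2 u hu).trans (hEu t.1 t.2 u' hu').symm)
  have hext : ∀ g g' : C(Sph m, Y), (∀ u, g (cubeToSphere m u) = g' (cubeToSphere m u)) →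
      g = g' := fun g g' hgg => by
    ext x
    obtain ⟨u, rfl⟩ := surjective_cubeToSphere hm x
    exact hgg u
  let b : Ω^ (K ⊕ Fin m) Y y := ⟨⟨fun w => E ((1, w ∘ Sum.inl), w ∘ Sum.inr),
    hE.comp ((continuous_const.prodMk (continuous_pi fun j => continuous_apply _)).prodMk
      (continuous_pi fun j => continuous_apply _))⟩, by
    rintro w ⟨j | j, hj⟩
    · exact hEt _ _ ⟨j, hj⟩ _
    · exact (hEu _ _ _ ⟨j, hj⟩).trans (H1 _)⟩
  refine ⟨b, ⟨⟨⟨G, fun t => hext _ _ fun u => ?_, fun t => hext _ _ fun u => ?_⟩,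
    fun s t ht => hext _ _ fun u => ?_⟩⟩⟩
  · exact (hG (0, t) u).trans (hE0 t u)
  · exact (hG (1, t) u).trans (sphereLoop_apply hm b t u).symm
  · exact ((hG (s, t) u).trans (hEt s t ht u)).trans (gb t ht _).symm

theorem HomotopyGroup.mul_comm_of_nontrivial {N X : Type*} [DecidableEq N] [Nontrivial N]
    [TopologicalSpace X] {x : X} (a b : HomotopyGroup N X x) : a * b = b * a :=
  (HomotopyGroup.commGroup (N := N) (X := X) (x := x)).mul_comm a b

/-- Every loop is the trace of a point under a loop of self-maps based at the identity. -/
def IsGottlieb {Y : Type*} [TopologicalSpace Y] (y : Y) : Prop :=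
  ∀ a : Ω^ (Fin 1) Y y, ∃ Q : C(I × Y, Y), (∀ z, Q (0, z) = z) ∧ (∀ z, Q (1, z) = z) ∧
    ∀ t, a t = Q (t 0, y)

/-- The homotopy groups of the space of maps from a sphere to `Y`, based at a constant map. -/
theorem nonempty_mulEquiv_of_isGottlieb {m : ℕ} (hm : 1 ≤ m) (k : ℕ) {Y : Type*}
    [TopologicalSpace Y] {y : Y} (hY : IsGottlieb y) :
    Nonempty (HomotopyGroup (Fin (k + 1)) C(Sph m, Y) (ContinuousMap.const _ y) ≃*
      HomotopyGroup (Fin (k + 1)) Y y × HomotopyGroup (Fin (k + 1) ⊕ Fin m) Y y) := by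
  let cst : C(Y, C(Sph m, Y)) := ContinuousMap.const'
  let ev : C(C(Sph m, Y), Y) := ⟨fun g => g (northPole m), continuous_eval_const _⟩
  let c : HomotopyGroup (Fin (k + 1)) Y y →*
      HomotopyGroup (Fin (k + 1)) C(Sph m, Y) (ContinuousMap.const _ y) :=
    HomotopyGroup.map cst rfl
  let e : HomotopyGroup (Fin (k + 1)) C(Sph m, Y) (ContinuousMap.const _ y) →*
      HomotopyGroup (Fin (k + 1)) Y y := HomotopyGroup.map ev rfl
  let i : HomotopyGroup (Fin (k + 1) ⊕ Fin m) Y y →*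
      HomotopyGroup (Fin (k + 1)) C(Sph m, Y) (ContinuousMap.const _ y) :=
    HomotopyGroup.homOfGenLoop (sphereLoop hm) (sphereLoop_homotopic hm) (Sum.inl 0) 0
      (sphereLoop_transAt hm 0)
  refine exists_mulEquiv_prod_of_split c i e ?_ ?_ ?_ ?_ ?_
  · rintro ⟨a⟩
    rfl
  · rintro ⟨b⟩
    exact congrArg (Quotient.mk _) (GenLoop.ext _ _ fun t => sphereLoop_northPole hm b t)
  · rintro ⟨b⟩ hb
    exact Quotient.sound (sphereLoop_injective hm 0 b (Quotient.exact hb))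
  · rintro ⟨g⟩ hg
    obtain ⟨b, hb⟩ := exists_sphereLoop_homotopic hm g
      (GenLoop.postcomp ev rfl g) (fun t => rfl) (Quotient.exact hg)
    exact ⟨Quotient.mk _ b, Quotient.sound hb.symm⟩
  · rintro ⟨a⟩ ⟨b⟩
    rcases k with _ | k
    · obtain ⟨Q, hQ0, hQ1, hQa⟩ := hY a
      let R : C(I × C(Sph m, Y), C(Sph m, Y)) :=
        ContinuousMap.curry ⟨fun z => Q (z.1.1, z.1.2 z.2), Q.continuous.comp (by fun_prop)⟩
      have h := GenLoop.transAt_homotopic_comm (x := ContinuousMap.const _ y) R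
        (fun g => ContinuousMap.ext fun x => hQ0 _) (fun g => ContinuousMap.ext fun x => hQ1 _)
        (GenLoop.postcomp cst rfl a) (sphereLoop hm b)
        (fun t => ContinuousMap.ext fun x => hQa t)
      have h1 := HomotopyGroup.mul_spec (i := (0 : Fin 1)) (p := GenLoop.postcomp cst rfl a)
        (q := sphereLoop hm b)
      have h2 := HomotopyGroup.mul_spec (i := (0 : Fin 1)) (p := sphereLoop hm b)
        (q := GenLoop.postcomp cst rfl a)
      exact (h1.trans (Quotient.sound h.symm)).trans h2.symm
    · exact HomotopyGroup.mul_comm_of_nontrivial _ _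

theorem conj_mem_gamma {N : ℕ} {R y : Matrix (Fin N ⊕ Fin N) (Fin N ⊕ Fin N) ℝ}
    (hR : R.transpose * R = 1) (hy : y ∈ Gamma N) : R * y * R.transpose ∈ Gamma N := by
  obtain ⟨h1, h2⟩ := hy
  have hR' : R * R.transpose = 1 := mul_eq_one_comm.1 hR
  constructor
  · calc (R * y * R.transpose).transpose * (R * y * R.transpose)
        = R * (y.transpose * ((R.transpose * R) * y)) * R.transpose := by
          simp only [Matrix.transpose_mul, Matrix.transpose_transpose, Matrix.mul_assoc]
      _ = 1 := by rw [hR, one_mul, h1, mul_one, hR']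
  · calc (R * y * R.transpose) * (R * y * R.transpose)
        = R * (y * ((R.transpose * R) * y)) * R.transpose := by simp only [Matrix.mul_assoc]
      _ = -1 := by rw [hR, one_mul, h2, mul_neg, neg_mul, mul_one, hR']

theorem conj_mem_gammaPlus {N : ℕ} {R : Matrix (Fin N ⊕ Fin N) (Fin N ⊕ Fin N) ℝ}
    (hR : R.transpose * R = 1) {z y : Gamma N} (hz : z ∈ GammaPlus N)
    (hRz : (⟨R * z.1 * R.transpose, conj_mem_gamma hR z.2⟩ : Gamma N) ∈ GammaPlus N)
    (hy : y ∈ GammaPlus N) :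
    (⟨R * y.1 * R.transpose, conj_mem_gamma hR y.2⟩ : Gamma N) ∈ GammaPlus N := by
  have hc : Continuous fun w : Gamma N =>
      (⟨R * w.1 * R.transpose, conj_mem_gamma hR w.2⟩ : Gamma N) := by fun_prop
  obtain ⟨γ⟩ : Joined z y := (show Joined _ z from hz).symm.trans hy
  exact (show Joined _ _ from hRz).trans ⟨γ.map hc⟩

theorem isGottlieb_J0plus {N : ℕ} (hN : 2 ≤ N) : IsGottlieb (J0plus N) := by
  intro a
  have ha : ∀ u ∈ Cube.boundary (Fin 1), a u = J0plus N := a.2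
  obtain ⟨G, hG⟩ := exists_descend_sphere le_rfl (T := Unit) (a.1.comp ⟨Prod.snd, continuous_snd⟩)
    (fun t u hu u' hu' => (ha u hu).trans (ha u' hu').symm)
  replace hG : ∀ u, G () (cubeToSphere 1 u) = a u := hG ()
  obtain ⟨F, hF, hFo, hFJ⟩ := exists_orthogonal_lift (m := 1) (N := N) odd_one (by omega)
    (J := fun x => (G () x).1.1) (by fun_prop) (fun x => (G () x).1.2)
  have hFo' : ∀ x, F x * (F x).transpose = 1 := fun x => mul_eq_one_comm.1 (hFo x)
  have hb : ∀ r : I, r = 0 ∨ r = 1 → cubeToSphere 1 (fun _ => r) = northPole 1 := fun r hr =>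
    cubeToSphere_boundary ⟨0, hr⟩
  have hG0 : (G () (northPole 1)).1.1 = J0 N := by
    rw [← hb 0 (Or.inl rfl), hG, ha _ ⟨0, Or.inl rfl⟩]
    rfl
  let α : I → Matrix (Fin N ⊕ Fin N) (Fin N ⊕ Fin N) ℝ := fun r =>
    F (cubeToSphere 1 fun _ => r) * (F (northPole 1)).transpose
  have hα : Continuous α := by
    have : Continuous fun r : I => F (cubeToSphere 1 fun _ => r) :=
      hF.comp (continuous_cubeToSphere.comp (by fun_prop))
    exact this.matrix_mul continuous_const
  have hαo : ∀ r, (α r).transpose * α r = 1 := fun r => by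
    simp only [α, Matrix.transpose_mul, Matrix.transpose_transpose]
    rw [Matrix.mul_assoc, ← Matrix.mul_assoc _ (F _), hFo, Matrix.one_mul, hFo']
  have hαb : ∀ r : I, r = 0 ∨ r = 1 → α r = 1 := fun r hr => by
    simp only [α]
    rw [hb r hr, hFo']
  have hαJ : ∀ r, α r * J0 N * (α r).transpose = (a fun _ => r).1.1 := fun r => by
    have h0 : J0 N * F (northPole 1) = F (northPole 1) * J0 N := by
      rw [← hFJ, hG0]
    have h1 : (F (northPole 1)).transpose * (J0 N * F (northPole 1)) = J0 N := by
      rw [h0, ← Matrix.mul_assoc, hFo, Matrix.one_mul]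
    calc α r * J0 N * (α r).transpose
        = F (cubeToSphere 1 fun _ => r) *
          ((F (northPole 1)).transpose * (J0 N * F (northPole 1))) *
            (F (cubeToSphere 1 fun _ => r)).transpose := by
          simp only [α, Matrix.transpose_mul, Matrix.transpose_transpose, Matrix.mul_assoc]
      _ = (a fun _ => r).1.1 := by
          rw [h1, ← hFJ, Matrix.mul_assoc, hFo', Matrix.mul_one, hG]
  have hmem : ∀ r (y : GammaPlus N),
      (⟨α r * y.1.1 * (α r).transpose, conj_mem_gamma (hαo r) y.1.2⟩ : Gamma N) ∈ GammaPlus N :=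
    fun r y => conj_mem_gammaPlus (hαo r) (J0plus N).2
      (by
        convert (a fun _ => r).2
        exact hαJ r) y.2
  refine ⟨⟨fun z => ⟨⟨_, conj_mem_gamma (hαo z.1) z.2.1.2⟩, hmem z.1 z.2⟩, ?_⟩, fun z => ?_,
    fun z => ?_, fun t => ?_⟩
  · refine Continuous.subtype_mk (Continuous.subtype_mk ?_ _) _
    fun_prop
  · refine Subtype.ext (Subtype.ext ?_)
    change α 0 * z.1.1 * (α 0).transpose = _
    rw [hαb 0 (Or.inl rfl), Matrix.one_mul, Matrix.transpose_one, Matrix.mul_one]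
  · refine Subtype.ext (Subtype.ext ?_)
    change α 1 * z.1.1 * (α 1).transpose = _
    rw [hαb 1 (Or.inr rfl), Matrix.one_mul, Matrix.transpose_one, Matrix.mul_one]
  · refine Subtype.ext (Subtype.ext ?_)
    have ht : t = fun _ => t 0 := funext fun i => by rw [Subsingleton.elim i 0]
    conv_lhs => rw [ht]
    exact (hαJ (t 0)).symm

/-- The map of a function space induced by a family of self-maps of the target. -/
def ContinuousMap.fiberwise {S Y : Type*} [TopologicalSpace S] [LocallyCompactSpace S]
    [TopologicalSpace Y] (Φ : C(S × Y, Y)) : C(C(S, Y), C(S, Y)) :=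
  ContinuousMap.curry ⟨fun z => Φ (z.2, z.1 z.2), Φ.continuous.comp (by fun_prop)⟩

theorem exists_homeomorph_gammaPlus {m N : ℕ} (hm : Odd m) (hmN : m + 2 < 2 * (N + 1))
    (f : C(Sph m, GammaPlus N)) : ∃ h : C(Sph m, GammaPlus N) ≃ₜ C(Sph m, GammaPlus N),
      h (ContinuousMap.const _ (J0plus N)) = f := by
  obtain ⟨F, hF, hFo, hFJ⟩ := exists_orthogonal_lift hm hmN
    (J := fun x => (f x).1.1) (by fun_prop) (fun x => (f x).1.2)
  have hFo' : ∀ x, F x * (F x).transpose = 1 := fun x => mul_eq_one_comm.1 (hFo x)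
  have hFt : ∀ x, (F x).transpose.transpose * (F x).transpose = 1 := fun x => by
    rw [Matrix.transpose_transpose, hFo']
  have hJ : ∀ x, F x * J0 N * (F x).transpose = (f x).1.1 := fun x => by
    rw [← hFJ, Matrix.mul_assoc, hFo', Matrix.mul_one]
  have hJ' : ∀ x, (F x).transpose * (f x).1.1 * (F x).transpose.transpose = J0 N := fun x => by
    rw [Matrix.transpose_transpose, Matrix.mul_assoc, hFJ, ← Matrix.mul_assoc, hFo, Matrix.one_mul]
  have hmem : ∀ x (y : GammaPlus N),
      (⟨F x * y.1.1 * (F x).transpose, conj_mem_gamma (hFo x) y.1.2⟩ : Gamma N) ∈ GammaPlus N :=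
    fun x y => conj_mem_gammaPlus (hFo x) (J0plus N).2
      (by
        convert (f x).2
        exact hJ x) y.2
  have hmem' : ∀ x (y : GammaPlus N),
      (⟨(F x).transpose * y.1.1 * (F x).transpose.transpose,
        conj_mem_gamma (hFt x) y.1.2⟩ : Gamma N) ∈ GammaPlus N :=
    fun x y => conj_mem_gammaPlus (hFt x) (f x).2
      (by
        convert (J0plus N).2
        exact hJ' x) y.2
  let Φ : C(Sph m × GammaPlus N, GammaPlus N) :=
    ⟨fun z => ⟨⟨_, conj_mem_gamma (hFo z.1) z.2.1.2⟩, hmem z.1 z.2⟩,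
      Continuous.subtype_mk (Continuous.subtype_mk (by fun_prop) _) _⟩
  let Ψ : C(Sph m × GammaPlus N, GammaPlus N) :=
    ⟨fun z => ⟨⟨_, conj_mem_gamma (hFt z.1) z.2.1.2⟩, hmem' z.1 z.2⟩,
      Continuous.subtype_mk (Continuous.subtype_mk (by fun_prop) _) _⟩
  have hΨΦ : ∀ x y, Ψ (x, Φ (x, y)) = y := fun x y => by
    refine Subtype.ext (Subtype.ext ?_)
    change (F x).transpose * (F x * y.1.1 * (F x).transpose) * (F x).transpose.transpose = _
    rw [Matrix.transpose_transpose, Matrix.mul_assoc, Matrix.mul_assoc, hFo, Matrix.mul_one,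
      ← Matrix.mul_assoc, hFo, Matrix.one_mul]
  have hΦΨ : ∀ x y, Φ (x, Ψ (x, y)) = y := fun x y => by
    refine Subtype.ext (Subtype.ext ?_)
    change F x * ((F x).transpose * y.1.1 * (F x).transpose.transpose) * (F x).transpose = _
    rw [Matrix.transpose_transpose, Matrix.mul_assoc, Matrix.mul_assoc, hFo', Matrix.mul_one,
      ← Matrix.mul_assoc, hFo', Matrix.one_mul]
  exact ⟨⟨⟨ContinuousMap.fiberwise Φ, ContinuousMap.fiberwise Ψ,
    fun g => ContinuousMap.ext fun x => hΨΦ x (g x),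
    fun g => ContinuousMap.ext fun x => hΦΨ x (g x)⟩, (ContinuousMap.fiberwise Φ).continuous,
    (ContinuousMap.fiberwise Ψ).continuous⟩,
    ContinuousMap.ext fun x => Subtype.ext (Subtype.ext (hJ x))⟩

end MappingSpaces

/-- For every `k ≥ 1` (written as `k + 1`) and every `f ∈ C(S^{2n+1}, Γ_{n+1}⁺)`,
`π_{k}(C(S^{2n+1}, Γ_{n+1}⁺), f) ≅ π_{k}(Γ_{n+1}⁺, J₀) × π_{2n+k+1}(Γ_{n+1}⁺, J₀)`. -/
theorem stmt4 (n : ℕ) (hn : 1 ≤ n) (k : ℕ)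
    (f : C(Sph (2 * n + 1), GammaPlus (n + 1))) :
    Nonempty ((π_ (k + 1) C(Sph (2 * n + 1), GammaPlus (n + 1)) f) ≃*
      (π_ (k + 1) (GammaPlus (n + 1)) (J0plus (n + 1))) ×
        (π_ (2 * n + k + 2) (GammaPlus (n + 1)) (J0plus (n + 1)))) := by
  obtain ⟨h, hf⟩ := exists_homeomorph_gammaPlus (odd_two_mul_add_one n) (by omega) f
  obtain ⟨e⟩ := nonempty_mulEquiv_of_isGottlieb (m := 2 * n + 1) (by omega) k
    (isGottlieb_J0plus (N := n + 1) (by omega))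
  exact ⟨(HomotopyGroup.mulEquivOfHomeomorph h hf).symm.trans (e.trans
    (MulEquiv.prodCongr (MulEquiv.refl _) (HomotopyGroup.mulEquivOfEquiv
      (finSumFinEquiv.trans (finCongr (by omega))))))⟩
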